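/- (Nondegeneracy.) Let n ≥ 2 and let (u,v) be a solution of Δu = u v², Δv = v u², u > 0, v > 0 on ℝⁿ satisfying the linear growth condition u(x) + v(x) ≤ C₀(1 + |x|) for some constant C₀ > 0. Then there exists a positive constant C such that for all r > 4, ∫_{∂B_r(0)} (u + v) ≥ r^n / C. -/

import Mathlib

open MeasureTheory Metric
open scoped RealInnerProductSpace

noncomputable section

/-- The Laplacian of a function on Euclidean space, as the trace of the second derivative. -/
def lap {n : ℕ} (u : EuclideanSpace ℝ (Fin n) → ℝ) (x : EuclideanSpace ℝ (Fin n)) : ℝ :=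
  ∑ i : Fin n, iteratedFDeriv ℝ 2 u x (fun _ => EuclideanSpace.single i 1)

/-- A (positive classical) solution of the system Δu = u v², Δv = v u², u,v > 0 on ℝⁿ. -/
def IsSolution {n : ℕ} (u v : EuclideanSpace ℝ (Fin n) → ℝ) : Prop :=
  ContDiff ℝ (⊤ : ℕ∞) u ∧ ContDiff ℝ (⊤ : ℕ∞) v ∧ (∀ x, 0 < u x) ∧ (∀ x, 0 < v x) ∧
    (∀ x, lap u x = u x * v x ^ 2) ∧ (∀ x, lap v x = v x * u x ^ 2)

/-- The bulk energy ∫_{B_r(x)} (|∇u|² + |∇v|² + u²v²). -/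
def bulk {n : ℕ} (u v : EuclideanSpace ℝ (Fin n) → ℝ) (x : EuclideanSpace ℝ (Fin n)) (r : ℝ) :
    ℝ :=
  ∫ y in ball x r, (‖gradient u y‖ ^ 2 + ‖gradient v y‖ ^ 2 + (u y) ^ 2 * (v y) ^ 2)

/-- The boundary mass ∫_{∂B_r(x)} (u² + v²), w.r.t. the (n-1)-dimensional surface
(Hausdorff) measure on the sphere. -/
def bdry {n : ℕ} (u v : EuclideanSpace ℝ (Fin n) → ℝ) (x : EuclideanSpace ℝ (Fin n)) (r : ℝ) :
    ℝ :=
  ∫ y in sphere x r, ((u y) ^ 2 + (v y) ^ 2) ∂μH[(n : ℝ) - 1]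

/-- The Almgren frequency N(r; x). -/
def freq {n : ℕ} (u v : EuclideanSpace ℝ (Fin n) → ℝ) (x : EuclideanSpace ℝ (Fin n)) (r : ℝ) :
    ℝ :=
  r * bulk u v x r / bdry u v x r

open scoped ContDiff

/-- Euclidean space of dimension `n`. -/
abbrev Eu (n : ℕ) := EuclideanSpace ℝ (Fin n)

/-- The `i`-th standard basis vector. -/
abbrev bv {n : ℕ} (i : Fin n) : Eu n := EuclideanSpace.single i (1 : ℝ)

/-- The `i`-th partial derivative. -/
def pd {n : ℕ} (i : Fin n) (f : Eu n → ℝ) (x : Eu n) : ℝ := fderiv ℝ f x (bv i)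

section PartialDerivatives

variable {n : ℕ} {f g : Eu n → ℝ}

lemma ContDiff.pd (hf : ContDiff ℝ ∞ f) (i : Fin n) : ContDiff ℝ ∞ (pd i f) := by
  have : ContDiff ℝ ∞ (fderiv ℝ f) := hf.fderiv_right (by simp)
  exact this.clm_apply contDiff_const

lemma ContDiff.diffble (hf : ContDiff ℝ ∞ f) : Differentiable ℝ f := hf.differentiable (by simp)

lemma eu_eq_sum (x : Eu n) : x = ∑ i, x i • bv i := by
  ext j
  simp [Finset.sum_apply, Pi.single_apply]

lemma fderiv_eq_sum_pd (f : Eu n → ℝ) (x v : Eu n) :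
    fderiv ℝ f x v = ∑ i, v i * pd i f x := by
  conv_lhs => rw [eu_eq_sum v]
  simp [pd]

lemma lap_eq_sum_pd (hf : ContDiff ℝ ∞ f) (x : Eu n) : lap f x = ∑ i, pd i (pd i f) x := by
  unfold lap
  refine Finset.sum_congr rfl fun i _ => ?_
  rw [iteratedFDeriv_two_apply]
  have h : DifferentiableAt ℝ (fderiv ℝ f) x :=
    ((hf.fderiv_right (m := ∞) (by simp)).differentiable (by simp)) x
  have : fderiv ℝ (pd i f) x =
      (ContinuousLinearMap.apply ℝ ℝ (bv i)).comp (fderiv ℝ (fderiv ℝ f) x) := by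
    have := (ContinuousLinearMap.apply ℝ ℝ (bv i)).hasFDerivAt.comp x h.hasFDerivAt
    exact this.fderiv
  rw [pd, this]
  rfl

lemma pd_comm (hf : ContDiff ℝ ∞ f) (i j : Fin n) (x : Eu n) :
    pd i (pd j f) x = pd j (pd i f) x := by
  have h : DifferentiableAt ℝ (fderiv ℝ f) x :=
    ((hf.fderiv_right (m := ∞) (by simp)).differentiable (by simp)) x
  have key : ∀ i j : Fin n, pd i (pd j f) x = fderiv ℝ (fderiv ℝ f) x (bv i) (bv j) := by
    intro i j
    have : fderiv ℝ (pd j f) x =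
        (ContinuousLinearMap.apply ℝ ℝ (bv j)).comp (fderiv ℝ (fderiv ℝ f) x) := by
      have := (ContinuousLinearMap.apply ℝ ℝ (bv j)).hasFDerivAt.comp x h.hasFDerivAt
      exact this.fderiv
    rw [pd, this]
    rfl
  rw [key, key]
  have := (hf.contDiffAt (x := x)).isSymmSndFDerivAt
    (by
      simp only [minSmoothness_of_isRCLikeNormedField]
      exact WithTop.coe_le_coe.2 (le_top : (2 : ℕ∞) ≤ ⊤))
  exact this (bv i) (bv j)

lemma pd_add (hf : Differentiable ℝ f) (hg : Differentiable ℝ g) (i : Fin n) :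
    pd i (fun x => f x + g x) = fun x => pd i f x + pd i g x := by
  ext x; simp [pd, fderiv_fun_add (hf x) (hg x)]

lemma pd_sub (hf : Differentiable ℝ f) (hg : Differentiable ℝ g) (i : Fin n) :
    pd i (fun x => f x - g x) = fun x => pd i f x - pd i g x := by
  ext x; simp [pd, fderiv_fun_sub (hf x) (hg x)]

lemma pd_const_mul (hf : Differentiable ℝ f) (c : ℝ) (i : Fin n) :
    pd i (fun x => c * f x) = fun x => c * pd i f x := by
  ext x; simp [pd, fderiv_const_mul (hf x) c]

lemma pd_mul (hf : Differentiable ℝ f) (hg : Differentiable ℝ g) (i : Fin n) :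
    pd i (fun x => f x * g x) = fun x => f x * pd i g x + g x * pd i f x := by
  ext x; simp [pd, fderiv_fun_mul (hf x) (hg x)]

lemma pd_sum {ι : Type*} (s : Finset ι) {F : ι → Eu n → ℝ} (hF : ∀ k ∈ s, Differentiable ℝ (F k))
    (i : Fin n) : pd i (fun x => ∑ k ∈ s, F k x) = fun x => ∑ k ∈ s, pd i (F k) x := by
  ext x
  simp only [pd]
  rw [fderiv_fun_sum (fun k hk => hF k hk x)]
  simp

lemma pd_comp (hf : Differentiable ℝ f) {φ : ℝ → ℝ} (hφ : Differentiable ℝ φ) (i : Fin n) :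
    pd i (fun x => φ (f x)) = fun x => deriv φ (f x) * pd i f x := by
  ext x
  have := ((hφ (f x)).hasDerivAt.comp_hasFDerivAt x (hf x).hasFDerivAt).fderiv
  simp only [pd]
  erw [this]
  simp

lemma pd_coord (i j : Fin n) : pd i (fun x : Eu n => x j) = fun _ => if j = i then 1 else 0 := by
  ext x
  have : fderiv ℝ (fun x : Eu n => x j) x = EuclideanSpace.proj j :=
    (EuclideanSpace.proj j : Eu n →L[ℝ] ℝ).fderiv
  simp [pd, this]

lemma pd_comp_affine (hf : Differentiable ℝ f) (A : Eu n →L[ℝ] Eu n) (a : Eu n) (i : Fin n)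
    (x : Eu n) : pd i (fun y => f (a + A y)) x = fderiv ℝ f (a + A x) (A (bv i)) := by
  have h1 : HasFDerivAt (fun y => a + A y) A x := by
    simpa using A.hasFDerivAt.const_add a
  have := ((hf (a + A x)).hasFDerivAt.comp x h1).fderiv
  simp only [pd]
  erw [this]
  rfl

lemma pd_translate_smul (hf : Differentiable ℝ f) (a : Eu n) (r : ℝ) (i : Fin n) :
    pd i (fun y => f (a + r • y)) = fun y => r * pd i f (a + r • y) := by
  ext x
  have := pd_comp_affine hf (r • ContinuousLinearMap.id ℝ (Eu n)) a i x
  simpa [pd] using this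

lemma hasDerivAt_line (hf : Differentiable ℝ f) (x v : Eu n) (t : ℝ) :
    HasDerivAt (fun t => f (x + t • v)) (fderiv ℝ f (x + t • v) v) t := by
  have h1 : HasDerivAt (fun t : ℝ => x + t • v) v t := by
    simpa using ((hasDerivAt_id t).smul_const v).const_add x
  exact (hf _).hasFDerivAt.comp_hasDerivAt t h1

end PartialDerivatives

/-- Weak second derivative test: at a local maximum the Laplacian is nonpositive. -/
lemma lap_nonpos_of_isLocalMax {n : ℕ} {f : Eu n → ℝ} (hf : ContDiff ℝ ∞ f) {x : Eu n}
    (hx : IsLocalMax f x) : ∑ i, pd i (pd i f) x ≤ 0 := by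
  refine Finset.sum_nonpos fun i _ => ?_
  by_contra! hpos
  set g : ℝ → ℝ := fun t => f (x + t • bv i) with hg
  have hd : deriv g = fun t => pd i f (x + t • bv i) := by
    ext t; exact (hasDerivAt_line hf.diffble x (bv i) t).deriv
  have hdd : deriv (deriv g) = fun t => pd i (pd i f) (x + t • bv i) := by
    rw [hd]; ext t; exact (hasDerivAt_line (hf.pd i).diffble x (bv i) t).deriv
  have hcont : Continuous (fun t : ℝ => x + t • bv i) := by fun_prop
  have hmax : IsLocalMax g 0 := by
    have : Filter.Tendsto (fun t : ℝ => x + t • bv i) (nhds 0) (nhds x) := by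
      have := hcont.tendsto 0; simpa using this
    have h2 := this.eventually hx
    simpa [IsLocalMax, IsMaxFilter, hg] using h2
  have hgc : Continuous g := hf.continuous.comp hcont
  have hmin := isLocalMin_of_deriv_deriv_pos (f := g) (x₀ := 0) (by rw [hdd]; simpa using hpos)
    hmax.deriv_eq_zero hgc.continuousAt
  have hc : g =ᶠ[nhds 0] fun _ => g 0 := by
    filter_upwards [hmax, hmin] with t h1 h2 using le_antisymm h1 h2
  have h3 := hc.deriv.deriv.eq_of_nhds
  rw [hdd] at h3
  simp at h3
  linarith

/-- The Laplacian as the sum of the pure second partial derivatives. -/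
def Lap {n : ℕ} (f : Eu n → ℝ) (x : Eu n) : ℝ := ∑ i, pd i (pd i f) x

section Laplacian

variable {n : ℕ} {f g : Eu n → ℝ}

lemma Lap_add (hf : ContDiff ℝ ∞ f) (hg : ContDiff ℝ ∞ g) :
    Lap (fun x => f x + g x) = fun x => Lap f x + Lap g x := by
  ext x
  simp [Lap, pd_add hf.diffble hg.diffble, pd_add (hf.pd _).diffble (hg.pd _).diffble,
    Finset.sum_add_distrib]

lemma Lap_sub (hf : ContDiff ℝ ∞ f) (hg : ContDiff ℝ ∞ g) :
    Lap (fun x => f x - g x) = fun x => Lap f x - Lap g x := by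
  ext x
  simp [Lap, pd_sub hf.diffble hg.diffble, pd_sub (hf.pd _).diffble (hg.pd _).diffble,
    Finset.sum_sub_distrib]

lemma Lap_const_mul (hf : ContDiff ℝ ∞ f) (c : ℝ) :
    Lap (fun x => c * f x) = fun x => c * Lap f x := by
  ext x
  simp [Lap, pd_const_mul hf.diffble, pd_const_mul (hf.pd _).diffble, Finset.mul_sum]

lemma Lap_sum {ι : Type*} (s : Finset ι) {F : ι → Eu n → ℝ} (hF : ∀ k, ContDiff ℝ ∞ (F k)) :
    Lap (fun x => ∑ k ∈ s, F k x) = fun x => ∑ k ∈ s, Lap (F k) x := by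
  ext x
  simp only [Lap]
  rw [Finset.sum_comm]
  refine Finset.sum_congr rfl fun i _ => ?_
  rw [pd_sum s (fun k _ => (hF k).diffble), pd_sum s (fun k _ => ((hF k).pd i).diffble)]

lemma Lap_mul (hf : ContDiff ℝ ∞ f) (hg : ContDiff ℝ ∞ g) :
    Lap (fun x => f x * g x) =
      fun x => f x * Lap g x + g x * Lap f x + 2 * ∑ i, pd i f x * pd i g x := by
  ext x
  simp only [Lap, Finset.mul_sum, ← Finset.sum_add_distrib]
  refine Finset.sum_congr rfl fun i _ => ?_
  rw [pd_mul hf.diffble hg.diffble,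
    pd_add (hf.diffble.fun_mul (hg.pd i).diffble) (hg.diffble.fun_mul (hf.pd i).diffble),
    pd_mul hf.diffble (hg.pd i).diffble, pd_mul hg.diffble (hf.pd i).diffble]
  ring

lemma contDiff_coord (j : Fin n) : ContDiff ℝ ∞ (fun x : Eu n => x j) :=
  (EuclideanSpace.proj j : Eu n →L[ℝ] ℝ).contDiff

lemma pd_const (c : ℝ) (i : Fin n) : pd i (fun _ : Eu n => c) = fun _ => 0 := by
  ext x; simp [pd]

lemma Lap_coord (j : Fin n) : Lap (fun x : Eu n => x j) = fun _ => 0 := by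
  ext x
  simp [Lap, pd_coord, pd_const]

lemma Lap_coord_mul_self (j : Fin n) : Lap (fun x : Eu n => x j * x j) = fun _ => 2 := by
  rw [Lap_mul (contDiff_coord j) (contDiff_coord j)]
  ext x
  simp [Lap_coord, pd_coord]

lemma pd_Lap (hf : ContDiff ℝ ∞ f) (j : Fin n) : pd j (Lap f) = Lap (pd j f) := by
  ext x
  have : Lap f = fun x => ∑ i ∈ Finset.univ, pd i (pd i f) x := rfl
  rw [this, pd_sum _ (fun i _ => ((hf.pd i).pd i).diffble)]
  simp only [Lap]
  refine Finset.sum_congr rfl fun i _ => ?_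
  rw [pd_comm (hf.pd i)]
  congr 1
  ext y
  exact pd_comm hf j i y

end Laplacian

/-- Reflection of the `i`-th coordinate. -/
def coordRefl {n : ℕ} (i : Fin n) : Eu n →L[ℝ] Eu n :=
  ContinuousLinearMap.id ℝ (Eu n) -
    (2 : ℝ) • (EuclideanSpace.proj i : Eu n →L[ℝ] ℝ).smulRight (bv i)

lemma coordRefl_apply {n : ℕ} (i : Fin n) (x : Eu n) : coordRefl i x = x - (2 * x i) • bv i := by
  simp [coordRefl, smul_smul]

lemma coordRefl_bv {n : ℕ} (i j : Fin n) :
    coordRefl i (bv j) = (if j = i then (-1 : ℝ) else 1) • bv j := by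
  rw [coordRefl_apply]
  by_cases h : j = i
  · subst h; simp only [PiLp.single_apply, if_true]; module
  · have : i ≠ j := fun h' => h h'.symm
    simp [h, this]

lemma norm_coordRefl {n : ℕ} (i : Fin n) (x : Eu n) : ‖coordRefl i x‖ = ‖x‖ := by
  rw [EuclideanSpace.norm_eq, EuclideanSpace.norm_eq]
  congr 1
  refine Finset.sum_congr rfl fun j _ => ?_
  rw [coordRefl_apply]
  by_cases h : j = i
  · subst h; simp; ring_nf
  · simp [h]

lemma Lap_comp_coordRefl {n : ℕ} {F : Eu n → ℝ} (hF : ContDiff ℝ ∞ F) (p : Eu n) (i : Fin n)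
    (x : Eu n) :
    Lap (fun y => F (p + coordRefl i y)) x = Lap F (p + coordRefl i x) := by
  have key : ∀ {G : Eu n → ℝ} (_ : Differentiable ℝ G) (j : Fin n),
      pd j (fun y => G (p + coordRefl i y)) =
        fun y => (if j = i then (-1 : ℝ) else 1) * pd j G (p + coordRefl i y) := by
    intro G hG j
    ext y
    rw [pd_comp_affine hG, coordRefl_bv, map_smul]
    rfl
  simp only [Lap]
  refine Finset.sum_congr rfl fun j _ => ?_
  have hd : Differentiable ℝ (fun y => pd j F (p + coordRefl i y)) :=
    (hF.pd j).diffble.comp ((coordRefl i).differentiable.const_add p)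
  rw [key hF.diffble, pd_const_mul hd, key (hF.pd j).diffble]
  split_ifs <;> ring

lemma Lap_comp_translate {n : ℕ} {F : Eu n → ℝ} (hF : ContDiff ℝ ∞ F) (p x : Eu n) :
    Lap (fun y => F (p + y)) x = Lap F (p + x) := by
  have key : ∀ {G : Eu n → ℝ} (_ : Differentiable ℝ G) (j : Fin n),
      pd j (fun y => G (p + y)) = fun y => pd j G (p + y) := by
    intro G hG j
    simpa using pd_translate_smul hG p 1 j
  simp only [Lap]
  refine Finset.sum_congr rfl fun j _ => ?_
  rw [key hF.diffble, key (hF.pd j).diffble]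

lemma pd_le_of_bounds {n : ℕ} {F : Eu n → ℝ} (hF : ContDiff ℝ ∞ F) (p : Eu n) (i : Fin n)
    {A N : ℝ} (hA : ∀ x, ‖x‖ ≤ 1 → |F (p + x)| ≤ A) (hN : ∀ x, ‖x‖ ≤ 1 → |Lap F (p + x)| ≤ N) :
    pd i F p ≤ (2 * n + 3) * (A + N + 1) := by
  set M : ℝ := A + N + 1 with hM
  have hA0 : 0 ≤ A := (abs_nonneg _).trans (hA 0 (by simp))
  have hN0 : 0 ≤ N := (abs_nonneg _).trans (hN 0 (by simp))
  have hM0 : 0 < M := by positivity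
  have hF1 : ContDiff ℝ ∞ (fun y => F (p + y)) := hF.comp (contDiff_const.add contDiff_id)
  have hF2 : ContDiff ℝ ∞ (fun y => F (p + coordRefl i y)) :=
    hF.comp (contDiff_const.add (coordRefl i).contDiff)
  set φ : Eu n → ℝ := fun y => (1 / 2) * (F (p + y) - F (p + coordRefl i y)) with hφ
  have hφs : ContDiff ℝ ∞ φ := contDiff_const.mul (hF1.sub hF2)
  have hsq : ∀ j, ContDiff ℝ ∞ (fun x : Eu n => x j * x j) :=
    fun j => (contDiff_coord j).mul (contDiff_coord j)
  set ψ : Eu n → ℝ := fun y => M * ((∑ j, y j * y j) + (n + 1) * (2 * y i - y i * y i)) with hψ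
  have hψs1 : ContDiff ℝ ∞ (fun y : Eu n => ∑ j, y j * y j) := ContDiff.sum fun j _ => hsq j
  have hψs2 : ContDiff ℝ ∞ (fun y : Eu n => 2 * y i - y i * y i) :=
    (contDiff_const.mul (contDiff_coord i)).sub (hsq i)
  have hψs : ContDiff ℝ ∞ ψ :=
    contDiff_const.mul (hψs1.add (contDiff_const.mul hψs2))
  have hLψ : ∀ x, Lap ψ x = -2 * M := by
    intro x
    rw [hψ, Lap_const_mul (hψs1.add (contDiff_const.mul hψs2)),
      Lap_add hψs1 (contDiff_const.mul hψs2), Lap_const_mul hψs2,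
      Lap_sub (contDiff_const.mul (contDiff_coord i)) (hsq i), Lap_const_mul (contDiff_coord i),
      Lap_sum _ hsq]
    simp [Lap_coord, Lap_coord_mul_self]
    ring
  have hLφ : ∀ x, ‖x‖ ≤ 1 → -N ≤ Lap φ x := by
    intro x hx
    rw [hφ, Lap_const_mul (hF1.sub hF2), Lap_sub hF1 hF2]
    beta_reduce
    rw [Lap_comp_coordRefl hF, Lap_comp_translate hF]
    have h1 := abs_le.1 (hN x hx)
    have h2 := abs_le.1 (hN (coordRefl i x) (by rw [norm_coordRefl]; exact hx))
    linarith
  have hnorm : ∀ y : Eu n, ∑ j, y j * y j = ‖y‖ ^ 2 := by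
    intro y
    rw [EuclideanSpace.norm_sq_eq]
    simp [sq]
  have hcoord : ∀ y : Eu n, |y i| ≤ ‖y‖ := fun y => by
    simpa using PiLp.norm_apply_le y i
  set K : Set (Eu n) := closedBall 0 1 ∩ {x | 0 ≤ x i} with hK
  have hKc : IsCompact K := (isCompact_closedBall 0 1).inter_right
    (isClosed_le continuous_const (contDiff_coord i).continuous)
  have hK0 : (0 : Eu n) ∈ K := by simp [hK]
  have hGs : ContDiff ℝ ∞ (fun x => φ x - ψ x) := hφs.sub hψs
  obtain ⟨x0, hx0, hmax⟩ := hKc.exists_isMaxOn ⟨0, hK0⟩ hGs.continuous.continuousOn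
  have hx0' : ‖x0‖ ≤ 1 := by simpa using hx0.1
  have hx0i : 0 ≤ x0 i := hx0.2
  have hx0i1 : x0 i ≤ 1 := (le_abs_self _).trans ((hcoord x0).trans hx0')
  have hquad : 0 ≤ (n + 1 : ℝ) * (2 * x0 i - x0 i * x0 i) := by
    have : 0 ≤ x0 i * (2 - x0 i) := mul_nonneg hx0i (by linarith)
    have hn : (0 : ℝ) ≤ n := Nat.cast_nonneg n
    apply mul_nonneg (by linarith); linarith
  have hle0 : φ x0 - ψ x0 ≤ 0 := by
    rcases eq_or_lt_of_le hx0' with h1 | h1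
    · have a1 := abs_le.1 (hA x0 hx0')
      have a2 := abs_le.1 (hA (coordRefl i x0) (by rw [norm_coordRefl]; exact hx0'))
      have a3 : M ≤ ψ x0 := by
        simp only [hψ, hnorm, h1]
        nlinarith
      have a4 : φ x0 ≤ A := by simp only [hφ]; linarith
      linarith
    · rcases eq_or_lt_of_le hx0i with h2 | h2
      · have a1 : φ x0 = 0 := by
          simp only [hφ, coordRefl_apply, ← h2]; simp
        have a2 : 0 ≤ ψ x0 := by
          simp only [hψ, hnorm]; positivity
        linarith
      · exfalso
        have hnhds : K ∈ nhds x0 := by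
          refine Filter.inter_mem (closedBall_mem_nhds_of_mem (by simpa using h1)) ?_
          exact (isOpen_lt continuous_const (contDiff_coord i).continuous).mem_nhds h2 |>
            Filter.mem_of_superset <| fun y (hy : 0 < y i) => hy.le
        have hl := lap_nonpos_of_isLocalMax hGs (hmax.isLocalMax hnhds)
        have : Lap (fun x => φ x - ψ x) x0 ≤ 0 := hl
        rw [Lap_sub hφs hψs] at this
        beta_reduce at this
        rw [hLψ] at this
        have := hLφ x0 hx0'
        linarith
  have hall : ∀ t : ℝ, 0 < t → t < 1 →
      (1 / 2) * (F (p + t • bv i) - F (p + t • (-bv i))) ≤ (2 * n + 3) * M * t := by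
    intro t ht ht1
    have hmem : t • bv i ∈ K := by
      refine ⟨?_, ?_⟩
      · simp [norm_smul, abs_of_pos ht, ht1.le]
      · simp [ht.le]
    have h1 : φ (t • bv i) - ψ (t • bv i) ≤ φ x0 - ψ x0 := hmax hmem
    have h2 : φ (t • bv i) ≤ ψ (t • bv i) := by
      linarith
    have h3 : coordRefl i (t • bv i) = t • (-bv i) := by rw [map_smul, coordRefl_bv]; simp
    have h4 : ψ (t • bv i) = M * (t ^ 2 + (n + 1) * (2 * t - t * t)) := by
      simp only [hψ, hnorm]
      simp [norm_smul, abs_of_pos ht]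
    have h5 : φ (t • bv i) = (1 / 2) * (F (p + t • bv i) - F (p + t • (-bv i))) := by
      simp only [hφ, h3]
    rw [← h5]
    refine h2.trans ?_
    rw [h4]
    have hn : (0 : ℝ) ≤ n := Nat.cast_nonneg n
    have : t ^ 2 + (n + 1) * (2 * t - t * t) ≤ (2 * n + 3) * t := by nlinarith [mul_nonneg hn ht.le]
    nlinarith
  have hder : HasDerivAt (fun t : ℝ => (1 / 2) * (F (p + t • bv i) - F (p + t • (-bv i))))
      (pd i F p) 0 := by
    have d1 := hasDerivAt_line hF.diffble p (bv i) 0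
    have d2 := hasDerivAt_line hF.diffble p (-bv i) 0
    refine HasDerivAt.congr_deriv ((d1.sub d2).const_mul (1 / 2)) ?_
    simp only [zero_smul, add_zero, map_neg, pd]
    ring
  have hs := hder.hasDerivWithinAt (s := Set.Ioi 0)
  rw [hasDerivWithinAt_iff_tendsto_slope' (by simp)] at hs
  refine le_of_tendsto hs ?_
  have : Set.Ioo (0 : ℝ) 1 ∈ nhdsWithin 0 (Set.Ioi 0) := Ioo_mem_nhdsGT one_pos
  filter_upwards [this] with t ht
  rw [slope_def_field]
  simp only [zero_smul, add_zero, sub_self, mul_zero, sub_zero] at *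
  rw [div_le_iff₀ ht.1]
  exact hall t ht.1 ht.2

/-- Interior gradient estimate for functions with bounded Laplacian. -/
lemma abs_pd_le_of_bounds {n : ℕ} {F : Eu n → ℝ} (hF : ContDiff ℝ ∞ F) (p : Eu n) (i : Fin n)
    {A N : ℝ} (hA : ∀ x, ‖x‖ ≤ 1 → |F (p + x)| ≤ A) (hN : ∀ x, ‖x‖ ≤ 1 → |Lap F (p + x)| ≤ N) :
    |pd i F p| ≤ (2 * n + 3) * (A + N + 1) := by
  refine abs_le.2 ⟨?_, pd_le_of_bounds hF p i hA hN⟩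
  have h := pd_le_of_bounds (F := fun x => (-1) * F x) (contDiff_const.mul hF) p i (A := A) (N := N)
    (by simpa using hA) (by rw [Lap_const_mul hF]; simpa using hN)
  rw [pd_const_mul hF.diffble] at h
  linarith

/-- Polynomially bounded functions. -/
def PB {n : ℕ} (f : Eu n → ℝ) : Prop := ∃ (k : ℕ) (C : ℝ), ∀ x, |f x| ≤ C * (1 + ‖x‖) ^ k

/-- Smooth functions all of whose partial derivatives up to order `k` are polynomially bounded. -/
def PG {n : ℕ} : ℕ → (Eu n → ℝ) → Prop
  | 0, f => ContDiff ℝ ∞ f ∧ PB f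
  | k + 1, f => (ContDiff ℝ ∞ f ∧ PB f) ∧ ∀ i, PG k (pd i f)

section PolynomialGrowth

variable {n : ℕ} {f g : Eu n → ℝ}

lemma PB.add (hf : PB f) (hg : PB g) : PB (fun x => f x + g x) := by
  obtain ⟨k, C, h⟩ := hf
  obtain ⟨l, C', h'⟩ := hg
  refine ⟨k + l, |C| + |C'|, fun x => ?_⟩
  have h1 : (1 : ℝ) ≤ 1 + ‖x‖ := by linarith [norm_nonneg x]
  have e1 : (1 + ‖x‖) ^ k ≤ (1 + ‖x‖) ^ (k + l) := pow_le_pow_right₀ h1 (by omega)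
  have e2 : (1 + ‖x‖) ^ l ≤ (1 + ‖x‖) ^ (k + l) := pow_le_pow_right₀ h1 (by omega)
  calc |f x + g x| ≤ |f x| + |g x| := abs_add_le _ _
    _ ≤ |C| * (1 + ‖x‖) ^ k + |C'| * (1 + ‖x‖) ^ l := by
      gcongr
      · exact (h x).trans (by gcongr; exact le_abs_self C)
      · exact (h' x).trans (by gcongr; exact le_abs_self C')
    _ ≤ |C| * (1 + ‖x‖) ^ (k + l) + |C'| * (1 + ‖x‖) ^ (k + l) := by gcongr
    _ = _ := by ring

lemma PB.mul (hf : PB f) (hg : PB g) : PB (fun x => f x * g x) := by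
  obtain ⟨k, C, h⟩ := hf
  obtain ⟨l, C', h'⟩ := hg
  refine ⟨k + l, C * C', fun x => ?_⟩
  rw [abs_mul]
  calc |f x| * |g x| ≤ (C * (1 + ‖x‖) ^ k) * (C' * (1 + ‖x‖) ^ l) :=
        mul_le_mul (h x) (h' x) (abs_nonneg _) ((abs_nonneg _).trans (h x))
    _ = _ := by ring

lemma PG.smooth {k : ℕ} (hf : PG k f) : ContDiff ℝ ∞ f := by
  cases k with
  | zero => exact hf.1
  | succ k => exact hf.1.1

lemma PG.pb {k : ℕ} (hf : PG k f) : PB f := by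
  cases k with
  | zero => exact hf.2
  | succ k => exact hf.1.2

lemma PG.of_succ {k : ℕ} (hf : PG (k + 1) f) : PG k f := by
  induction k generalizing f with
  | zero => exact hf.1
  | succ k ih => exact ⟨hf.1, fun i => ih (hf.2 i)⟩

lemma PG.add {k : ℕ} (hf : PG k f) (hg : PG k g) : PG k (fun x => f x + g x) := by
  induction k generalizing f g with
  | zero => exact ⟨hf.1.add hg.1, hf.2.add hg.2⟩
  | succ k ih =>
    refine ⟨⟨hf.smooth.add hg.smooth, hf.pb.add hg.pb⟩, fun i => ?_⟩
    rw [pd_add hf.smooth.diffble hg.smooth.diffble]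
    exact ih (hf.2 i) (hg.2 i)

lemma PG.mul {k : ℕ} (hf : PG k f) (hg : PG k g) : PG k (fun x => f x * g x) := by
  induction k generalizing f g with
  | zero => exact ⟨hf.1.mul hg.1, hf.2.mul hg.2⟩
  | succ k ih =>
    refine ⟨⟨hf.smooth.mul hg.smooth, hf.pb.mul hg.pb⟩, fun i => ?_⟩
    rw [pd_mul hf.smooth.diffble hg.smooth.diffble]
    exact (ih hf.of_succ (hg.2 i)).add (ih hg.of_succ (hf.2 i))

lemma PB.pd_of_Lap (hs : ContDiff ℝ ∞ f) (hf : PB f) (hL : PB (Lap f)) (i : Fin n) :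
    PB (pd i f) := by
  obtain ⟨k, C, h⟩ := hf
  obtain ⟨l, C', h'⟩ := hL
  refine ⟨k + l, (2 * n + 3) * (|C| * 2 ^ k + |C'| * 2 ^ l + 1), fun p => ?_⟩
  have h1 : (1 : ℝ) ≤ 1 + ‖p‖ := by linarith [norm_nonneg p]
  have hb : ∀ x : Eu n, ‖x‖ ≤ 1 → 1 + ‖p + x‖ ≤ 2 * (1 + ‖p‖) := fun x hx => by
    linarith [norm_add_le p x, norm_nonneg p]
  have := abs_pd_le_of_bounds hs p i (A := |C| * (2 * (1 + ‖p‖)) ^ k)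
    (N := |C'| * (2 * (1 + ‖p‖)) ^ l)
    (fun x hx => (h _).trans (by gcongr; exacts [le_abs_self C, hb x hx]))
    (fun x hx => (h' _).trans (by gcongr; exacts [le_abs_self C', hb x hx]))
  have e0 : 1 ≤ (1 + ‖p‖) ^ (k + l) := one_le_pow₀ h1
  have e1 : (1 + ‖p‖) ^ k ≤ (1 + ‖p‖) ^ (k + l) := pow_le_pow_right₀ h1 (by omega)
  have e2 : (1 + ‖p‖) ^ l ≤ (1 + ‖p‖) ^ (k + l) := pow_le_pow_right₀ h1 (by omega)
  refine this.trans ?_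
  rw [mul_pow, mul_pow]
  calc _ ≤ (2 * n + 3) * (|C| * (2 ^ k * (1 + ‖p‖) ^ (k + l)) + |C'| * (2 ^ l * (1 + ‖p‖) ^ (k + l))
        + (1 + ‖p‖) ^ (k + l)) := by gcongr
    _ = _ := by ring

lemma PG.of_Lap {k : ℕ} (hf : PG k f) (hL : PG k (Lap f)) : PG (k + 1) f := by
  induction k generalizing f with
  | zero => exact ⟨hf, fun i => ⟨hf.smooth.pd i, hf.pb.pd_of_Lap hf.smooth hL.pb i⟩⟩
  | succ k ih =>
    refine ⟨hf.1, fun i => ih (hf.2 i) ?_⟩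
    rw [← pd_Lap hf.smooth]
    exact hL.2 i

lemma hasTemperateGrowth_of_PG (hf : ∀ k, PG k f) : f.HasTemperateGrowth := by
  refine ⟨(hf 0).smooth, fun m => ?_⟩
  induction m generalizing f with
  | zero =>
    obtain ⟨k, C, h⟩ := (hf 0).pb
    exact ⟨k, C, fun x => by simpa using h x⟩
  | succ m ih =>
    have hpd : ∀ i, ∀ k, PG k (pd i f) := fun i k => (hf (k + 1)).2 i
    choose k C h using fun i => ih (hpd i)
    refine ⟨∑ i, k i, ∑ i, |C i|, fun x => ?_⟩
    have hs := (hf 0).smooth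
    have h1 : (1 : ℝ) ≤ 1 + ‖x‖ := by linarith [norm_nonneg x]
    have hfd : fderiv ℝ f = fun x => ∑ i, (ContinuousLinearMap.smulRightL ℝ (Eu n) ℝ
        (EuclideanSpace.proj i)) (pd i f x) := by
      ext x v
      rw [fderiv_eq_sum_pd]
      simp
    rw [← norm_iteratedFDeriv_fderiv, hfd, iteratedFDeriv_fun_sum_apply]
    · refine (norm_sum_le _ _).trans ?_
      rw [Finset.sum_mul]
      refine Finset.sum_le_sum fun i _ => ?_
      have hle := ContinuousLinearMap.norm_iteratedFDeriv_comp_left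
        (ContinuousLinearMap.smulRightL ℝ (Eu n) ℝ (EuclideanSpace.proj i))
        (f := pd i f) (x := x) (n := m) (hs.pd i).contDiffAt
        (WithTop.coe_le_coe.2 (le_top : (m : ℕ∞) ≤ ⊤))
      have hnorm : ‖ContinuousLinearMap.smulRightL ℝ (Eu n) ℝ (EuclideanSpace.proj i)‖ ≤ 1 := by
        refine ContinuousLinearMap.opNorm_le_bound _ zero_le_one fun c => ?_
        refine ContinuousLinearMap.opNorm_le_bound _ (by positivity) fun v => ?_
        rw [ContinuousLinearMap.smulRightL_apply_apply, ContinuousLinearMap.smulRight_apply,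
          norm_smul, one_mul, mul_comm]
        gcongr
        exact PiLp.norm_apply_le v i
      refine hle.trans ?_
      calc _ ≤ 1 * (|C i| * (1 + ‖x‖) ^ (k i)) := by
            gcongr
            exact (h i x).trans (by gcongr; exact le_abs_self _)
        _ ≤ _ := by
          rw [one_mul]
          gcongr
          exact Finset.single_le_sum (f := k) (fun _ _ => Nat.zero_le _) (Finset.mem_univ i)
    · intro i _
      exact (((ContinuousLinearMap.contDiff _).comp (hs.pd i)).of_le
        (WithTop.coe_le_coe.2 (le_top : (m : ℕ∞) ≤ ⊤))).contDiffAt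

lemma PG_solution {u v : Eu n → ℝ} (hu : ContDiff ℝ ∞ u) (hv : ContDiff ℝ ∞ v)
    (hup : PB u) (hvp : PB v) (hLu : ∀ x, Lap u x = u x * v x ^ 2)
    (hLv : ∀ x, Lap v x = v x * u x ^ 2) (k : ℕ) : PG k u ∧ PG k v := by
  have e1 : Lap u = fun x => u x * (v x * v x) := by ext x; rw [hLu]; ring
  have e2 : Lap v = fun x => v x * (u x * u x) := by ext x; rw [hLv]; ring
  induction k with
  | zero => exact ⟨⟨hu, hup⟩, ⟨hv, hvp⟩⟩
  | succ k ih =>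
    obtain ⟨a, b⟩ := ih
    exact ⟨a.of_Lap (e1 ▸ a.mul (b.mul b)), b.of_Lap (e2 ▸ b.mul (a.mul a))⟩

end PolynomialGrowth

/-- The standard Gaussian measure on `ℝⁿ`. -/
def gam (n : ℕ) : Measure (Eu n) := ProbabilityTheory.stdGaussian (Eu n)

instance (n : ℕ) : IsProbabilityMeasure (gam n) := by unfold gam; infer_instance
instance (n : ℕ) : ProbabilityTheory.IsGaussian (gam n) := by unfold gam; infer_instance

/-- Total mass of the unnormalised Gaussian weight. -/
def gmass (n : ℕ) : ℝ := ∫ z : Eu n, Real.exp (-(1 / 2) * ‖z‖ ^ 2)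

/-- The standard Gaussian density. -/
def gdens {n : ℕ} (z : Eu n) : ℝ := (gmass n)⁻¹ * Real.exp (-(1 / 2) * ‖z‖ ^ 2)

lemma gmass_pos (n : ℕ) : 0 < gmass n := by
  unfold gmass
  rw [GaussianFourier.integral_rexp_neg_mul_sq_norm (by norm_num)]
  positivity

lemma gdens_pos {n : ℕ} (z : Eu n) : 0 < gdens z := by
  unfold gdens; have := gmass_pos n; positivity

lemma integrable_exp_neg {n : ℕ} : Integrable (fun z : Eu n => Real.exp (-(1 / 2) * ‖z‖ ^ 2)) := by
  by_contra h
  have := gmass_pos n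
  rw [gmass, integral_undef h] at this
  exact lt_irrefl _ this

lemma measurable_gdens {n : ℕ} : Measurable (gdens (n := n)) := by
  unfold gdens; fun_prop

lemma gam_eq_withDensity (n : ℕ) :
    gam n = (volume : Measure (Eu n)).withDensity (fun z => ENNReal.ofReal (gdens z)) := by
  have hfin : IsFiniteMeasure
      ((volume : Measure (Eu n)).withDensity (fun z => ENNReal.ofReal (gdens z))) :=
    isFiniteMeasure_withDensity_ofReal (integrable_exp_neg.const_mul _).2
  refine Measure.ext_of_charFun ?_
  ext t
  rw [gam, ProbabilityTheory.charFun_stdGaussian, charFun_apply,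
    integral_withDensity_eq_integral_toReal_smul (measurable_gdens.ennreal_ofReal)
      (by simp)]
  have hP : ((gmass n : ℝ) : ℂ) =
      (Real.pi / (1 / 2 : ℂ)) ^ (Module.finrank ℝ (Eu n) / 2 : ℂ) := by
    rw [← GaussianFourier.integral_cexp_neg_mul_sq_norm (by norm_num), gmass,
      ← integral_complex_ofReal]
    refine integral_congr_ae (Filter.Eventually.of_forall fun z => ?_)
    simp
  have h := GaussianFourier.integral_cexp_neg_mul_sq_norm_add (V := Eu n) (b := (1 / 2 : ℂ))
    (by norm_num) Complex.I t
  rw [← hP] at h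
  have h2 : ∀ z : Eu n, (ENNReal.ofReal (gdens z)).toReal • Complex.exp (⟪z, t⟫ * Complex.I) =
      ((gmass n : ℝ) : ℂ)⁻¹ * Complex.exp (-(1 / 2) * ‖z‖ ^ 2 + Complex.I * ⟪t, z⟫) := by
    intro z
    rw [ENNReal.toReal_ofReal (gdens_pos z).le, gdens, Complex.real_smul, Complex.exp_add]
    push_cast
    rw [real_inner_comm, mul_comm Complex.I]
    ring
  simp_rw [h2]
  rw [integral_const_mul, h, ← mul_assoc, inv_mul_cancel₀ (by exact_mod_cast (gmass_pos n).ne'),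
    one_mul]
  congr 1
  simp
  ring

lemma integral_gam {n : ℕ} (F : Eu n → ℝ) : ∫ z, F z ∂(gam n) = ∫ z, gdens z * F z := by
  rw [gam_eq_withDensity, integral_withDensity_eq_integral_toReal_smul
    (measurable_gdens.ennreal_ofReal) (by simp)]
  refine integral_congr_ae (Filter.Eventually.of_forall fun z => ?_)
  simp [ENNReal.toReal_ofReal (gdens_pos z).le]

lemma integrable_gam_iff {n : ℕ} {F : Eu n → ℝ} :
    Integrable F (gam n) ↔ Integrable (fun z => gdens z * F z) := by
  rw [gam_eq_withDensity, integrable_withDensity_iff_integrable_smul'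
    (measurable_gdens.ennreal_ofReal) (by simp)]
  simp [ENNReal.toReal_ofReal (gdens_pos _).le]

lemma integrable_one_add_norm_pow (n k : ℕ) :
    Integrable (fun z : Eu n => (1 + ‖z‖) ^ k) (gam n) := by
  have h0 : MemLp (fun z : Eu n => ‖z‖) k (gam n) :=
    (ProbabilityTheory.IsGaussian.memLp_id (gam n) k (by simp)).norm
  have h1 : MemLp (fun z : Eu n => 1 + ‖z‖) k (gam n) := (memLp_const (1 : ℝ)).add h0
  have h2 : Integrable (fun z : Eu n => ‖1 + ‖z‖‖ ^ k) (gam n) := h1.integrable_norm_pow'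
  refine h2.congr (Filter.Eventually.of_forall fun z => ?_)
  simp only [Real.norm_eq_abs]
  rw [abs_of_nonneg (by positivity)]

lemma PB.integrable {n : ℕ} {F : Eu n → ℝ} (hF : PB F) (hc : Continuous F) :
    Integrable F (gam n) := by
  obtain ⟨k, C, h⟩ := hF
  refine ((integrable_one_add_norm_pow n k).const_mul C).mono' hc.aestronglyMeasurable ?_
  exact Filter.Eventually.of_forall h

section TG

variable {n : ℕ} {F G : Eu n → ℝ}

lemma Function.HasTemperateGrowth.smooth (hF : F.HasTemperateGrowth) : ContDiff ℝ ∞ F := hF.1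

lemma Function.HasTemperateGrowth.pb (hF : F.HasTemperateGrowth) : PB F := by
  obtain ⟨k, C, h⟩ := hF.2 0
  exact ⟨k, C, by simpa using h⟩

lemma Function.HasTemperateGrowth.pd (hF : F.HasTemperateGrowth) (i : Fin n) :
    (pd i F).HasTemperateGrowth := by
  have h1 : (fderiv ℝ F).HasTemperateGrowth := by
    refine ⟨hF.1.fderiv_right (by simp), fun m => ?_⟩
    obtain ⟨k, C, h⟩ := hF.2 (m + 1)
    exact ⟨k, C, fun x => by rw [norm_iteratedFDeriv_fderiv]; exact h x⟩
  exact ((ContinuousLinearMap.apply ℝ ℝ (bv i)).hasTemperateGrowth).comp h1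

lemma hasTemperateGrowth_coord (i : Fin n) :
    Function.HasTemperateGrowth (fun x : Eu n => x i) :=
  (EuclideanSpace.proj i : Eu n →L[ℝ] ℝ).hasTemperateGrowth

lemma Function.HasTemperateGrowth.Lap (hF : F.HasTemperateGrowth) :
    (Lap F).HasTemperateGrowth := by
  unfold _root_.Lap
  exact Function.HasTemperateGrowth.sum fun i _ => (hF.pd i).pd i

lemma Function.HasTemperateGrowth.dilate (hF : F.HasTemperateGrowth) (a : Eu n) (r : ℝ) :
    Function.HasTemperateGrowth (fun z => F (a + r • z)) := by
  refine hF.comp ?_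
  exact (Function.HasTemperateGrowth.const a).add
    ((r • ContinuousLinearMap.id ℝ (Eu n)).hasTemperateGrowth)

lemma Function.HasTemperateGrowth.integrable (hF : F.HasTemperateGrowth) :
    Integrable F (gam n) := hF.pb.integrable hF.1.continuous

lemma Function.HasTemperateGrowth.integrable_smul (hF : F.HasTemperateGrowth) (r : ℝ) :
    Integrable (fun z => F (r • z)) (gam n) := by
  simpa using (hF.dilate 0 r).integrable

end TG

/-- The Euler (radial) derivative. -/
def euler {n : ℕ} (F : Eu n → ℝ) (x : Eu n) : ℝ := ∑ i, x i * pd i F x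

lemma Function.HasTemperateGrowth.euler {n : ℕ} {F : Eu n → ℝ} (hF : F.HasTemperateGrowth) :
    (euler F).HasTemperateGrowth := by
  unfold _root_.euler
  exact Function.HasTemperateGrowth.sum fun i _ => (hasTemperateGrowth_coord i).mul (hF.pd i)

/-- Gaussian average at scale `r`. -/
def gav {n : ℕ} (F : Eu n → ℝ) (r : ℝ) : ℝ := ∫ z, F (r • z) ∂(gam n)

section gav

variable {n : ℕ} {F G : Eu n → ℝ}

lemma hasDerivAt_gav (hF : F.HasTemperateGrowth) {r : ℝ} (hr : 0 < r) :
    HasDerivAt (gav F) (gav (euler F) r / r) r := by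
  have key : ∀ x : ℝ, x ≠ 0 → ∀ z : Eu n, fderiv ℝ F (x • z) z = euler F (x • z) / x := by
    intro x hx z
    rw [fderiv_eq_sum_pd, euler, Finset.sum_div]
    refine Finset.sum_congr rfl fun i _ => ?_
    simp; field_simp
  obtain ⟨k, C, hk⟩ := hF.euler.pb
  have hball : ball r (r / 2) ∈ nhds r := ball_mem_nhds r (by positivity)
  have hb : ∀ x ∈ ball r (r / 2), r / 2 < x ∧ x < 3 * r / 2 := by
    intro x hx
    rw [mem_ball, Real.dist_eq, abs_lt] at hx
    constructor <;> linarith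
  have := (hasDerivAt_integral_of_dominated_loc_of_deriv_le (μ := gam n) (s := ball r (r / 2))
    (F := fun x z => F (x • z)) (F' := fun x z => fderiv ℝ F (x • z) z) (x₀ := r)
    (bound := fun z => |C| * (2 + 3 * r / 2) ^ k * (1 + ‖z‖) ^ k / (r / 2)) hball ?_
    (hF.integrable_smul r) ?_ ?_ ?_ ?_).2
  · refine HasDerivAt.congr_deriv this ?_
    unfold gav
    rw [← integral_div]
    exact integral_congr_ae (Filter.Eventually.of_forall fun z => key r hr.ne' z)
  · refine Filter.Eventually.of_forall fun x => ?_
    exact (hF.integrable_smul x).aestronglyMeasurable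
  · simp_rw [key r hr.ne']
    exact ((hF.euler.integrable_smul r).div_const r).aestronglyMeasurable
  · refine Filter.Eventually.of_forall fun z x hx => ?_
    obtain ⟨h1, h2⟩ := hb x hx
    have hx0 : 0 < x := by linarith
    rw [key x hx0.ne', norm_div, Real.norm_eq_abs, Real.norm_eq_abs, abs_of_pos hx0]
    have h3 : 1 + ‖x • z‖ ≤ (2 + 3 * r / 2) * (1 + ‖z‖) := by
      rw [norm_smul, Real.norm_eq_abs, abs_of_pos hx0]
      nlinarith [norm_nonneg z]
    have h4 : |euler F (x • z)| ≤ |C| * (2 + 3 * r / 2) ^ k * (1 + ‖z‖) ^ k := by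
      calc _ ≤ C * (1 + ‖x • z‖) ^ k := hk _
        _ ≤ |C| * ((2 + 3 * r / 2) * (1 + ‖z‖)) ^ k := by gcongr; exact le_abs_self C
        _ = _ := by rw [mul_pow]; ring
    gcongr
  · exact ((integrable_one_add_norm_pow n k).const_mul _).div_const _
  · refine Filter.Eventually.of_forall fun z x _ => ?_
    simpa using hasDerivAt_line hF.1.diffble 0 z x

lemma gav_add (hF : F.HasTemperateGrowth) (hG : G.HasTemperateGrowth) (r : ℝ) :
    gav (fun x => F x + G x) r = gav F r + gav G r :=
  integral_add (hF.integrable_smul r) (hG.integrable_smul r)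

lemma gav_sub (hF : F.HasTemperateGrowth) (hG : G.HasTemperateGrowth) (r : ℝ) :
    gav (fun x => F x - G x) r = gav F r - gav G r :=
  integral_sub (hF.integrable_smul r) (hG.integrable_smul r)

lemma gav_const_mul (c : ℝ) (F : Eu n → ℝ) (r : ℝ) :
    gav (fun x => c * F x) r = c * gav F r := integral_const_mul _ _

lemma gav_sum {ι : Type*} (s : Finset ι) {F : ι → Eu n → ℝ}
    (hF : ∀ k, (F k).HasTemperateGrowth) (r : ℝ) :
    gav (fun x => ∑ k ∈ s, F k x) r = ∑ k ∈ s, gav (F k) r :=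
  integral_finsetSum s fun k _ => (hF k).integrable_smul r

lemma gav_mono (hF : F.HasTemperateGrowth) (hG : G.HasTemperateGrowth) (h : ∀ x, F x ≤ G x)
    (r : ℝ) : gav F r ≤ gav G r :=
  integral_mono (hF.integrable_smul r) (hG.integrable_smul r) fun _ => h _

lemma gav_nonneg (h : ∀ x, 0 ≤ F x) (r : ℝ) : 0 ≤ gav F r := integral_nonneg fun _ => h _

lemma gav_pos (hF : F.HasTemperateGrowth) (h : ∀ x, 0 < F x) (r : ℝ) : 0 < gav F r := by
  rw [gav, integral_pos_iff_support_of_nonneg (fun _ => (h _).le) (hF.integrable_smul r)]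
  have : Function.support (fun z => F (r • z)) = Set.univ :=
    Set.eq_univ_of_forall fun z => (h _).ne'
  rw [this]; simp

lemma stein_one (hG : G.HasTemperateGrowth) (i : Fin n) :
    ∫ z, z i * G z ∂(gam n) = ∫ z, pd i G z ∂(gam n) := by
  have hd : ∀ z : Eu n, HasFDerivAt (gdens (n := n)) (-(gdens z) • innerSL ℝ z) z := by
    intro z
    have h1 : HasFDerivAt (fun z : Eu n => ‖z‖ ^ 2) (2 • innerSL ℝ z) z :=
      (hasStrictFDerivAt_norm_sq z).hasFDerivAt
    have h2 := ((h1.const_mul (-(1 / 2))).exp).const_mul (gmass n)⁻¹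
    refine HasFDerivAt.congr_fderiv h2 ?_
    ext v
    simp [gdens]
    ring
  have hfd : ∀ z : Eu n, fderiv ℝ (gdens (n := n)) z (bv i) = - (gdens z * z i) := by
    intro z
    rw [(hd z).fderiv]
    simp [EuclideanSpace.inner_single_right]
  have hGi := hG.integrable
  have e1 := integrable_gam_iff.1 (hG.pd i).integrable
  have e2 := integrable_gam_iff.1 ((hasTemperateGrowth_coord i).mul hG).integrable
  have e3 := integrable_gam_iff.1 hGi
  rw [integral_gam, integral_gam]
  have := integral_mul_fderiv_eq_neg_fderiv_mul_of_integrable (μ := (volume : Measure (Eu n)))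
    (f := G) (g := gdens) (v := bv i) (e1.congr (Filter.Eventually.of_forall fun z => ?_))
    (e2.neg.congr (Filter.Eventually.of_forall fun z => ?_))
    (e3.congr (Filter.Eventually.of_forall fun z => mul_comm _ _))
    (fun x _ => hG.1.diffble x) (fun x _ => (hd x).differentiableAt)
  · rw [← neg_inj, ← integral_neg]
    calc _ = ∫ x, G x * fderiv ℝ gdens x (bv i) := by
            refine integral_congr_ae (Filter.Eventually.of_forall fun z => ?_)
            simp only [hfd]; ring
      _ = _ := by
            rw [this]
            congr 1
            refine integral_congr_ae (Filter.Eventually.of_forall fun z => ?_)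
            simp only [pd]; ring
  · simp only [pd]; ring
  · simp only [hfd, Pi.neg_apply, Pi.mul_apply]; ring

lemma stein (hG : G.HasTemperateGrowth) (i : Fin n) (r : ℝ) :
    gav (fun x => x i * G x) r = r ^ 2 * gav (pd i G) r := by
  have h := stein_one (hG.dilate 0 r) i
  rw [pd_translate_smul hG.1.diffble 0 r i] at h
  simp only [zero_add] at h
  rw [integral_const_mul] at h
  calc gav (fun x => x i * G x) r = ∫ z, r * (z i * G (r • z)) ∂(gam n) := by
        refine integral_congr_ae (Filter.Eventually.of_forall fun z => ?_)
        simp; ring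
    _ = r * (r * ∫ z, pd i G (r • z) ∂(gam n)) := by rw [integral_const_mul, h]
    _ = _ := by rw [gav]; ring

/-- Gaussian integration by parts for the Euler field. -/
lemma gav_mul_euler (hF : F.HasTemperateGrowth) (hG : G.HasTemperateGrowth) (r : ℝ) :
    gav (fun x => F x * euler G x) r =
      r ^ 2 * gav (fun x => F x * Lap G x + ∑ i, pd i F x * pd i G x) r := by
  have e1 : (fun x => F x * euler G x) = fun x => ∑ i, x i * (F x * pd i G x) := by
    ext x; rw [euler, Finset.mul_sum]; exact Finset.sum_congr rfl fun i _ => by ring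
  have h1 : ∀ i, (fun x => F x * pd i G x).HasTemperateGrowth := fun i => hF.mul (hG.pd i)
  rw [e1, gav_sum _ (fun i => (hasTemperateGrowth_coord i).fun_mul (h1 i))]
  have e2 : (fun x => F x * Lap G x + ∑ i, pd i F x * pd i G x) =
      fun x => ∑ i, pd i (fun x => F x * pd i G x) x := by
    ext x
    rw [Lap, Finset.mul_sum, ← Finset.sum_add_distrib]
    refine Finset.sum_congr rfl fun i _ => ?_
    rw [pd_mul hF.1.diffble (hG.1.pd i).diffble]; ring
  rw [e2, gav_sum _ (fun i => (h1 i).pd i), Finset.mul_sum]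
  exact Finset.sum_congr rfl fun i _ => stein (h1 i) i r

lemma gav_euler (hG : G.HasTemperateGrowth) (r : ℝ) : gav (euler G) r = r ^ 2 * gav (Lap G) r := by
  have := gav_mul_euler (Function.HasTemperateGrowth.const (1 : ℝ)) hG r
  simpa [pd_const] using this

end gav

section prod

variable {n : ℕ}

lemma Function.HasTemperateGrowth.integrable_prod {H : Eu n × Eu n → ℝ}
    (hH : H.HasTemperateGrowth) : Integrable H ((gam n).prod (gam n)) := by
  obtain ⟨k, C, h⟩ := hH.2 0
  have h2 := (((integrable_one_add_norm_pow n k).mul_prod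
    (integrable_one_add_norm_pow n k)).const_mul |C|)
  refine h2.mono' hH.1.continuous.aestronglyMeasurable (Filter.Eventually.of_forall fun p => ?_)
  have h1 := h p
  rw [norm_iteratedFDeriv_zero] at h1
  refine h1.trans ?_
  rw [← mul_pow]
  have : 1 + ‖p‖ ≤ (1 + ‖p.1‖) * (1 + ‖p.2‖) := by
    have := norm_nonneg p.1
    have := norm_nonneg p.2
    have : ‖p‖ ≤ ‖p.1‖ + ‖p.2‖ := by
      rw [Prod.norm_def]; exact max_le (by linarith) (by linarith)
    nlinarith
  gcongr
  exact le_abs_self C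

lemma integral_rotation {H : Eu n × Eu n → ℝ} (hH : Continuous H) (θ : ℝ) :
    ∫ p, H (Real.cos θ • p.1 + Real.sin θ • p.2, -Real.sin θ • p.1 + Real.cos θ • p.2)
      ∂((gam n).prod (gam n)) = ∫ p, H p ∂((gam n).prod (gam n)) := by
  have h0 : ∫ x, id x ∂(gam n) = 0 := ProbabilityTheory.integral_id_stdGaussian
  have h := ProbabilityTheory.IsGaussian.map_rotation_eq_self (μ := gam n) h0 θ
  conv_rhs => rw [← h]
  rw [integral_map (by fun_prop) hH.aestronglyMeasurable]
  rfl

lemma integral_rotation_fst {G : Eu n → ℝ} (hG : Continuous G) (θ : ℝ) :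
    ∫ p, G (Real.cos θ • p.1 + Real.sin θ • p.2) ∂((gam n).prod (gam n)) = ∫ z, G z ∂(gam n) := by
  have := integral_rotation (H := fun p => G p.1) (by fun_prop) θ
  simp only at this
  rw [this, integral_fun_fst]; simp

end prod

section Mehler

variable {n : ℕ} {F G : Eu n → ℝ}

lemma Function.HasTemperateGrowth.comp_rot (hF : F.HasTemperateGrowth) (a b : ℝ) :
    Function.HasTemperateGrowth (fun p : Eu n × Eu n => F (a • p.1 + b • p.2)) :=
  hF.comp ((a • ContinuousLinearMap.fst ℝ (Eu n) (Eu n) +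
    b • ContinuousLinearMap.snd ℝ (Eu n) (Eu n)).hasTemperateGrowth)

lemma Function.HasTemperateGrowth.comp_fst (hF : F.HasTemperateGrowth) :
    Function.HasTemperateGrowth (fun p : Eu n × Eu n => F p.1) :=
  hF.comp ((ContinuousLinearMap.fst ℝ (Eu n) (Eu n)).hasTemperateGrowth)

lemma Function.HasTemperateGrowth.comp_snd (hF : F.HasTemperateGrowth) :
    Function.HasTemperateGrowth (fun p : Eu n × Eu n => F p.2) :=
  hF.comp ((ContinuousLinearMap.snd ℝ (Eu n) (Eu n)).hasTemperateGrowth)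

/-- Two-point correlation along the Mehler rotation. -/
def mehler (F : Eu n → ℝ) (θ : ℝ) : ℝ :=
  ∫ p, F p.1 * F (Real.cos θ • p.1 + Real.sin θ • p.2) ∂((gam n).prod (gam n))

lemma hasDerivAt_mehler_aux (hF : F.HasTemperateGrowth) (θ : ℝ) :
    HasDerivAt (mehler F) (∫ p, F p.1 * fderiv ℝ F (Real.cos θ • p.1 + Real.sin θ • p.2)
      (-Real.sin θ • p.1 + Real.cos θ • p.2) ∂((gam n).prod (gam n))) θ := by
  obtain ⟨k, C, hk⟩ := hF.2 0
  obtain ⟨l, C', hl⟩ := hF.2 1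
  have hcs : ∀ p : Eu n × Eu n, ∀ θ : ℝ, ‖Real.cos θ • p.1 + Real.sin θ • p.2‖ ≤ ‖p.1‖ + ‖p.2‖ ∧
      ‖-Real.sin θ • p.1 + Real.cos θ • p.2‖ ≤ ‖p.1‖ + ‖p.2‖ := by
    intro p θ
    have h1 := Real.abs_cos_le_one θ
    have h2 := Real.abs_sin_le_one θ
    constructor
    all_goals
      refine (norm_add_le _ _).trans ?_
      simp only [norm_smul, Real.norm_eq_abs, abs_neg]
      nlinarith [norm_nonneg p.1, norm_nonneg p.2]
  refine (hasDerivAt_integral_of_dominated_loc_of_deriv_le (s := Set.univ) (x₀ := θ)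
    (F := fun θ (p : Eu n × Eu n) => F p.1 * F (Real.cos θ • p.1 + Real.sin θ • p.2))
    (F' := fun θ (p : Eu n × Eu n) => F p.1 * fderiv ℝ F (Real.cos θ • p.1 + Real.sin θ • p.2)
      (-Real.sin θ • p.1 + Real.cos θ • p.2)) (μ := (gam n).prod (gam n))
    (bound := fun p => |C| * |C'| * ((1 + ‖p.1‖) ^ (k + l + 1) * (1 + ‖p.2‖) ^ (k + l + 1)))
    Filter.univ_mem ?_ ?_ ?_ ?_ ?_ ?_).2
  · refine Filter.Eventually.of_forall fun x => ?_
    have h1 := hF.1.continuous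
    exact Continuous.aestronglyMeasurable (by fun_prop)
  · exact (hF.comp_fst.mul (hF.comp_rot _ _)).integrable_prod
  · have h1 := hF.1.continuous
    have h2 : Continuous (fderiv ℝ F) := hF.1.continuous_fderiv (by simp)
    exact Continuous.aestronglyMeasurable (by fun_prop)
  · refine Filter.Eventually.of_forall fun p x _ => ?_
    have a1 : |F p.1| ≤ |C| * ((1 + ‖p.1‖) * (1 + ‖p.2‖)) ^ k := by
      have := hk p.1
      rw [norm_iteratedFDeriv_zero] at this
      refine this.trans ?_
      gcongr
      · exact le_abs_self C
      · nlinarith [norm_nonneg p.1, norm_nonneg p.2]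
    have a2 : ‖fderiv ℝ F (Real.cos x • p.1 + Real.sin x • p.2)‖ ≤
        |C'| * ((1 + ‖p.1‖) * (1 + ‖p.2‖)) ^ l := by
      have := hl (Real.cos x • p.1 + Real.sin x • p.2)
      rw [norm_iteratedFDeriv_one] at this
      refine this.trans ?_
      gcongr
      · exact le_abs_self C'
      · have := (hcs p x).1
        nlinarith [norm_nonneg p.1, norm_nonneg p.2]
    have a3 : ‖-Real.sin x • p.1 + Real.cos x • p.2‖ ≤ (1 + ‖p.1‖) * (1 + ‖p.2‖) := by
      have := (hcs p x).2
      nlinarith [norm_nonneg p.1, norm_nonneg p.2]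
    rw [norm_mul]
    calc _ ≤ |F p.1| * (‖fderiv ℝ F (Real.cos x • p.1 + Real.sin x • p.2)‖ *
          ‖-Real.sin x • p.1 + Real.cos x • p.2‖) := by
            rw [Real.norm_eq_abs]; gcongr; exact ContinuousLinearMap.le_opNorm _ _
      _ ≤ (|C| * ((1 + ‖p.1‖) * (1 + ‖p.2‖)) ^ k) * ((|C'| * ((1 + ‖p.1‖) * (1 + ‖p.2‖)) ^ l) *
          ((1 + ‖p.1‖) * (1 + ‖p.2‖))) := by gcongr
      _ = _ := by rw [← mul_pow]; ring
  · exact ((integrable_one_add_norm_pow n _).mul_prod (integrable_one_add_norm_pow n _)).const_mul _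
  · refine Filter.Eventually.of_forall fun p x _ => ?_
    have h1 : HasDerivAt (fun θ : ℝ => Real.cos θ • p.1 + Real.sin θ • p.2)
        (-Real.sin x • p.1 + Real.cos x • p.2) x :=
      ((Real.hasDerivAt_cos x).smul_const p.1).add ((Real.hasDerivAt_sin x).smul_const p.2)
    exact ((hF.1.diffble _).hasFDerivAt.comp_hasDerivAt x h1).const_mul _

lemma hasDerivAt_mehler (hF : F.HasTemperateGrowth) (θ : ℝ) :
    HasDerivAt (mehler F) (-Real.sin θ * ∑ i, ∫ p, pd i F p.1 *
      pd i F (Real.cos θ • p.1 + Real.sin θ • p.2) ∂((gam n).prod (gam n))) θ := by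
  refine (hasDerivAt_mehler_aux hF θ).congr_deriv ?_
  set c := Real.cos θ
  set s := Real.sin θ
  set μ := (gam n).prod (gam n)
  have t1 : ∀ i : Fin n, Function.HasTemperateGrowth
      (fun p : Eu n × Eu n => p.1 i * (F p.1 * pd i F (c • p.1 + s • p.2))) := fun i =>
    ((hasTemperateGrowth_coord i).comp_fst).mul (hF.comp_fst.mul ((hF.pd i).comp_rot c s))
  have t2 : ∀ i : Fin n, Function.HasTemperateGrowth
      (fun p : Eu n × Eu n => p.2 i * (F p.1 * pd i F (c • p.1 + s • p.2))) := fun i =>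
    ((hasTemperateGrowth_coord i).comp_snd).mul (hF.comp_fst.mul ((hF.pd i).comp_rot c s))
  have t3 : ∀ i : Fin n, Function.HasTemperateGrowth
      (fun p : Eu n × Eu n => pd i F p.1 * pd i F (c • p.1 + s • p.2)) := fun i =>
    (hF.pd i).comp_fst.mul ((hF.pd i).comp_rot c s)
  have t4 : ∀ i : Fin n, Function.HasTemperateGrowth
      (fun p : Eu n × Eu n => F p.1 * pd i (pd i F) (c • p.1 + s • p.2)) := fun i =>
    hF.comp_fst.mul (((hF.pd i).pd i).comp_rot c s)
  have s1 : ∀ i, ∫ p, p.1 i * (F p.1 * pd i F (c • p.1 + s • p.2)) ∂μ =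
      (∫ p, pd i F p.1 * pd i F (c • p.1 + s • p.2) ∂μ) +
        c * ∫ p, F p.1 * pd i (pd i F) (c • p.1 + s • p.2) ∂μ := by
    intro i
    rw [← integral_const_mul, ← integral_add (t3 i).integrable_prod
      ((t4 i).integrable_prod.const_mul c), integral_prod_symm _ (t1 i).integrable_prod,
      integral_prod_symm _ ((t3 i).integrable_prod.fun_add ((t4 i).integrable_prod.const_mul c))]
    refine integral_congr_ae (Filter.Eventually.of_forall fun y => ?_)
    have e : (fun x => c • x + s • y) = fun x : Eu n => s • y + c • x := by
      ext x; simp; ring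
    have := stein_one (hF.mul ((hF.pd i).dilate (s • y) c)) i
    simp only [Pi.mul_apply] at this
    simp only [add_comm (c • _) (s • y)]
    rw [this]
    refine integral_congr_ae (Filter.Eventually.of_forall fun z => ?_)
    have h1 := pd_mul (i := i) hF.1.diffble ((hF.pd i).dilate (s • y) c).1.diffble
    simp only
    change pd i (fun x => F x * pd i F (s • y + c • x)) z = _
    rw [h1, pd_translate_smul (hF.pd i).1.diffble]
    ring
  have s2 : ∀ i, ∫ p, p.2 i * (F p.1 * pd i F (c • p.1 + s • p.2)) ∂μ =
        s * ∫ p, F p.1 * pd i (pd i F) (c • p.1 + s • p.2) ∂μ := by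
    intro i
    rw [← integral_const_mul, integral_prod _ (t2 i).integrable_prod,
      integral_prod _ ((t4 i).integrable_prod.const_mul s)]
    refine integral_congr_ae (Filter.Eventually.of_forall fun x => ?_)
    have := stein_one ((hF.pd i).dilate (c • x) s) i
    have e : ∀ y : Eu n, y i * (F x * pd i F (c • x + s • y)) =
      F x * (y i * pd i F (c • x + s • y)) := fun y => by ring
    simp only [e]
    rw [integral_const_mul, this, ← integral_const_mul]
    refine integral_congr_ae (Filter.Eventually.of_forall fun z => ?_)
    simp only
    rw [pd_translate_smul (hF.pd i).1.diffble]
    ring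
  have e0 : ∀ p : Eu n × Eu n, F p.1 * fderiv ℝ F (c • p.1 + s • p.2) (-s • p.1 + c • p.2) =
      ∑ i, (-s * (p.1 i * (F p.1 * pd i F (c • p.1 + s • p.2))) +
        c * (p.2 i * (F p.1 * pd i F (c • p.1 + s • p.2)))) := by
    intro p
    rw [fderiv_eq_sum_pd, Finset.mul_sum]
    refine Finset.sum_congr rfl fun i _ => ?_
    simp; ring
  simp only [e0]
  rw [integral_finsetSum _ fun i _ => ((t1 i).integrable_prod.const_mul _).fun_add
    ((t2 i).integrable_prod.const_mul _), Finset.mul_sum]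
  refine Finset.sum_congr rfl fun i _ => ?_
  rw [integral_add ((t1 i).integrable_prod.const_mul _) ((t2 i).integrable_prod.const_mul _),
    integral_const_mul, integral_const_mul, s1, s2]
  ring

lemma poincare_one (hF : F.HasTemperateGrowth) (h0 : ∫ z, F z ∂(gam n) = 0) :
    ∫ z, F z ^ 2 ∂(gam n) ≤ ∑ i, ∫ z, pd i F z ^ 2 ∂(gam n) := by
  set E := ∑ i, ∫ z, pd i F z ^ 2 ∂(gam n) with hE
  have hsq : ∀ i, (fun z => pd i F z ^ 2).HasTemperateGrowth := fun i => by
    simpa [sq] using (hF.pd i).fun_mul (hF.pd i)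
  have hmono : MonotoneOn (fun θ => mehler F θ - Real.cos θ * E) (Set.Icc 0 (Real.pi / 2)) := by
    have hd : ∀ θ, HasDerivAt (fun θ => mehler F θ - Real.cos θ * E)
        (-Real.sin θ * (∑ i, ∫ p, pd i F p.1 *
      pd i F (Real.cos θ • p.1 + Real.sin θ • p.2) ∂((gam n).prod (gam n))) - -Real.sin θ * E) θ :=
      fun θ => (hasDerivAt_mehler hF θ).sub ((Real.hasDerivAt_cos θ).mul_const E)
    refine monotoneOn_of_hasDerivWithinAt_nonneg (convex_Icc _ _)
      (fun x _ => (hd x).continuousAt.continuousWithinAt) (fun x _ => (hd x).hasDerivWithinAt) ?_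
    intro θ hθ
    rw [interior_Icc] at hθ
    have hs : 0 ≤ Real.sin θ := Real.sin_nonneg_of_nonneg_of_le_pi hθ.1.le (by
      have := Real.pi_pos; linarith [hθ.2])
    have : (∑ i, ∫ p, pd i F p.1 *
      pd i F (Real.cos θ • p.1 + Real.sin θ • p.2) ∂((gam n).prod (gam n))) ≤ E := by
      refine Finset.sum_le_sum fun i _ => ?_
      have c1 : ∫ p : Eu n × Eu n, pd i F p.1 ^ 2 ∂((gam n).prod (gam n)) =
          ∫ z, pd i F z ^ 2 ∂(gam n) := by
        rw [integral_fun_fst (fun z => pd i F z ^ 2)]; simp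
      have c2 := integral_rotation_fst (hsq i).1.continuous θ
      have i1 := (hsq i).comp_fst.integrable_prod
      have i2 := ((hsq i).comp_rot (Real.cos θ) (Real.sin θ)).integrable_prod
      calc _ ≤ ∫ p : Eu n × Eu n, (1 / 2 * (pd i F p.1 ^ 2) + 1 / 2 *
              pd i F (Real.cos θ • p.1 + Real.sin θ • p.2) ^ 2) ∂((gam n).prod (gam n)) := by
            refine integral_mono ((hF.pd i).comp_fst.mul ((hF.pd i).comp_rot _ _)).integrable_prod
              ((i1.const_mul _).add (i2.const_mul _)) fun p => ?_
            simp only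
            nlinarith [sq_nonneg (pd i F p.1 - pd i F (Real.cos θ • p.1 + Real.sin θ • p.2))]
        _ = _ := by
            rw [integral_add (i1.const_mul _) (i2.const_mul _), integral_const_mul,
              integral_const_mul, c1, c2]; ring
    nlinarith
  have h1 := hmono (a := 0) (b := Real.pi / 2) (by simp; positivity) (by simp; positivity)
    (by positivity)
  simp only [Real.cos_zero, Real.cos_pi_div_two] at h1
  have k0 : mehler F 0 = ∫ z, F z ^ 2 ∂(gam n) := by
    have := integral_fun_fst (μ := gam n) (ν := gam n) (fun z => F z ^ 2)
    simp [mehler, ← sq, this]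
  have k1 : mehler F (Real.pi / 2) = 0 := by
    have := integral_prod_mul (μ := gam n) (ν := gam n) F F
    simp [mehler, this, h0]
  rw [k0, k1] at h1
  linarith

end Mehler

section gap

variable {n : ℕ} {F G : Eu n → ℝ}

lemma integral_gam_neg (F : Eu n → ℝ) : ∫ z, F (-z) ∂(gam n) = ∫ z, F z ∂(gam n) := by
  rw [integral_gam, integral_gam, ← integral_neg_eq_self (fun z => gdens z * F z)]
  simp [gdens]

lemma integral_gam_odd (h : ∀ z, F (-z) = -F z) : ∫ z, F z ∂(gam n) = 0 := by
  have := integral_gam_neg F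
  simp only [h, integral_neg] at this
  linarith

lemma Function.HasTemperateGrowth.sq (hF : F.HasTemperateGrowth) :
    Function.HasTemperateGrowth (fun x => F x ^ 2) := by
  simpa [_root_.sq] using hF.fun_mul hF

lemma pd_dilate (hF : Differentiable ℝ F) (a : Eu n) (c : ℝ) (i : Fin n) (z : Eu n) :
    pd i (fun y => F (a + c • y)) z = c * pd i F (a + c • z) :=
  congrFun (pd_translate_smul hF a c i) z

lemma even_gap_one (hG : G.HasTemperateGrowth) (he : ∀ z, G (-z) = G z)
    (h0 : ∫ z, G z ∂(gam n) = 0) :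
    2 * ∫ z, G z ^ 2 ∂(gam n) ≤ ∑ i, ∫ z, pd i G z ^ 2 ∂(gam n) := by
  set μ := (gam n).prod (gam n)
  obtain ⟨c, hc, hcs, hc2⟩ : ∃ c : ℝ, Real.cos (Real.pi / 4) = c ∧ Real.sin (Real.pi / 4) = c ∧
      c ^ 2 = 1 / 2 := by
    refine ⟨_, rfl, by simp, ?_⟩
    rw [Real.cos_pi_div_four, div_pow]; norm_num
  let H : Eu n × Eu n → ℝ := fun p => G (c • p.1 + c • p.2) - G (-c • p.1 + c • p.2)
  have hH : H.HasTemperateGrowth := (hG.comp_rot c c).sub (hG.comp_rot (-c) c)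
  have hH2 : Function.HasTemperateGrowth (fun p => H p ^ 2) := by
    simpa [_root_.sq] using hH.fun_mul hH
  have hp : ∀ i, Function.HasTemperateGrowth (fun p : Eu n × Eu n =>
      (c * pd i G (c • p.1 + c • p.2) - c * pd i G (-c • p.1 + c • p.2)) ^ 2) := fun i => by
    have h1 : Function.HasTemperateGrowth (fun p : Eu n × Eu n =>
      c * pd i G (c • p.1 + c • p.2) - c * pd i G (-c • p.1 + c • p.2)) :=
      ((Function.HasTemperateGrowth.const c).mul ((hG.pd i).comp_rot c c)).sub
        ((Function.HasTemperateGrowth.const c).mul ((hG.pd i).comp_rot (-c) c))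
    simpa [_root_.sq] using h1.fun_mul h1
  have hq : ∀ i, Function.HasTemperateGrowth (fun p : Eu n × Eu n =>
      (c * pd i G (c • p.1 + c • p.2) + c * pd i G (-c • p.1 + c • p.2)) ^ 2) := fun i => by
    have h1 : Function.HasTemperateGrowth (fun p : Eu n × Eu n =>
      c * pd i G (c • p.1 + c • p.2) + c * pd i G (-c • p.1 + c • p.2)) :=
      ((Function.HasTemperateGrowth.const c).mul ((hG.pd i).comp_rot c c)).add
        ((Function.HasTemperateGrowth.const c).mul ((hG.pd i).comp_rot (-c) c))
    simpa [_root_.sq] using h1.fun_mul h1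
  have A1 : ∫ p, H p ^ 2 ∂μ ≤ ∑ i, ∫ p,
      (c * pd i G (c • p.1 + c • p.2) - c * pd i G (-c • p.1 + c • p.2)) ^ 2 ∂μ := by
    rw [← integral_finsetSum _ fun i _ => (hp i).integrable_prod,
      integral_prod _ hH2.integrable_prod, integral_prod _
        (integrable_finsetSum _ fun i _ => (hp i).integrable_prod)]
    refine integral_mono hH2.integrable_prod.integral_prod_left
      (integrable_finsetSum _ fun i _ => (hp i).integrable_prod).integral_prod_left fun x => ?_
    have hx : Function.HasTemperateGrowth (fun y => G (c • x + c • y) - G (-c • x + c • y)) :=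
      (hG.dilate _ _).sub (hG.dilate _ _)
    have := poincare_one hx (integral_gam_odd fun z => by
      rw [← he (c • x + c • -z), ← he (-c • x + c • -z)]
      simp only [smul_neg, neg_smul, neg_add, neg_neg]; ring)
    refine this.trans_eq ?_
    have hi : ∀ i, Integrable
      (fun z => pd i (fun y => G (c • x + c • y) - G (-c • x + c • y)) z ^ 2)
      (gam n) := fun i => (hx.pd i).sq.integrable
    rw [← integral_finsetSum _ fun i _ => hi i]
    refine integral_congr_ae (Filter.Eventually.of_forall fun z => ?_)
    refine Finset.sum_congr rfl fun i _ => ?_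
    simp only
    rw [pd_sub (hG.dilate _ _).1.diffble (hG.dilate _ _).1.diffble]
    simp only [pd_dilate hG.1.diffble]
  have A2 : ∫ p, H p ^ 2 ∂μ ≤ ∑ i, ∫ p,
      (c * pd i G (c • p.1 + c • p.2) + c * pd i G (-c • p.1 + c • p.2)) ^ 2 ∂μ := by
    rw [← integral_finsetSum _ fun i _ => (hq i).integrable_prod,
      integral_prod_symm _ hH2.integrable_prod, integral_prod_symm _
        (integrable_finsetSum _ fun i _ => (hq i).integrable_prod)]
    refine integral_mono hH2.integrable_prod.integral_prod_right
      (integrable_finsetSum _ fun i _ => (hq i).integrable_prod).integral_prod_right fun y => ?_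
    have hx : Function.HasTemperateGrowth (fun x => G (c • y + c • x) - G (c • y + -c • x)) :=
      (hG.dilate _ _).sub (hG.dilate _ _)
    have := poincare_one hx (integral_gam_odd fun z => by
      simp only [smul_neg, neg_smul, neg_neg]; ring)
    simp only [H, add_comm _ (c • y)]
    refine this.trans_eq ?_
    have hi : ∀ i, Integrable
      (fun z => pd i (fun x => G (c • y + c • x) - G (c • y + -c • x)) z ^ 2)
      (gam n) := fun i => (hx.pd i).sq.integrable
    rw [← integral_finsetSum _ fun i _ => hi i]
    refine integral_congr_ae (Filter.Eventually.of_forall fun z => ?_)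
    refine Finset.sum_congr rfl fun i _ => ?_
    rw [pd_sub (hG.dilate _ _).1.diffble (hG.dilate _ _).1.diffble]
    simp only [pd_dilate hG.1.diffble]
    ring
  have B : ∫ p, H p ^ 2 ∂μ = 2 * ∫ z, G z ^ 2 ∂(gam n) := by
    have := integral_rotation (H := fun p => (G p.1 - G p.2) ^ 2)
      (by have := hG.1.continuous; fun_prop) (Real.pi / 4)
    rw [hc, hcs] at this
    simp only at this
    rw [this]
    have e : ∀ p : Eu n × Eu n, (G p.1 - G p.2) ^ 2 =
      (G p.1 ^ 2 + G p.2 ^ 2) - 2 * (G p.1 * G p.2) := fun p => by ring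
    simp only [e]
    rw [integral_sub (hG.sq.comp_fst.integrable_prod.fun_add hG.sq.comp_snd.integrable_prod)
      ((hG.comp_fst.fun_mul hG.comp_snd).integrable_prod.const_mul 2),
      integral_add hG.sq.comp_fst.integrable_prod hG.sq.comp_snd.integrable_prod,
      integral_const_mul, integral_prod_mul, h0, integral_fun_fst (fun z => G z ^ 2),
      integral_fun_snd (fun z => G z ^ 2)]
    simp; ring
  have D : ∀ i, (∫ p, (c * pd i G (c • p.1 + c • p.2) - c * pd i G (-c • p.1 + c • p.2)) ^ 2 ∂μ) +
      (∫ p, (c * pd i G (c • p.1 + c • p.2) + c * pd i G (-c • p.1 + c • p.2)) ^ 2 ∂μ) =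
      2 * ∫ z, pd i G z ^ 2 ∂(gam n) := by
    intro i
    rw [← integral_add (hp i).integrable_prod (hq i).integrable_prod]
    have := integral_rotation (H := fun p => (pd i G p.1) ^ 2 + (pd i G p.2) ^ 2)
      (by have := (hG.pd i).1.continuous; fun_prop) (Real.pi / 4)
    rw [hc, hcs] at this
    simp only at this
    rw [integral_add (hG.pd i).sq.comp_fst.integrable_prod (hG.pd i).sq.comp_snd.integrable_prod,
      integral_fun_fst (fun z => pd i G z ^ 2),
      integral_fun_snd (fun z => pd i G z ^ 2)] at this
    simp only [probReal_univ, one_smul] at this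
    rw [two_mul, ← this]
    refine integral_congr_ae (Filter.Eventually.of_forall fun z => ?_)
    simp only
    linear_combination 2 * (pd i G (c • z.1 + c • z.2) ^ 2 + pd i G (-c • z.1 + c • z.2) ^ 2) * hc2
  have S := Finset.sum_congr rfl fun i (_ : i ∈ Finset.univ) => D i
  rw [Finset.sum_add_distrib, ← Finset.mul_sum] at S
  linarith

lemma Function.HasTemperateGrowth.neg_arg (hF : F.HasTemperateGrowth) :
    Function.HasTemperateGrowth (fun x => F (-x)) := by
  simpa using hF.dilate 0 (-1)

lemma pd_neg_arg (hF : Differentiable ℝ F) (i : Fin n) (z : Eu n) :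
    pd i (fun x => F (-x)) z = - pd i F (-z) := by
  simpa using pd_dilate hF 0 (-1) i z

lemma poincare_even_one (hF : F.HasTemperateGrowth) (h0 : ∫ z, F z ∂(gam n) = 0) :
    ∫ z, F z ^ 2 ∂(gam n) + ∫ z, ((F z + F (-z)) / 2) ^ 2 ∂(gam n) ≤
      ∑ i, ∫ z, pd i F z ^ 2 ∂(gam n) := by
  have hc := Function.HasTemperateGrowth.const (E := Eu n) (1 / 2 : ℝ)
  set A : Eu n → ℝ := fun z => 1 / 2 * (F z + F (-z)) with hA
  set B : Eu n → ℝ := fun z => 1 / 2 * (F z - F (-z)) with hB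
  have tA : A.HasTemperateGrowth := hc.mul (hF.add hF.neg_arg)
  have tB : B.HasTemperateGrowth := hc.mul (hF.sub hF.neg_arg)
  have eA : ∀ z, A (-z) = A z := fun z => by simp [hA]; ring
  have eB : ∀ z, B (-z) = -B z := fun z => by simp [hB]; ring
  have hAB : ∀ z, F z = A z + B z := fun z => by simp only [hA, hB]; ring
  have hFe : F = fun z => A z + B z := funext hAB
  have zB : ∫ z, B z ∂(gam n) = 0 := integral_gam_odd eB
  have zA : ∫ z, A z ∂(gam n) = 0 := by
    simp only [hAB] at h0
    rwa [integral_add tA.integrable tB.integrable, zB, add_zero] at h0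
  have g1 := even_gap_one tA eA zA
  have g2 := poincare_one tB zB
  have pA : ∀ i z, pd i A (-z) = - pd i A z := fun i z => by
    have := pd_neg_arg tA.1.diffble i z
    simp only [eA] at this
    change pd i A z = _ at this
    linarith
  have pB : ∀ i z, pd i B (-z) = pd i B z := fun i z => by
    have := pd_neg_arg tB.1.diffble i z
    have h2 : (fun z => B (-z)) = fun z => (-1) * B z := by ext z; rw [eB]; ring
    rw [h2, pd_const_mul tB.1.diffble] at this
    linarith
  have e1 : ∫ z, F z ^ 2 ∂(gam n) = ∫ z, A z ^ 2 ∂(gam n) + ∫ z, B z ^ 2 ∂(gam n) := by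
    have z1 : ∫ z, A z * B z ∂(gam n) = 0 := integral_gam_odd fun z => by rw [eA, eB]; ring
    have e : ∀ z, F z ^ 2 = (A z ^ 2 + B z ^ 2) + 2 * (A z * B z) := fun z => by rw [hAB]; ring
    simp only [e]
    rw [integral_add (tA.sq.integrable.fun_add tB.sq.integrable)
      ((tA.fun_mul tB).integrable.const_mul 2), integral_const_mul, z1,
      integral_add tA.sq.integrable tB.sq.integrable]
    ring
  have e2 : ∀ i, ∫ z, pd i F z ^ 2 ∂(gam n) =
      ∫ z, pd i A z ^ 2 ∂(gam n) + ∫ z, pd i B z ^ 2 ∂(gam n) := by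
    intro i
    have z1 : ∫ z, pd i A z * pd i B z ∂(gam n) = 0 :=
      integral_gam_odd fun z => by rw [pA, pB]; ring
    have e : ∀ z, pd i F z ^ 2 = (pd i A z ^ 2 + pd i B z ^ 2) + 2 * (pd i A z * pd i B z) :=
      fun z => by rw [hFe, pd_add tA.1.diffble tB.1.diffble]; ring
    simp only [e]
    rw [integral_add ((tA.pd i).sq.integrable.fun_add (tB.pd i).sq.integrable)
      (((tA.pd i).fun_mul (tB.pd i)).integrable.const_mul 2), integral_const_mul, z1,
      integral_add (tA.pd i).sq.integrable (tB.pd i).sq.integrable]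
    ring
  have e3 : ∫ z, ((F z + F (-z)) / 2) ^ 2 ∂(gam n) = ∫ z, A z ^ 2 ∂(gam n) := by
    refine integral_congr_ae (Filter.Eventually.of_forall fun z => ?_)
    simp only [hA]; ring
  simp only [e2, Finset.sum_add_distrib]
  rw [e1, e3]
  linarith

/-- Squared gradient length. -/
def gsq (F : Eu n → ℝ) (x : Eu n) : ℝ := ∑ i, pd i F x ^ 2

lemma Function.HasTemperateGrowth.gsq (hF : F.HasTemperateGrowth) :
    (gsq F).HasTemperateGrowth :=
  Function.HasTemperateGrowth.sum fun i _ => (hF.pd i).sq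

lemma gsq_nonneg (F : Eu n → ℝ) (x : Eu n) : 0 ≤ gsq F x :=
  Finset.sum_nonneg fun _ _ => sq_nonneg _

lemma poincare_even (hF : F.HasTemperateGrowth) {r : ℝ} (h0 : gav F r = 0) :
    gav (fun x => F x ^ 2) r + gav (fun x => ((F x + F (-x)) / 2) ^ 2) r ≤
      r ^ 2 * gav (gsq F) r := by
  have hd := hF.dilate 0 r
  simp only [zero_add] at hd
  have h := poincare_even_one hd h0
  have hp : ∀ i z, pd i (fun z => F (r • z)) z = r * pd i F (r • z) := fun i z => by
    simpa using pd_dilate hF.1.diffble 0 r i z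
  have e : gsq F = fun x => ∑ i, pd i F x ^ 2 := rfl
  rw [e, gav_sum _ (fun i => (hF.pd i).sq), Finset.mul_sum]
  simp only [hp, mul_pow, integral_const_mul] at h
  simpa [gav] using h

lemma gav_sq_sub_mean (hF : F.HasTemperateGrowth) (r : ℝ) :
    gav (fun x => (F x - gav F r) ^ 2) r = gav (fun x => F x ^ 2) r - gav F r ^ 2 := by
  set m := gav F r with hm
  have e : (fun x => (F x - m) ^ 2) = fun x => (F x ^ 2 - (2 * m) * F x) + m ^ 2 := by
    ext x; ring
  rw [e, gav_add (hF.sq.fun_sub ((Function.HasTemperateGrowth.const (2 * m)).fun_mul hF))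
    (Function.HasTemperateGrowth.const _), gav_sub hF.sq
    ((Function.HasTemperateGrowth.const (2 * m)).fun_mul hF), gav_const_mul, ← hm]
  simp [gav]; ring

lemma poincare (hF : F.HasTemperateGrowth) (r : ℝ) :
    gav (fun x => F x ^ 2) r - gav F r ^ 2 ≤ r ^ 2 * gav (gsq F) r := by
  rw [← gav_sq_sub_mean hF]
  set m := gav F r with hm
  have hd : Function.HasTemperateGrowth (fun x => F x - m) :=
    hF.sub (Function.HasTemperateGrowth.const m)
  have h0 : gav (fun x => F x - m) r = 0 := by
    rw [gav_sub hF (Function.HasTemperateGrowth.const m), ← hm]; simp [gav]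
  have h := poincare_even hd h0
  have h1 : gsq (fun x => F x - m) = gsq F := by
    ext x
    refine Finset.sum_congr rfl fun i _ => ?_
    rw [pd_sub hF.1.diffble (differentiable_const m), pd_const]; simp
  rw [h1] at h
  have := gav_nonneg (F := fun x => ((F x - m + (F (-x) - m)) / 2) ^ 2) (fun _ => sq_nonneg _) r
  linarith

end gap

section CS

variable {n : ℕ} {F G : Eu n → ℝ}

lemma gav_mul_sq_le (hF : F.HasTemperateGrowth) (hG : G.HasTemperateGrowth) (r : ℝ) :
    gav (fun x => F x * G x) r ^ 2 ≤ gav (fun x => F x ^ 2) r * gav (fun x => G x ^ 2) r := by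
  have key : ∀ t : ℝ,
      0 ≤ gav (fun x => G x ^ 2) r * (t * t) + (2 * gav (fun x => F x * G x) r) * t +
      gav (fun x => F x ^ 2) r := by
    intro t
    have h := gav_nonneg (F := fun x => (F x + t * G x) ^ 2) (fun _ => sq_nonneg _) r
    have e : (fun x => (F x + t * G x) ^ 2) =
        fun x => (F x ^ 2 + (2 * t) * (F x * G x)) + (t * t) * G x ^ 2 := by ext x; ring
    rw [e, gav_add (hF.sq.fun_add ((Function.HasTemperateGrowth.const (2 * t)).fun_mul
      (hF.fun_mul hG))) ((Function.HasTemperateGrowth.const (t * t)).fun_mul hG.sq),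
      gav_add hF.sq ((Function.HasTemperateGrowth.const (2 * t)).fun_mul
      (hF.fun_mul hG)), gav_const_mul, gav_const_mul] at h
    linarith
  have := discrim_le_zero key
  rw [discrim] at this
  nlinarith

end CS

/-- A positive solution with temperate growth. -/
structure Sol {n : ℕ} (u v : Eu n → ℝ) : Prop where
  tu : u.HasTemperateGrowth
  tv : v.HasTemperateGrowth
  pu : ∀ x, 0 < u x
  pv : ∀ x, 0 < v x
  eu : ∀ x, Lap u x = u x * v x ^ 2
  ev : ∀ x, Lap v x = v x * u x ^ 2

lemma Sol.symm {n : ℕ} {u v : Eu n → ℝ} (h : Sol u v) : Sol v u :=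
  ⟨h.tv, h.tu, h.pv, h.pu, h.ev, h.eu⟩

lemma Sol.translate {n : ℕ} {u v : Eu n → ℝ} (h : Sol u v) (a : Eu n) :
    Sol (fun x => u (a + x)) (fun x => v (a + x)) := by
  have tr : ∀ f : Eu n → ℝ, f.HasTemperateGrowth → ∀ x,
      Lap (fun x => f (a + x)) x = Lap f (a + x) := by
    intro f hf x
    unfold Lap
    refine Finset.sum_congr rfl fun i _ => ?_
    have h1 : pd i (fun x => f (a + x)) = fun x => pd i f (a + x) := by
      simpa using pd_translate_smul hf.1.diffble a 1 i
    have h2 : pd i (fun x => pd i f (a + x)) = fun x => pd i (pd i f) (a + x) := by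
      simpa using pd_translate_smul (hf.pd i).1.diffble a 1 i
    rw [h1, h2]
  refine ⟨by simpa using h.tu.dilate a 1, by simpa using h.tv.dilate a 1, fun x => h.pu _,
    fun x => h.pv _, fun x => ?_, fun x => ?_⟩
  · rw [tr u h.tu, h.eu]
  · rw [tr v h.tv, h.ev]

section energy

variable {n : ℕ}

/-- Gaussian height of one component. -/
def ht (u : Eu n → ℝ) (r : ℝ) : ℝ := gav (fun x => u x ^ 2) r

/-- Gaussian overlap energy. -/
def ov (u v : Eu n → ℝ) (r : ℝ) : ℝ := gav (fun x => u x ^ 2 * v x ^ 2) r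

/-- Gaussian energy of the first component. -/
def en (u v : Eu n → ℝ) (r : ℝ) : ℝ := r ^ 2 * (gav (gsq u) r + ov u v r)

/-- Second radial moment. -/
def rad (u : Eu n → ℝ) (r : ℝ) : ℝ := gav (fun x => euler u x ^ 2) r

lemma ov_comm (u v : Eu n → ℝ) (r : ℝ) : ov u v r = ov v u r := by
  unfold ov; simp only [mul_comm]

lemma ov_nonneg (u v : Eu n → ℝ) (r : ℝ) : 0 ≤ ov u v r := gav_nonneg (fun _ => by positivity) r

lemma en_nonneg (u v : Eu n → ℝ) (r : ℝ) : 0 ≤ en u v r :=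
  mul_nonneg (sq_nonneg _) (add_nonneg (gav_nonneg (gsq_nonneg _) r) (ov_nonneg _ _ _))

variable {u v : Eu n → ℝ}

lemma Sol.ht_pos (h : Sol u v) (r : ℝ) : 0 < ht u r :=
  gav_pos h.tu.sq (fun x => by have := h.pu x; positivity) r

lemma Sol.gav_mul_euler_self (h : Sol u v) (r : ℝ) :
    gav (fun x => u x * euler u x) r = en u v r := by
  rw [gav_mul_euler h.tu h.tu, en, ov, ← gav_add h.tu.gsq (h.tu.sq.fun_mul h.tv.sq)]
  congr 2
  ext x
  rw [h.eu, gsq]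
  have : ∑ i, pd i u x * pd i u x = ∑ i, pd i u x ^ 2 := Finset.sum_congr rfl fun i _ => by ring
  rw [this]; ring

lemma euler_mul {F G : Eu n → ℝ} (hF : Differentiable ℝ F) (hG : Differentiable ℝ G) :
    euler (fun x => F x * G x) = fun x => F x * euler G x + G x * euler F x := by
  ext x
  simp only [euler, pd_mul hF hG]
  rw [Finset.mul_sum, Finset.mul_sum, ← Finset.sum_add_distrib]
  exact Finset.sum_congr rfl fun i _ => by ring

lemma euler_sq {F : Eu n → ℝ} (hF : Differentiable ℝ F) :
    euler (fun x => F x ^ 2) = fun x => 2 * (F x * euler F x) := by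
  have := euler_mul hF hF
  simp only [sq]
  rw [this]
  ext x; ring

lemma Sol.hasDerivAt_ht (h : Sol u v) {r : ℝ} (hr : 0 < r) :
    HasDerivAt (ht u) (2 * en u v r / r) r := by
  have := hasDerivAt_gav h.tu.sq hr
  rw [euler_sq h.tu.1.diffble, gav_const_mul, h.gav_mul_euler_self] at this
  exact this

lemma Sol.en_sq_le (h : Sol u v) (r : ℝ) : en u v r ^ 2 ≤ ht u r * rad u r := by
  rw [← h.gav_mul_euler_self]
  exact gav_mul_sq_le h.tu h.tu.euler r

lemma euler_pd {F : Eu n → ℝ} (hF : F.HasTemperateGrowth) (i : Fin n) (x : Eu n) :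
    euler (pd i F) x = pd i (euler F) x - pd i F x := by
  have h1 : pd i (euler F) x = ∑ j, (x j * pd i (pd j F) x + pd j F x * pd i (fun x => x j) x) := by
    have : euler F = fun x => ∑ j, x j * pd j F x := rfl
    rw [this, pd_sum _ (fun j _ =>
      (hasTemperateGrowth_coord j).1.diffble.fun_mul (hF.pd j).1.diffble)]
    refine Finset.sum_congr rfl fun j _ => ?_
    exact congrFun (pd_mul (i := i) (hasTemperateGrowth_coord j).1.diffble (hF.pd j).1.diffble) x
  rw [h1, Finset.sum_add_distrib, euler]
  have h2 : ∑ j, pd j F x * pd i (fun x => x j) x = pd i F x := by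
    simp [pd_coord]
  rw [h2]
  simp only [pd_comm hF.1 i]
  ring

lemma gav_euler_gsq (hu : u.HasTemperateGrowth) {r : ℝ} (hr : 0 < r) :
    gav (euler (gsq u)) r = 2 * (rad u r / r ^ 2 - gav (fun x => euler u x * Lap u x) r
      - gav (gsq u) r) := by
  have e : euler (gsq u) = fun x => 2 * (∑ i, pd i (euler u) x * pd i u x - gsq u x) := by
    ext x
    have h1 : ∀ j, pd j (gsq u) x = ∑ i, 2 * (pd i u x * pd j (pd i u) x) := by
      intro j
      have : gsq u = fun x => ∑ i, pd i u x * pd i u x := by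
        ext x; exact Finset.sum_congr rfl fun i _ => by ring
      rw [this, pd_sum _ (fun j _ => (hu.pd j).1.diffble.fun_mul (hu.pd j).1.diffble)]
      refine Finset.sum_congr rfl fun i _ => ?_
      have := congrFun (pd_mul (i := j) (hu.pd i).1.diffble (hu.pd i).1.diffble) x
      refine this.trans ?_
      ring
    have h2 : euler (gsq u) x = ∑ i, 2 * (pd i u x * euler (pd i u) x) := by
      simp only [euler, h1, Finset.mul_sum]
      rw [Finset.sum_comm]
      exact Finset.sum_congr rfl fun i _ => Finset.sum_congr rfl fun j _ => by ring
    rw [h2, gsq, ← Finset.sum_sub_distrib, Finset.mul_sum]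
    refine Finset.sum_congr rfl fun i _ => ?_
    rw [euler_pd hu]; ring
  have t : Function.HasTemperateGrowth (fun x => ∑ i, pd i (euler u) x * pd i u x) :=
    Function.HasTemperateGrowth.sum fun i _ => (hu.euler.pd i).fun_mul (hu.pd i)
  rw [e, gav_const_mul, gav_sub t hu.gsq]
  have h := gav_mul_euler hu.euler hu r
  rw [gav_add (hu.euler.fun_mul hu.Lap) t] at h
  have h' : rad u r = gav (fun x => euler u x * euler u x) r := by simp only [rad, sq]
  rw [h', h]
  field_simp
  ring

/-- Total height. -/
def htt (u v : Eu n → ℝ) (r : ℝ) : ℝ := ht u r + ht v r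

/-- Total energy. -/
def ten (u v : Eu n → ℝ) (r : ℝ) : ℝ := r ^ 2 * (gav (gsq u) r + gav (gsq v) r + ov u v r)

lemma Sol.hasDerivAt_ten (h : Sol u v) {r : ℝ} (hr : 0 < r) :
    HasDerivAt (ten u v) (2 * (rad u r + rad v r + r ^ 2 * ov u v r) / r) r := by
  have h1 := hasDerivAt_gav h.tu.gsq hr
  have h2 := hasDerivAt_gav h.tv.gsq hr
  have h3 : HasDerivAt (ov u v) _ r := hasDerivAt_gav (h.tu.sq.fun_mul h.tv.sq) hr
  have e : gav (euler (fun x => u x ^ 2 * v x ^ 2)) r =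
      2 * (gav (fun x => euler u x * Lap u x) r + gav (fun x => euler v x * Lap v x) r) := by
    rw [← gav_add (h.tu.euler.fun_mul h.tu.Lap) (h.tv.euler.fun_mul h.tv.Lap), ← gav_const_mul,
      euler_mul h.tu.sq.1.diffble h.tv.sq.1.diffble, euler_sq h.tu.1.diffble,
      euler_sq h.tv.1.diffble]
    congr 1; ext x
    rw [h.eu, h.ev]; ring
  rw [e] at h3
  rw [gav_euler_gsq h.tu hr] at h1
  rw [gav_euler_gsq h.tv hr] at h2
  have h4 := (hasDerivAt_pow 2 r).mul ((h1.add h2).add h3)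
  refine HasDerivAt.congr_deriv h4 ?_
  simp only [Pi.add_apply]
  field_simp
  push_cast
  ring

end energy

lemma monotoneOn_Ici_of_hasDerivAt {f f' : ℝ → ℝ} {a : ℝ} (hf : ∀ x, a ≤ x → HasDerivAt f (f' x) x)
    (h : ∀ x, a ≤ x → 0 ≤ f' x) : MonotoneOn f (Set.Ici a) := by
  refine monotoneOn_of_hasDerivWithinAt_nonneg (f' := f') (convex_Ici a)
    (fun x hx => (hf x hx).continuousAt.continuousWithinAt)
    (fun x hx => (hf x (interior_subset hx)).hasDerivWithinAt) fun x hx => h x (interior_subset hx)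

section freqmono

variable {n : ℕ} {u v : Eu n → ℝ}

/-- Gaussian frequency. -/
def fr (u v : Eu n → ℝ) (r : ℝ) : ℝ := ten u v r / htt u v r

/-- Component frequency. -/
def lam (u v : Eu n → ℝ) (r : ℝ) : ℝ := en u v r / ht u r

/-- Proportion of the height carried by the first component. -/
def prop (u v : Eu n → ℝ) (r : ℝ) : ℝ := ht u r / htt u v r

/-- Normalised overlap. -/
def nov (u v : Eu n → ℝ) (r : ℝ) : ℝ := r ^ 2 * ov u v r / htt u v r

lemma Sol.htt_pos (h : Sol u v) (r : ℝ) : 0 < htt u v r := add_pos (h.ht_pos r) (h.symm.ht_pos r)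

lemma en_add_en (u v : Eu n → ℝ) (r : ℝ) :
    en u v r + en v u r = ten u v r + r ^ 2 * ov u v r := by
  rw [en, en, ten, ov_comm v u]; ring

lemma sq_mul_ov_le_ten (u v : Eu n → ℝ) (r : ℝ) : r ^ 2 * ov u v r ≤ ten u v r := by
  unfold ten
  have := gav_nonneg (gsq_nonneg u) r
  have := gav_nonneg (gsq_nonneg v) r
  gcongr; linarith

lemma Sol.hasDerivAt_htt (h : Sol u v) {r : ℝ} (hr : 0 < r) :
    HasDerivAt (htt u v) (2 * (ten u v r + r ^ 2 * ov u v r) / r) r := by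
  refine HasDerivAt.congr_deriv ((h.hasDerivAt_ht hr).add (h.symm.hasDerivAt_ht hr)) ?_
  rw [← en_add_en]; ring

/-- Derivative of the Gaussian frequency. -/
def frDer (u v : Eu n → ℝ) (r : ℝ) : ℝ :=
  (2 * (rad u r + rad v r + r ^ 2 * ov u v r) / r * htt u v r -
    ten u v r * (2 * (ten u v r + r ^ 2 * ov u v r) / r)) / htt u v r ^ 2

lemma Sol.hasDerivAt_fr (h : Sol u v) {r : ℝ} (hr : 0 < r) :
    HasDerivAt (fr u v) (frDer u v r) r :=
  (h.hasDerivAt_ten hr).div (h.hasDerivAt_htt hr) (h.htt_pos r).ne'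

lemma Sol.frDer_ge (h : Sol u v) {r : ℝ} (hr : 0 < r) :
    2 / r * (prop u v r * (1 - prop u v r) * (lam u v r - lam v u r) ^ 2 + nov u v r) ≤
      frDer u v r := by
  have a1 := h.ht_pos r
  have a2 := h.symm.ht_pos r
  have c1 := h.en_sq_le r
  have c2 := h.symm.en_sq_le r
  have hB := en_add_en u v r
  have hS := ov_nonneg u v r
  have b1 := en_nonneg u v r
  have b2 := en_nonneg v u r
  have hh : htt u v r = ht u r + ht v r := rfl
  have hp := h.htt_pos r
  have hT : ten u v r = en u v r + en v u r - r ^ 2 * ov u v r := by linarith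
  unfold frDer prop nov lam
  rw [hT, hh] at *
  generalize ht u r = p at *
  generalize ht v r = q at *
  generalize en u v r = b at *
  generalize en v u r = c at *
  generalize rad u r = Q at *
  generalize rad v r = R at *
  generalize hs : r ^ 2 * ov u v r = s at *
  have hs0 : 0 ≤ s := by rw [← hs]; positivity
  have k1 : b ^ 2 / p ≤ Q := by rw [div_le_iff₀ a1]; linarith
  have k2 : c ^ 2 / q ≤ R := by rw [div_le_iff₀ a2]; linarith
  have e : 2 / r * (p / (p + q) * (1 - p / (p + q)) * (b / p - c / q) ^ 2 + s / (p + q)) =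
      2 / r * ((b ^ 2 / p + c ^ 2 / q) * (p + q) - (b + c) ^ 2 + s * (p + q)) / (p + q) ^ 2 := by
    field_simp; ring
  rw [e]
  gcongr
  have : 2 * (Q + R + s) / r * (p + q) - (b + c - s) * (2 * (b + c - s + s) / r) =
      2 / r * ((Q + R) * (p + q) - (b + c) ^ 2 + s * (p + q) + s * (b + c)) := by
    field_simp; ring
  rw [this]
  refine mul_le_mul_of_nonneg_left ?_ (by positivity)
  have : (b ^ 2 / p + c ^ 2 / q) * (p + q) ≤ (Q + R) * (p + q) := by gcongr
  nlinarith [mul_nonneg hs0 (add_nonneg b1 b2)]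

lemma Sol.prop_mem (h : Sol u v) (r : ℝ) : 0 < prop u v r ∧ prop u v r < 1 := by
  have a1 := h.ht_pos r
  have a2 := h.symm.ht_pos r
  unfold prop htt
  exact ⟨by positivity, by rw [div_lt_one (by positivity)]; linarith⟩

lemma Sol.nov_nonneg (h : Sol u v) (r : ℝ) : 0 ≤ nov u v r := by
  have := h.htt_pos r
  have := ov_nonneg u v r
  unfold nov; positivity

lemma Sol.frDer_nonneg (h : Sol u v) {r : ℝ} (hr : 0 < r) : 0 ≤ frDer u v r := by
  refine le_trans ?_ (h.frDer_ge hr)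
  obtain ⟨h1, h2⟩ := h.prop_mem r
  have := h.nov_nonneg r
  have : 0 ≤ 1 - prop u v r := by linarith
  positivity

lemma Sol.fr_mono (h : Sol u v) {r s : ℝ} (hr : 0 < r) (hrs : r ≤ s) : fr u v r ≤ fr u v s :=
  monotoneOn_Ici_of_hasDerivAt (a := r) (fun _ hx => h.hasDerivAt_fr (hr.trans_le hx))
    (fun _ hx => h.frDer_nonneg (hr.trans_le hx)) (Set.mem_Ici.2 le_rfl) (Set.mem_Ici.2 hrs) hrs

lemma Sol.htt_le (h : Sol u v) {C₀ : ℝ} (hg : ∀ x, u x + v x ≤ C₀ * (1 + ‖x‖)) :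
    ∃ M, 0 < M ∧ ∀ r, 0 < r → htt u v r ≤ M * (1 + r) ^ 2 := by
  have hI := integrable_one_add_norm_pow n 2
  refine ⟨C₀ ^ 2 * (∫ z, (1 + ‖z‖) ^ 2 ∂(gam n)) + 1, ?_, fun r hr => ?_⟩
  · have : 0 ≤ ∫ z : Eu n, (1 + ‖z‖) ^ 2 ∂(gam n) := integral_nonneg fun _ => by positivity
    positivity
  have e : htt u v r = ∫ z, (u (r • z) ^ 2 + v (r • z) ^ 2) ∂(gam n) :=
    (integral_add (h.tu.sq.integrable_smul r) (h.tv.sq.integrable_smul r)).symm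
  have : htt u v r ≤ ∫ z : Eu n, (C₀ ^ 2 * (1 + r) ^ 2) * (1 + ‖z‖) ^ 2 ∂(gam n) := by
    rw [e]
    refine integral_mono ((h.tu.sq.integrable_smul r).add (h.tv.sq.integrable_smul r))
      (hI.const_mul _) fun z => ?_
    have h1 := hg (r • z)
    have h2 := h.pu (r • z)
    have h3 := h.pv (r • z)
    rw [norm_smul, Real.norm_eq_abs, abs_of_pos hr] at h1
    have hC : 0 < C₀ := by
      by_contra hc
      have : C₀ * (1 + r * ‖z‖) ≤ 0 := mul_nonpos_of_nonpos_of_nonneg (not_lt.1 hc) (by positivity)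
      linarith
    have h4 : u (r • z) + v (r • z) ≤ C₀ * ((1 + r) * (1 + ‖z‖)) := by
      refine h1.trans ?_
      gcongr
      nlinarith [norm_nonneg z]
    calc u (r • z) ^ 2 + v (r • z) ^ 2 ≤ (u (r • z) + v (r • z)) ^ 2 := by nlinarith
      _ ≤ (C₀ * ((1 + r) * (1 + ‖z‖))) ^ 2 := by gcongr
      _ = _ := by ring
  rw [integral_const_mul] at this
  nlinarith [sq_nonneg (1 + r)]

lemma Sol.fr_le_one (h : Sol u v) {C₀ : ℝ} (hg : ∀ x, u x + v x ≤ C₀ * (1 + ‖x‖)) {r : ℝ}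
    (hr : 0 < r) : fr u v r ≤ 1 := by
  by_contra hN
  push Not at hN
  obtain ⟨M, hM, hb⟩ := h.htt_le hg
  set L := fr u v r
  set a := max r 1
  have ha1 : 1 ≤ a := le_max_right _ _
  have ha0 : 0 < a := by linarith
  have hm : MonotoneOn (fun s => Real.log (htt u v s) - 2 * L * Real.log s) (Set.Ici a) := by
    refine monotoneOn_Ici_of_hasDerivAt (f' := fun s =>
      (2 * (ten u v s + s ^ 2 * ov u v s) / s) / htt u v s - 2 * L * s⁻¹) ?_ ?_
    · intro s hs
      have hs0 : 0 < s := by linarith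
      exact ((h.hasDerivAt_htt hs0).log (h.htt_pos s).ne').sub
        ((Real.hasDerivAt_log hs0.ne').const_mul _)
    · intro s hs
      have hs0 : 0 < s := by linarith
      have h1 : L ≤ fr u v s := h.fr_mono hr ((le_max_left _ _).trans hs)
      have h2 := ov_nonneg u v s
      have h3 := h.htt_pos s
      have h4 : (2 * (ten u v s + s ^ 2 * ov u v s) / s) / htt u v s - 2 * L * s⁻¹ =
        2 / s * ((fr u v s - L) + s ^ 2 * ov u v s / htt u v s) := by
        unfold fr; field_simp; ring
      rw [h4]
      have : 0 ≤ fr u v s - L := by linarith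
      positivity
  set c := Real.log (htt u v a) - 2 * L * Real.log a
  have key : ∀ s, a ≤ s → c + 2 * (L - 1) * Real.log s ≤ Real.log (M * 4) := by
    intro s hs
    have hs0 : 0 < s := by linarith
    have h1 := hm (Set.mem_Ici.2 le_rfl) (Set.mem_Ici.2 hs) hs
    have h2 := Real.log_le_log (h.htt_pos s) (hb s hs0)
    have h3 : Real.log (M * (1 + s) ^ 2) ≤ Real.log ((M * 4) * s ^ 2) := by
      refine Real.log_le_log (by positivity) ?_
      rw [mul_assoc]
      have : (1 + s) ^ 2 ≤ 4 * s ^ 2 := by nlinarith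
      gcongr
    rw [Real.log_mul (x := M * 4) (by positivity) (by positivity), Real.log_pow] at h3
    push_cast at h3
    simp only at h1
    linarith
  have hlim := Filter.Tendsto.const_mul_atTop (r := 2 * (L - 1)) (by linarith)
    Real.tendsto_log_atTop
  obtain ⟨s, hs1, hs2⟩ := ((hlim.eventually_gt_atTop (Real.log (M * 4) - c)).and
    (Filter.eventually_ge_atTop a)).exists
  have := key s hs2
  linarith

end freqmono

section acf

variable {n : ℕ} {F u v : Eu n → ℝ}

lemma gav_const (c r : ℝ) : gav (fun _ : Eu n => c) r = c := by simp [gav]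

lemma gav_zero (F : Eu n → ℝ) : gav F 0 = F 0 := by simp [gav]

lemma tendsto_gav_zero (hF : F.HasTemperateGrowth) :
    Filter.Tendsto (gav F) (nhds 0) (nhds (F 0)) := by
  rw [← gav_zero F]
  obtain ⟨k, C, h⟩ := hF.pb
  refine tendsto_integral_filter_of_dominated_convergence (fun z => |C| * (1 + ‖z‖) ^ k)
    (Filter.Eventually.of_forall fun r => (hF.integrable_smul r).aestronglyMeasurable) ?_
    ((integrable_one_add_norm_pow n k).const_mul _)
    (Filter.Eventually.of_forall fun z => ?_)
  · filter_upwards [Metric.ball_mem_nhds (0 : ℝ) one_pos] with r hr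
    refine Filter.Eventually.of_forall fun z => (h _).trans ?_
    rw [mem_ball_zero_iff] at hr
    rw [norm_smul]
    gcongr
    · exact le_abs_self C
    · nlinarith [norm_nonneg z]
  · have h1 : Continuous fun r : ℝ => F (r • z) := by have := hF.1.continuous; fun_prop
    exact h1.tendsto 0

lemma Sol.ht_mono (h : Sol u v) {r s : ℝ} (hr : 0 < r) (hrs : r ≤ s) : ht u r ≤ ht u s :=
  monotoneOn_Ici_of_hasDerivAt (a := r) (fun _ hx => h.hasDerivAt_ht (hr.trans_le hx))
    (fun x hx => div_nonneg (mul_nonneg two_pos.le (en_nonneg u v x)) (hr.trans_le hx).le)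
    (Set.mem_Ici.2 le_rfl) (Set.mem_Ici.2 hrs) hrs

lemma Sol.sq_zero_le_ht (h : Sol u v) {r : ℝ} (hr : 0 < r) : u 0 ^ 2 ≤ ht u r := by
  refine le_of_tendsto ((tendsto_gav_zero h.tu.sq).mono_left
    (nhdsWithin_le_nhds (s := Set.Ioi 0))) ?_
  filter_upwards [Ioc_mem_nhdsGT hr] with s hs
  exact h.ht_mono hs.1 hs.2

lemma Sol.variance_le (h : Sol u v) (r : ℝ) :
    ht u r - gav u r ^ 2 ≤ en u v r - r ^ 2 * ov u v r := by
  have := poincare h.tu r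
  rw [en]; unfold ht; linarith

lemma gav_mul_sub (hF : F.HasTemperateGrowth) {G : Eu n → ℝ} (hG : G.HasTemperateGrowth) (r : ℝ) :
    gav (fun x => (F x - gav F r) * (G x - gav G r)) r =
      gav (fun x => F x * G x) r - gav F r * gav G r := by
  set a := gav F r with ha
  set b := gav G r with hb
  have e : (fun x => (F x - a) * (G x - b)) =
      fun x => (F x * G x - (b * F x + a * G x)) + a * b := by ext x; ring
  have t1 := (Function.HasTemperateGrowth.const (E := Eu n) b).fun_mul hF
  have t2 := (Function.HasTemperateGrowth.const (E := Eu n) a).fun_mul hG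
  rw [e, gav_add ((hF.fun_mul hG).fun_sub (t1.fun_add t2)) (Function.HasTemperateGrowth.const _),
    gav_sub (hF.fun_mul hG) (t1.fun_add t2), gav_add t1 t2, gav_const_mul, gav_const_mul,
    gav_const, ← ha, ← hb]
  ring

lemma gav_covariance_sq_le (hF : F.HasTemperateGrowth) {G : Eu n → ℝ} (hG : G.HasTemperateGrowth)
    (r : ℝ) : (gav (fun x => F x * G x) r - gav F r * gav G r) ^ 2 ≤
      (gav (fun x => F x ^ 2) r - gav F r ^ 2) * (gav (fun x => G x ^ 2) r - gav G r ^ 2) := by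
  rw [← gav_mul_sub hF hG, ← gav_sq_sub_mean hF, ← gav_sq_sub_mean hG]
  exact gav_mul_sq_le (hF.fun_sub (Function.HasTemperateGrowth.const _))
    (hG.fun_sub (Function.HasTemperateGrowth.const _)) r

lemma Sol.lam_nonneg (h : Sol u v) (r : ℝ) : 0 ≤ lam u v r :=
  div_nonneg (en_nonneg _ _ _) (h.ht_pos r).le

lemma Sol.lam_add_lam_ge (h : Sol u v) {r : ℝ} (hr : 1 ≤ r ^ 2 * htt u v r) :
    1 / 16 ≤ lam u v r + lam v u r := by
  have l1 := h.lam_nonneg r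
  have l2 := h.symm.lam_nonneg r
  by_contra hlt
  push Not at hlt
  have p1 := h.ht_pos r
  have p2 := h.symm.ht_pos r
  have e1 : en u v r = lam u v r * ht u r := by unfold lam; field_simp
  have e2 : en v u r = lam v u r * ht v r := by unfold lam; field_simp
  have v1 := h.variance_le r
  have v2 := h.symm.variance_le r
  rw [ov_comm v u] at v2
  have hS := ov_nonneg u v r
  have hS' : 0 ≤ r ^ 2 * ov u v r := by positivity
  have en1 : r ^ 2 * ov u v r ≤ en u v r := by
    have := gav_nonneg (gsq_nonneg u) r; unfold en; gcongr; linarith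
  have en2 : r ^ 2 * ov u v r ≤ en v u r := by
    have := gav_nonneg (gsq_nonneg v) r; unfold en; rw [ov_comm v u]; gcongr; linarith
  have cov := gav_covariance_sq_le h.tu h.tv r
  have jen : gav (fun x => u x * v x) r ^ 2 ≤ ov u v r := by
    have := gav_mul_sq_le (h.tu.fun_mul h.tv) (Function.HasTemperateGrowth.const (1 : ℝ)) r
    simp only [mul_one, one_pow, gav_const, mul_pow] at this
    exact this
  have m1 : 0 < gav u r := gav_pos h.tu h.pu r
  have m2 : 0 < gav v r := gav_pos h.tv h.pv r
  have vq : 0 ≤ ht v r - gav v r ^ 2 := by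
    rw [ht, ← gav_sq_sub_mean h.tv]; exact gav_nonneg (fun _ => sq_nonneg _) r
  unfold htt at hr
  change _ ≤ (ht u r - _) * (ht v r - _) at cov
  generalize gav (fun x => u x * v x) r = w at *
  generalize gav u r = a at *
  generalize gav v r = b at *
  generalize ht u r = p at *
  generalize ht v r = q at *
  generalize ov u v r = S at *
  generalize lam u v r = x at *
  generalize lam v u r = y at *
  rw [e1] at v1 en1
  rw [e2] at v2 en2
  have va : p - a ^ 2 ≤ p / 16 := by nlinarith
  have vb : q - b ^ 2 ≤ q / 16 := by nlinarith
  have sp : 0 < Real.sqrt (p * q) := Real.sqrt_pos.2 (by positivity)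
  have sq' : Real.sqrt (p * q) ^ 2 = p * q := Real.sq_sqrt (by positivity)
  set t := Real.sqrt (p * q)
  have hab : (15 / 16 * t) ≤ a * b := by
    refine abs_le_of_sq_le_sq' ?_ (by positivity) |>.2
    have : (15 / 16 * p) * (15 / 16 * q) ≤ a ^ 2 * b ^ 2 := by
      apply mul_le_mul <;> first | positivity | linarith
    nlinarith
  have hc : -(1 / 16 * t) ≤ w - a * b := by
    refine abs_le_of_sq_le_sq' ?_ (by positivity) |>.1
    have : (p - a ^ 2) * (q - b ^ 2) ≤ (p / 16) * (q / 16) := by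
      exact mul_le_mul va vb vq (by positivity)
    nlinarith
  have hw : 7 / 8 * t ≤ w := by linarith
  have hS2 : 49 / 64 * (p * q) ≤ S := by nlinarith
  have k1 : r ^ 2 * (49 / 64 * q) ≤ x := by
    have : r ^ 2 * (49 / 64 * (p * q)) ≤ x * p := le_trans (by gcongr) en1
    exact le_of_mul_le_mul_right (by linarith) p1
  have k2 : r ^ 2 * (49 / 64 * p) ≤ y := by
    have : r ^ 2 * (49 / 64 * (p * q)) ≤ y * q := le_trans (by gcongr) en2
    exact le_of_mul_le_mul_right (by linarith) p2
  linarith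

/-- Weak Alt–Caffarelli–Friedman type growth of the product of the heights. -/
lemma Sol.product_growth (h : Sol u v) {r : ℝ} (hr : 0 < r) (h1 : 1 ≤ r ^ 2 * (u 0 * v 0)) :
    (u 0 * v 0) ^ 2 * (r ^ 2 * (u 0 * v 0)) ^ (1 / 16 : ℝ) ≤ ht u r * ht v r := by
  have u0 := h.pu 0
  have v0 := h.pv 0
  set w := u 0 * v 0 with hw
  have w0 : 0 < w := mul_pos u0 v0
  set a := (Real.sqrt w)⁻¹ with ha
  have a0 : 0 < a := by have := Real.sqrt_pos.2 w0; positivity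
  have a2 : a ^ 2 = w⁻¹ := by rw [ha, inv_pow, Real.sq_sqrt w0.le]
  have har : a ≤ r := by
    refine abs_le_of_sq_le_sq' ?_ hr.le |>.2
    rw [a2, inv_le_iff_one_le_mul₀ w0]; exact h1
  have hm : MonotoneOn (fun s => Real.log (ht u s) + Real.log (ht v s) - 1 / 8 * Real.log s)
      (Set.Ici a) := by
    refine monotoneOn_Ici_of_hasDerivAt (f' := fun s =>
      2 * en u v s / s / ht u s + 2 * en v u s / s / ht v s - 1 / 8 * s⁻¹) ?_ ?_
    · intro s hs
      have hs0 : 0 < s := by linarith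
      exact (((h.hasDerivAt_ht hs0).log (h.ht_pos s).ne').add
        ((h.symm.hasDerivAt_ht hs0).log (h.symm.ht_pos s).ne')).sub
        ((Real.hasDerivAt_log hs0.ne').const_mul _)
    · intro s hs
      have hs0 : 0 < s := by linarith
      have p1 := h.ht_pos s
      have p2 := h.symm.ht_pos s
      have hh : 2 * w ≤ htt u v s := by
        have := h.sq_zero_le_ht hs0
        have := h.symm.sq_zero_le_ht hs0
        unfold htt
        nlinarith [sq_nonneg (u 0 - v 0)]
      have h2 : 1 ≤ s ^ 2 * htt u v s := by
        have : 1 ≤ s ^ 2 * w := by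
          have : a ^ 2 ≤ s ^ 2 := by gcongr
          calc 1 = w⁻¹ * w := by field_simp
            _ ≤ s ^ 2 * w := by rw [← a2]; gcongr
        nlinarith [sq_nonneg s]
      have h3 := h.lam_add_lam_ge h2
      have e : 2 * en u v s / s / ht u s + 2 * en v u s / s / ht v s - 1 / 8 * s⁻¹ =
          2 / s * (lam u v s + lam v u s - 1 / 16) := by
        unfold lam; field_simp; ring
      rw [e]
      have : 0 ≤ lam u v s + lam v u s - 1 / 16 := by linarith
      positivity
  have key := hm (Set.mem_Ici.2 le_rfl) (Set.mem_Ici.2 har) har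
  simp only at key
  have l1 := Real.log_le_log (by positivity) (h.sq_zero_le_ht a0)
  have l2 := Real.log_le_log (by positivity) (h.symm.sq_zero_le_ht a0)
  have pu := h.ht_pos r
  have pv := h.symm.ht_pos r
  rw [← Real.log_le_log_iff (by positivity) (by positivity), Real.log_mul (by positivity)
    (by positivity), Real.log_mul (by positivity) (by positivity), Real.log_rpow (by positivity),
    Real.log_mul (by positivity) (by positivity), Real.log_pow, Real.log_pow]
  have la : Real.log a = -(1 / 2 * Real.log w) := by
    rw [ha, Real.log_inv, Real.log_sqrt w0.le]; ring
  have lw : Real.log w = Real.log (u 0) + Real.log (v 0) := Real.log_mul u0.ne' v0.ne'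
  rw [Real.log_pow] at l1 l2
  push_cast at *
  linarith

lemma gdens_shift (w z : Eu n) : gdens ((3 : ℝ) • w - z) ≤ Real.exp (‖z‖ ^ 2 / 16) * gdens w := by
  have := gmass_pos n
  unfold gdens
  rw [mul_left_comm, ← Real.exp_add]
  gcongr
  have h1 : 0 ≤ ‖(8 : ℝ) • w - (3 : ℝ) • z‖ ^ 2 := sq_nonneg _
  rw [norm_sub_sq_real, norm_smul, real_inner_smul_left]
  rw [norm_sub_sq_real, norm_smul, norm_smul, real_inner_smul_left, real_inner_smul_right] at h1
  norm_num at h1 ⊢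
  nlinarith

lemma gav_translate_le (hF : F.HasTemperateGrowth) (h0 : ∀ x, 0 ≤ F x) (r : ℝ) (z : Eu n) :
    gav (fun x => F (r • z + x)) r ≤ 3 ^ n * Real.exp (‖z‖ ^ 2 / 16) * gav F (3 * r) := by
  have e : gav (fun x => F (r • z + x)) r =
      3 ^ n * ∫ w, gdens ((3 : ℝ) • w - z) * F ((3 * r) • w) := by
    rw [gav, integral_gam]
    have h1 := integral_sub_right_eq_self (μ := (volume : Measure (Eu n)))
      (fun y => gdens y * F (r • z + r • y)) z
    rw [← h1]
    have h2 := Measure.integral_comp_smul (volume : Measure (Eu n))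
      (fun y => gdens (y - z) * F (r • z + r • (y - z))) (3 : ℝ)
    rw [finrank_euclideanSpace_fin] at h2
    have h3 : ∀ w : Eu n, gdens ((3 : ℝ) • w - z) * F ((3 * r) • w) =
        gdens ((3 : ℝ) • w - z) * F (r • z + r • ((3 : ℝ) • w - z)) := by
      intro w
      congr 2
      module
    simp only [h3, h2]
    rw [abs_of_pos (by positivity : (0 : ℝ) < ((3 : ℝ) ^ n)⁻¹), smul_eq_mul, ← mul_assoc,
      mul_inv_cancel₀ (pow_ne_zero n (by norm_num : (3 : ℝ) ≠ 0)),
      one_mul]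
  rw [e, gav, integral_gam, mul_assoc, ← integral_const_mul (Real.exp (‖z‖ ^ 2 / 16))]
  have h3 : (0 : ℝ) ≤ 3 ^ n := by positivity
  refine mul_le_mul_of_nonneg_left ?_ h3
  have hi := (integrable_gam_iff.1 (hF.integrable_smul (3 * r))).const_mul
    (Real.exp (‖z‖ ^ 2 / 16))
  refine integral_mono_of_nonneg (Filter.Eventually.of_forall fun w =>
    mul_nonneg (gdens_pos _).le (h0 _)) hi (Filter.Eventually.of_forall fun w => ?_)
  have := gdens_shift w z
  have := h0 ((3 * r) • w)
  simp only
  rw [← mul_assoc]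
  gcongr

lemma Sol.sq_le (h : Sol u v) {r : ℝ} (hr : 0 < r) (z : Eu n) :
    u (r • z) ^ 2 ≤ 3 ^ n * Real.exp (‖z‖ ^ 2 / 16) * ht u (3 * r) := by
  have h1 := (h.translate (r • z)).sq_zero_le_ht hr
  simp only [add_zero] at h1
  exact h1.trans (gav_translate_le h.tu.sq (fun _ => sq_nonneg _) r z)

lemma Sol.product_le (h : Sol u v) {r : ℝ} (hr : 0 < r) (z : Eu n)
    (h1 : 1 ≤ r ^ 2 * (u (r • z) * v (r • z))) :
    (u (r • z) * v (r • z)) ^ 2 * (r ^ 2 * (u (r • z) * v (r • z))) ^ (1 / 16 : ℝ) ≤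
      (3 ^ n * Real.exp (‖z‖ ^ 2 / 16)) ^ 2 * (ht u (3 * r) * ht v (3 * r)) := by
  have h2 := (h.translate (r • z)).product_growth hr (by simpa using h1)
  simp only [add_zero] at h2
  refine h2.trans ?_
  have k1 := gav_translate_le h.tu.sq (fun _ => sq_nonneg _) r z
  have k2 := gav_translate_le h.tv.sq (fun _ => sq_nonneg _) r z
  have p2 := ((h.translate (r • z)).symm.ht_pos r).le
  have p1 := ((h.translate (r • z)).ht_pos r).le
  have := mul_le_mul k1 k2 p2 (p1.trans k1)
  refine this.trans_eq ?_
  unfold ht; ring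

/-- Doubling of both heights. -/
def Dbl (u v : Eu n → ℝ) (K r : ℝ) : Prop := ht u (4 * r) ≤ K * ht u r ∧ ht v (4 * r) ≤ K * ht v r

lemma Sol.exists_overlap_bound (h : Sol u v) (K : ℝ) (hK : 1 ≤ K) :
    ∃ C, 1 ≤ C ∧ ∃ R, 1 ≤ R ∧ ∀ r, R ≤ r → Dbl u v K r → ∀ z : Eu n,
      u (r • z) * v (r • z) ≤ C * r ^ (-(1 / 32) : ℝ) * Real.exp (‖z‖ ^ 2 / 16) *
        Real.sqrt (ht u r * ht v r) := by
  set c := Real.sqrt (ht u 1 * ht v 1) with hc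
  have c0 : 0 < c := Real.sqrt_pos.2 (mul_pos (h.ht_pos 1) (h.symm.ht_pos 1))
  refine ⟨3 ^ n * K * c ^ (-(1 / 32) : ℝ) + 1, by have : 0 < K := by linarith
                                                  have := Real.rpow_pos_of_pos c0 (-(1 / 32))
                                                  have : 0 < 3 ^ n * K * c ^ (-(1 / 32) : ℝ) := by
                                                    positivity
                                                  linarith, max 1 c⁻¹, le_max_left _ _, ?_⟩
  intro r hr hD z
  have r1 : 1 ≤ r := (le_max_left _ _).trans hr
  have r0 : 0 < r := by linarith
  have rc : 1 ≤ r * c := by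
    have : c⁻¹ ≤ r := (le_max_right _ _).trans hr
    rwa [inv_le_iff_one_le_mul₀ c0] at this
  have p1 := h.ht_pos r
  have p2 := h.symm.ht_pos r
  have cs : c ≤ Real.sqrt (ht u r * ht v r) := by
    have q1 := h.ht_mono one_pos r1
    have q2 := h.symm.ht_mono one_pos r1
    have q0 := (h.symm.ht_pos 1).le
    rw [hc]; gcongr
  have s2 : Real.sqrt (ht u r * ht v r) ^ 2 = ht u r * ht v r := Real.sq_sqrt (by positivity)
  set s := Real.sqrt (ht u r * ht v r)
  have s0 : 0 < s := c0.trans_le cs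
  have w0 : 0 < u (r • z) * v (r • z) := mul_pos (h.pu _) (h.pv _)
  have hpl := h.product_le r0 z
  set w := u (r • z) * v (r • z)
  have ex : 1 ≤ Real.exp (‖z‖ ^ 2 / 16) := Real.one_le_exp (by positivity)
  set X := Real.exp (‖z‖ ^ 2 / 16)
  set e := r ^ (-(1 / 32) : ℝ) with he
  have e0 : 0 < e := by positivity
  have cc := Real.rpow_pos_of_pos c0 (-(1 / 32))
  have K0 : 0 < K := by linarith
  by_cases hw : w ≤ s / r
  · have e1 : r⁻¹ ≤ e := by
      rw [he, ← Real.rpow_neg_one]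
      exact Real.rpow_le_rpow_of_exponent_le r1 (by norm_num)
    calc w ≤ r⁻¹ * s := by rw [mul_comm]; exact hw
      _ ≤ e * s := by gcongr
      _ = 1 * e * 1 * s := by ring
      _ ≤ _ := by
        gcongr
        have : 0 ≤ 3 ^ n * K * c ^ (-(1 / 32) : ℝ) := by positivity
        linarith
  · push Not at hw
    have hw2 : r * c ≤ r ^ 2 * w := by
      have : s / r * r = s := by field_simp
      nlinarith
    have h2 := hpl (rc.trans hw2)
    have t1 : ht u (3 * r) ≤ K * ht u r := (h.ht_mono (by positivity) (by linarith)).trans hD.1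
    have t2 : ht v (3 * r) ≤ K * ht v r := (h.symm.ht_mono (by positivity) (by linarith)).trans hD.2
    have h3 : w ^ 2 * (r * c) ^ (1 / 16 : ℝ) ≤ (3 ^ n * X) ^ 2 * ((K * s) ^ 2) := by
      calc _ ≤ w ^ 2 * (r ^ 2 * w) ^ (1 / 16 : ℝ) := by gcongr
        _ ≤ _ := h2
        _ ≤ (3 ^ n * X) ^ 2 * ((K * ht u r) * (K * ht v r)) := by
            have := (h.symm.ht_pos (3 * r)).le
            gcongr
        _ = _ := by rw [mul_pow K, s2]; ring
    have ed : (e * c ^ (-(1 / 32) : ℝ)) ^ 2 * (r * c) ^ (1 / 16 : ℝ) = 1 := by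
      rw [he, ← Real.mul_rpow r0.le c0.le, ← Real.rpow_natCast, ← Real.rpow_mul (by positivity),
        ← Real.rpow_add (by positivity)]
      norm_num
    have hy : 0 < (r * c) ^ (1 / 16 : ℝ) := by positivity
    have h4 : w ^ 2 ≤ (3 ^ n * X * (K * s) * (e * c ^ (-(1 / 32) : ℝ))) ^ 2 := by
      have : w ^ 2 * (r * c) ^ (1 / 16 : ℝ) ≤
        (3 ^ n * X * (K * s) * (e * c ^ (-(1 / 32) : ℝ))) ^ 2 * (r * c) ^ (1 / 16 : ℝ) := by
        rw [mul_pow _ (e * c ^ (-(1 / 32) : ℝ)), mul_assoc, ed]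
        refine h3.trans_eq ?_
        ring
      exact le_of_mul_le_mul_right this hy
    have h5 := abs_le_of_sq_le_sq' h4 (by positivity) |>.2
    refine h5.trans ?_
    have : 0 ≤ e * X * s := by positivity
    nlinarith

end acf

section overlap

variable {n : ℕ} {F G w u v : Eu n → ℝ}

lemma norm_sq_eq_sum_sq (x : Eu n) : ‖x‖ ^ 2 = ∑ i, x i * x i := by
  rw [EuclideanSpace.norm_sq_eq]
  exact Finset.sum_congr rfl fun i _ => by rw [Real.norm_eq_abs, sq_abs, sq]

lemma hasTemperateGrowth_norm_sq : Function.HasTemperateGrowth (fun x : Eu n => ‖x‖ ^ 2) := by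
  have : (fun x : Eu n => ‖x‖ ^ 2) = fun x => ∑ i, x i * x i := funext norm_sq_eq_sum_sq
  rw [this]
  exact Function.HasTemperateGrowth.sum fun i _ =>
    (hasTemperateGrowth_coord i).fun_mul (hasTemperateGrowth_coord i)

/-- Gaussian integration by parts for the Euler field. -/
lemma gav_norm_sq_mul (hG : G.HasTemperateGrowth) (r : ℝ) :
    gav (fun x => ‖x‖ ^ 2 * G x) r = r ^ 2 * (n * gav G r + gav (euler G) r) := by
  have e : (fun x => ‖x‖ ^ 2 * G x) = fun x => ∑ i, x i * (x i * G x) := by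
    ext x; rw [norm_sq_eq_sum_sq, Finset.sum_mul]; exact Finset.sum_congr rfl fun i _ => by ring
  have t1 : ∀ i, Function.HasTemperateGrowth (fun x : Eu n => x i * G x) := fun i =>
    (hasTemperateGrowth_coord i).fun_mul hG
  have t2 : ∀ i, Function.HasTemperateGrowth (fun x : Eu n => x i * pd i G x) := fun i =>
    (hasTemperateGrowth_coord i).fun_mul (hG.pd i)
  have e2 : euler G = fun x => ∑ i, x i * pd i G x := rfl
  rw [e, gav_sum Finset.univ (fun i => (hasTemperateGrowth_coord i).fun_mul (t1 i)), e2,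
    gav_sum Finset.univ t2]
  have e3 : ∀ i, gav (fun x => x i * (x i * G x)) r =
      r ^ 2 * (gav G r + gav (fun x => x i * pd i G x) r) := by
    intro i
    rw [stein (t1 i)]
    have : pd i (fun x : Eu n => x i * G x) = fun x => x i * pd i G x + G x := by
      rw [pd_mul (hasTemperateGrowth_coord i).smooth.diffble hG.smooth.diffble]
      ext x
      rw [pd_coord]; simp
    rw [this, gav_add (t2 i) hG, add_comm]
  simp only [e3]
  rw [← Finset.mul_sum, Finset.sum_add_distrib, Finset.sum_const, Finset.card_univ,
    Fintype.card_fin, nsmul_eq_mul]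

lemma gdens_mul_exp (z : Eu n) :
    gdens z * Real.exp (3 / 8 * ‖z‖ ^ 2) = gdens ((2⁻¹ : ℝ) • z) := by
  unfold gdens
  rw [mul_assoc, ← Real.exp_add, norm_smul]
  congr 2
  norm_num
  ring

lemma integral_exp_mul (F : Eu n → ℝ) (r : ℝ) :
    ∫ z, Real.exp (3 / 8 * ‖z‖ ^ 2) * F (r • z) ∂(gam n) = 2 ^ n * gav F (2 * r) := by
  have e : ∀ z : Eu n, gdens z * (Real.exp (3 / 8 * ‖z‖ ^ 2) * F (r • z)) =
      gdens ((2⁻¹ : ℝ) • z) * F ((2 * r) • (2⁻¹ : ℝ) • z) := by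
    intro z
    rw [← mul_assoc, gdens_mul_exp, smul_smul]
    congr 3
    ring
  rw [gav, integral_gam, integral_gam]
  simp only [e]
  have h2 := Measure.integral_comp_inv_smul (volume : Measure (Eu n))
      (fun y => gdens y * F ((2 * r) • y)) (2 : ℝ)
  rw [finrank_euclideanSpace_fin] at h2
  rw [h2, abs_of_pos (by positivity : (0 : ℝ) < 2 ^ n), smul_eq_mul]

lemma integrable_exp_mul (hF : F.HasTemperateGrowth) (r : ℝ) :
    Integrable (fun z => Real.exp (3 / 8 * ‖z‖ ^ 2) * F (r • z)) (gam n) := by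
  have e : ∀ z : Eu n, gdens z * (Real.exp (3 / 8 * ‖z‖ ^ 2) * F (r • z)) =
      gdens ((2⁻¹ : ℝ) • z) * F ((2 * r) • (2⁻¹ : ℝ) • z) := by
    intro z
    rw [← mul_assoc, gdens_mul_exp, smul_smul]
    congr 3
    ring
  rw [integrable_gam_iff]
  simp only [e]
  exact (integrable_gam_iff.1 (hF.integrable_smul (2 * r))).comp_smul (by norm_num)

lemma gav_norm_sq_mul_le (hG : G.HasTemperateGrowth) (h0 : ∀ x, 0 ≤ G x) (r : ℝ) :
    gav (fun x => ‖x‖ ^ 2 * G x) r ≤ r ^ 2 * (3 * 2 ^ n * gav G (2 * r)) := by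
  rw [mul_assoc 3, ← integral_exp_mul, ← integral_const_mul, ← integral_const_mul]
  refine integral_mono ((hasTemperateGrowth_norm_sq.fun_mul hG).integrable_smul r)
    (((integrable_exp_mul hG r).const_mul _).const_mul _) fun z => ?_
  have := Real.add_one_le_exp (3 / 8 * ‖z‖ ^ 2)
  have h1 := h0 (r • z)
  simp only
  rw [norm_smul, mul_pow, Real.norm_eq_abs, sq_abs, mul_assoc]
  refine mul_le_mul_of_nonneg_left ?_ (sq_nonneg r)
  rw [← mul_assoc]
  refine mul_le_mul_of_nonneg_right ?_ h1
  nlinarith [sq_nonneg ‖z‖]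

lemma gav_Lap_le (hG : G.HasTemperateGrowth) (h0 : ∀ x, 0 ≤ G x) {r : ℝ} (hr : 0 < r) :
    r ^ 2 * gav (Lap G) r ≤ 3 * 2 ^ n * gav G (2 * r) := by
  have h1 := gav_norm_sq_mul_le hG h0 r
  rw [gav_norm_sq_mul hG, ← gav_euler hG] at *
  have h2 := le_of_mul_le_mul_left h1 (by positivity)
  have := gav_nonneg h0 r
  have : 0 ≤ n * gav G r := by positivity
  linarith

/-- A convex function of growth `3/2` composed with `w`. -/
def bend (w : Eu n → ℝ) (x : Eu n) : ℝ := (1 + w x ^ 2) ^ (3 / 4 : ℝ)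

lemma hasTemperateGrowth_rpow (hw : w.HasTemperateGrowth) (a : ℝ) :
    Function.HasTemperateGrowth (fun x => (1 + w x ^ 2) ^ a) := by
  have h := (Function.hasTemperateGrowth_one_add_norm_sq_rpow ℝ a).comp hw
  simpa [Function.comp_def] using h

lemma hasDerivAt_rpow_one_add_sq (a s : ℝ) :
    HasDerivAt (fun s : ℝ => (1 + s ^ 2) ^ a) (2 * a * s * (1 + s ^ 2) ^ (a - 1)) s := by
  have h1 : HasDerivAt (fun s : ℝ => 1 + s ^ 2) (2 * s) s := by
    simpa using (hasDerivAt_pow 2 s).const_add 1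
  have h2 := h1.rpow_const (p := a) (Or.inl (by positivity))
  exact h2.congr_deriv (by ring)

lemma Lap_bend_ge (hw : w.HasTemperateGrowth) (h0 : ∀ x, 0 ≤ w x) (hL : ∀ x, 0 ≤ Lap w x)
    (x : Eu n) : 3 / 4 * (gsq w x * (1 + w x ^ 2) ^ (-(1 / 4) : ℝ)) ≤ Lap (bend w) x := by
  have d1 : Differentiable ℝ (fun s : ℝ => (1 + s ^ 2) ^ (3 / 4 : ℝ)) := fun s =>
    (hasDerivAt_rpow_one_add_sq _ s).differentiableAt
  have hd1 : deriv (fun s : ℝ => (1 + s ^ 2) ^ (3 / 4 : ℝ)) =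
      fun s => 3 / 2 * s * (1 + s ^ 2) ^ (-(1 / 4) : ℝ) := by
    ext s; rw [(hasDerivAt_rpow_one_add_sq _ s).deriv]; norm_num
  have hd2 : ∀ s : ℝ, HasDerivAt (fun s : ℝ => 3 / 2 * s * (1 + s ^ 2) ^ (-(1 / 4) : ℝ))
      ((3 / 2 + 3 / 4 * s ^ 2) * (1 + s ^ 2) ^ (-(5 / 4) : ℝ)) s := by
    intro s
    have h1 : HasDerivAt (fun s : ℝ => 3 / 2 * s) (3 / 2) s := by
      simpa using (hasDerivAt_id s).const_mul (3 / 2)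
    refine (h1.mul (hasDerivAt_rpow_one_add_sq (-(1 / 4)) s)).congr_deriv ?_
    have : (1 + s ^ 2) ^ (-(1 / 4) : ℝ) = (1 + s ^ 2) * (1 + s ^ 2) ^ (-(5 / 4) : ℝ) := by
      rw [← Real.rpow_one_add' (by positivity) (by norm_num)]; norm_num
    rw [this, show (-(1 / 4) - 1 : ℝ) = -(5 / 4) by norm_num]
    ring
  have hp1 : ∀ i, pd i (bend w) =
      fun x => (3 / 2 * w x * (1 + w x ^ 2) ^ (-(1 / 4) : ℝ)) * pd i w x := by
    intro i
    have := pd_comp hw.smooth.diffble d1 i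
    rw [hd1] at this
    exact this
  have hp2 : ∀ i, pd i (pd i (bend w)) x =
      (3 / 2 * w x * (1 + w x ^ 2) ^ (-(1 / 4) : ℝ)) * pd i (pd i w) x +
      pd i w x ^ 2 * ((3 / 2 + 3 / 4 * w x ^ 2) * (1 + w x ^ 2) ^ (-(5 / 4) : ℝ)) := by
    intro i
    have d2 : Differentiable ℝ (fun s : ℝ => 3 / 2 * s * (1 + s ^ 2) ^ (-(1 / 4) : ℝ)) :=
      fun s => (hd2 s).differentiableAt
    have c := pd_comp hw.smooth.diffble d2 i
    rw [hp1, pd_mul (f := fun x => 3 / 2 * w x * (1 + w x ^ 2) ^ (-(1 / 4) : ℝ))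
      (d2.comp hw.smooth.diffble) (hw.pd i).smooth.diffble, c]
    simp only [(hd2 _).deriv]
    ring
  have e : Lap (bend w) x = (3 / 2 * w x * (1 + w x ^ 2) ^ (-(1 / 4) : ℝ)) * Lap w x +
      gsq w x * ((3 / 2 + 3 / 4 * w x ^ 2) * (1 + w x ^ 2) ^ (-(5 / 4) : ℝ)) := by
    unfold Lap gsq
    simp only [hp2]
    rw [Finset.sum_add_distrib, ← Finset.mul_sum, ← Finset.sum_mul]
  have h5 : (1 + w x ^ 2) ^ (-(1 / 4) : ℝ) = (1 + w x ^ 2) * (1 + w x ^ 2) ^ (-(5 / 4) : ℝ) := by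
    rw [← Real.rpow_one_add' (by positivity) (by norm_num)]; norm_num
  have k1 : 0 ≤ (3 / 2 * w x * (1 + w x ^ 2) ^ (-(1 / 4) : ℝ)) * Lap w x := by
    have := h0 x; have := hL x; positivity
  have k2 : 0 ≤ gsq w x * (1 + w x ^ 2) ^ (-(5 / 4) : ℝ) := by
    have := gsq_nonneg w x; positivity
  have k3 : 0 ≤ gsq w x * (1 + w x ^ 2) ^ (-(1 / 4) : ℝ) := by
    have := gsq_nonneg w x; positivity
  rw [e]
  rw [h5] at k1 k3 ⊢
  linarith

lemma gav_weighted_gradient_le (hw : w.HasTemperateGrowth) (h0 : ∀ x, 0 ≤ w x)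
    (hL : ∀ x, 0 ≤ Lap w x) {r : ℝ} (hr : 0 < r) :
    r ^ 2 * gav (fun x => gsq w x * (1 + w x ^ 2) ^ (-(1 / 4) : ℝ)) r ≤
      4 * 2 ^ n * gav (bend w) (2 * r) := by
  have tb : (bend w).HasTemperateGrowth := hasTemperateGrowth_rpow hw _
  have tg := hw.gsq.fun_mul (hasTemperateGrowth_rpow hw (-(1 / 4)))
  have h1 := gav_Lap_le tb (fun x => by unfold bend; positivity) hr
  have h2 := gav_mono ((Function.HasTemperateGrowth.const (3 / 4 : ℝ)).fun_mul tg) tb.Lap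
    (Lap_bend_ge hw h0 hL) r
  rw [gav_const_mul] at h2
  nlinarith [sq_nonneg r]

end overlap

section cross

variable {n : ℕ} {F G w w' u v : Eu n → ℝ}

lemma sum_mul_le_of_weights {ι : Type*} (s : Finset ι) (x y : ι → ℝ) {p q : ℝ} (hp : 0 < p)
    (hq : 0 < q) : |∑ i ∈ s, x i * y i| ≤
      1 / 2 * ((∑ i ∈ s, x i ^ 2) * (p ^ 2)⁻¹ + (∑ i ∈ s, y i ^ 2) * (q ^ 2)⁻¹) * (p * q) := by
  have e : (∑ i ∈ s, x i ^ 2) * (p ^ 2)⁻¹ + (∑ i ∈ s, y i ^ 2) * (q ^ 2)⁻¹ =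
      ∑ i ∈ s, ((x i / p) ^ 2 + (y i / q) ^ 2) := by
    rw [Finset.sum_add_distrib, Finset.sum_mul, Finset.sum_mul]
    simp only [div_eq_mul_inv, mul_pow, inv_pow]
  rw [e, Finset.mul_sum, Finset.sum_mul]
  refine (Finset.abs_sum_le_sum_abs _ _).trans (Finset.sum_le_sum fun i _ => ?_)
  have h1 : x i * y i = (x i / p) * (y i / q) * (p * q) := by field_simp
  rw [h1, abs_mul, abs_of_pos (mul_pos hp hq)]
  refine mul_le_mul_of_nonneg_right ?_ (mul_pos hp hq).le
  rw [abs_le]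
  constructor <;> nlinarith [sq_nonneg (x i / p + y i / q), sq_nonneg (x i / p - y i / q)]

lemma hasTemperateGrowth_inner_pd (hw : w.HasTemperateGrowth) (hw' : w'.HasTemperateGrowth) :
    Function.HasTemperateGrowth (fun x => ∑ i, pd i w x * pd i w' x) :=
  Function.HasTemperateGrowth.sum fun i _ => (hw.pd i).fun_mul (hw'.pd i)

lemma gav_inner_pd_le (hw : w.HasTemperateGrowth) (h0 : ∀ x, 0 ≤ w x) (hL : ∀ x, 0 ≤ Lap w x)
    (hw' : w'.HasTemperateGrowth) (h0' : ∀ x, 0 ≤ w' x) (hL' : ∀ x, 0 ≤ Lap w' x)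
    {r L N : ℝ} (hr : 0 < r) (hl : 0 ≤ L)
    (hov : ∀ z, (1 + w (r • z) ^ 2) * (1 + w' (r • z) ^ 2) ≤ L ^ 8 * Real.exp (‖z‖ ^ 2 / 8))
    (hN : gav (bend w) (4 * r) ≤ N) (hN' : gav (bend w') (4 * r) ≤ N) :
    r ^ 2 * |gav (fun x => ∑ i, pd i w x * pd i w' x) r| ≤ L * 4 ^ n * N := by
  set g : Eu n → ℝ := fun x => gsq w x * (1 + w x ^ 2) ^ (-(1 / 4) : ℝ) with hg
  set g' : Eu n → ℝ := fun x => gsq w' x * (1 + w' x ^ 2) ^ (-(1 / 4) : ℝ) with hg'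
  have tg : g.HasTemperateGrowth := hw.gsq.fun_mul (hasTemperateGrowth_rpow hw _)
  have tg' : g'.HasTemperateGrowth := hw'.gsq.fun_mul (hasTemperateGrowth_rpow hw' _)
  have k1 := gav_weighted_gradient_le hw h0 hL (r := 2 * r) (by positivity)
  have k2 := gav_weighted_gradient_le hw' h0' hL' (r := 2 * r) (by positivity)
  rw [← mul_assoc 2 2 r] at k1 k2
  norm_num only at k1 k2
  have pw : ∀ z : Eu n, |∑ i, pd i w (r • z) * pd i w' (r • z)| ≤
      1 / 2 * L * (Real.exp (3 / 8 * ‖z‖ ^ 2) * (g (r • z) + g' (r • z))) := by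
    intro z
    have P0 : 0 < 1 + w (r • z) ^ 2 := by positivity
    have Q0 : 0 < 1 + w' (r • z) ^ 2 := by positivity
    have ho := hov z
    set P := 1 + w (r • z) ^ 2
    set Q := 1 + w' (r • z) ^ 2
    set p := P ^ (1 / 8 : ℝ) with hp
    set q := Q ^ (1 / 8 : ℝ) with hq
    have p0 : 0 < p := by positivity
    have q0 : 0 < q := by positivity
    have p8 : p ^ 8 = P := by rw [hp, ← Real.rpow_natCast, ← Real.rpow_mul P0.le]; norm_num
    have q8 : q ^ 8 = Q := by rw [hq, ← Real.rpow_natCast, ← Real.rpow_mul Q0.le]; norm_num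
    have p2 : (p ^ 2)⁻¹ = P ^ (-(1 / 4) : ℝ) := by
      rw [hp, ← Real.rpow_natCast, ← Real.rpow_mul P0.le, ← Real.rpow_neg P0.le]; norm_num
    have q2 : (q ^ 2)⁻¹ = Q ^ (-(1 / 4) : ℝ) := by
      rw [hq, ← Real.rpow_natCast, ← Real.rpow_mul Q0.le, ← Real.rpow_neg Q0.le]; norm_num
    have hs := sum_mul_le_of_weights Finset.univ (fun i => pd i w (r • z))
      (fun i => pd i w' (r • z)) p0 q0
    rw [p2, q2] at hs
    refine hs.trans ?_
    change 1 / 2 * (g (r • z) + g' (r • z)) * (p * q) ≤ _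
    have g0 : 0 ≤ g (r • z) := mul_nonneg (gsq_nonneg _ _) (by positivity)
    have g0' : 0 ≤ g' (r • z) := mul_nonneg (gsq_nonneg _ _) (by positivity)
    have hpq : p * q ≤ L * Real.exp (‖z‖ ^ 2 / 64) := by
      refine le_of_pow_le_pow_left₀ (n := 8) (by norm_num) (by positivity) ?_
      rw [mul_pow, p8, q8, mul_pow, ← Real.exp_nat_mul]
      refine ho.trans_eq ?_
      congr 2
      push_cast; ring
    have he : Real.exp (‖z‖ ^ 2 / 64) ≤ Real.exp (3 / 8 * ‖z‖ ^ 2) := by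
      apply Real.exp_le_exp.2; nlinarith [sq_nonneg ‖z‖]
    calc _ ≤ 1 / 2 * (g (r • z) + g' (r • z)) * (L * Real.exp (3 / 8 * ‖z‖ ^ 2)) := by
          refine mul_le_mul_of_nonneg_left (hpq.trans ?_) (by positivity)
          exact mul_le_mul_of_nonneg_left he hl
      _ = _ := by ring
  have h1 : |gav (fun x => ∑ i, pd i w x * pd i w' x) r| ≤
      1 / 2 * L * (2 ^ n * gav (fun x => g x + g' x) (2 * r)) := by
    rw [← integral_exp_mul, ← integral_const_mul]
    refine (abs_integral_le_integral_abs).trans (integral_mono ?_ ?_ pw)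
    · exact ((hasTemperateGrowth_inner_pd hw hw').integrable_smul r).abs
    · exact (integrable_exp_mul (tg.fun_add tg') r).const_mul _
  rw [gav_add tg tg'] at h1
  have e4 : (4 : ℝ) ^ n = 2 ^ n * 2 ^ n := by rw [← mul_pow]; norm_num
  have m1 : r ^ 2 * gav g (2 * r) ≤ 2 ^ n * N := by
    have : 4 * 2 ^ n * gav (bend w) (4 * r) ≤ 4 * 2 ^ n * N := by gcongr
    nlinarith
  have m2 : r ^ 2 * gav g' (2 * r) ≤ 2 ^ n * N := by
    have : 4 * 2 ^ n * gav (bend w') (4 * r) ≤ 4 * 2 ^ n * N := by gcongr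
    nlinarith
  calc _ ≤ r ^ 2 * (1 / 2 * L * (2 ^ n * (gav g (2 * r) + gav g' (2 * r)))) := by gcongr
    _ = 1 / 2 * L * 2 ^ n * (r ^ 2 * gav g (2 * r) + r ^ 2 * gav g' (2 * r)) := by ring
    _ ≤ 1 / 2 * L * 2 ^ n * (2 ^ n * N + 2 ^ n * N) := by gcongr
    _ = _ := by rw [e4]; ring

lemma gav_bend_le (hu : u.HasTemperateGrowth) {c k K r : ℝ} (k0 : 0 < k) (k1 : k ≤ 1)
    (hK : c ^ 2 * gav (fun x => u x ^ 2) r ≤ K) :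
    gav (bend (fun x => c / k ^ 4 * u x)) r ≤ (1 + K) / k ^ 6 := by
  have tc := Function.HasTemperateGrowth.const (E := Eu n) (c / k ^ 4)
  have t1 : (bend (fun x => c / k ^ 4 * u x)).HasTemperateGrowth :=
    hasTemperateGrowth_rpow (tc.fun_mul hu) _
  have t2 : Function.HasTemperateGrowth (fun x => c ^ 2 / k ^ 6 * u x ^ 2) :=
    (Function.HasTemperateGrowth.const (E := Eu n) (c ^ 2 / k ^ 6)).fun_mul hu.sq
  have t3 := Function.HasTemperateGrowth.const (E := Eu n) (1 / k ^ 6)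
  have h1 := gav_mono t1 (t2.fun_add t3) (fun x => ?_) r
  · refine h1.trans ?_
    rw [gav_add t2 t3, gav_const, gav_const_mul]
    have : c ^ 2 / k ^ 6 * gav (fun x => u x ^ 2) r + 1 / k ^ 6 =
      (1 + c ^ 2 * gav (fun x => u x ^ 2) r) / k ^ 6 := by ring
    rw [this]
    gcongr
  · have b0 : 1 ≤ 1 + c ^ 2 * u x ^ 2 := by nlinarith [sq_nonneg (c * u x)]
    have e1 : 1 + (c / k ^ 4 * u x) ^ 2 ≤ (1 + c ^ 2 * u x ^ 2) / k ^ 8 := by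
      rw [le_div_iff₀ (by positivity)]
      have : k ^ 8 ≤ 1 := pow_le_one₀ k0.le k1
      have : (1 + (c / k ^ 4 * u x) ^ 2) * k ^ 8 = k ^ 8 + c ^ 2 * u x ^ 2 := by field_simp
      linarith
    calc bend (fun x => c / k ^ 4 * u x) x ≤ ((1 + c ^ 2 * u x ^ 2) / k ^ 8) ^ (3 / 4 : ℝ) := by
          unfold bend; gcongr
      _ = (1 + c ^ 2 * u x ^ 2) ^ (3 / 4 : ℝ) / k ^ 6 := by
          rw [Real.div_rpow (by positivity) (by positivity), ← Real.rpow_natCast k,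
            ← Real.rpow_mul k0.le, ← Real.rpow_natCast k]
          norm_num
      _ ≤ (1 + c ^ 2 * u x ^ 2) ^ (1 : ℝ) / k ^ 6 := by
          gcongr
          norm_num
      _ = _ := by rw [Real.rpow_one]; ring

lemma Sol.lap_nonneg (h : Sol u v) (x : Eu n) : 0 ≤ Lap u x := by
  rw [h.eu]; exact mul_nonneg (h.pu x).le (sq_nonneg _)

lemma Sol.cross_le (h : Sol u v) {r k K C : ℝ} (hr : 0 < r) (k0 : 0 < k) (k1 : k ≤ 1)
    (hK : 1 ≤ K) (hD : Dbl u v K r)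
    (ho : ∀ z : Eu n, u (r • z) * v (r • z) ≤
      C * k ^ 4 * Real.exp (‖z‖ ^ 2 / 16) * Real.sqrt (ht u r * ht v r)) :
    r ^ 2 * |gav (fun x => ∑ i, pd i u x * pd i v x) r| ≤
      k * ((1 + 2 * 3 ^ n * K + C ^ 2) * 4 ^ n * (1 + K)) * Real.sqrt (ht u r * ht v r) := by
  have p0 := h.ht_pos r
  have q0 := h.symm.ht_pos r
  set a := (Real.sqrt (ht u r))⁻¹ with ha
  set b := (Real.sqrt (ht v r))⁻¹ with hb
  have sp := Real.sqrt_pos.2 p0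
  have sq' := Real.sqrt_pos.2 q0
  have a0 : 0 < a := by positivity
  have b0 : 0 < b := by positivity
  have a2 : a ^ 2 * ht u r = 1 := by
    rw [ha, inv_pow, Real.sq_sqrt p0.le]; field_simp
  have b2 : b ^ 2 * ht v r = 1 := by
    rw [hb, inv_pow, Real.sq_sqrt q0.le]; field_simp
  have st : a * b * Real.sqrt (ht u r * ht v r) = 1 := by
    rw [Real.sqrt_mul p0.le, ha, hb]; field_simp
  have s0 : 0 < Real.sqrt (ht u r * ht v r) := Real.sqrt_pos.2 (by positivity)
  set t := Real.sqrt (ht u r * ht v r)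
  set D := 1 + 2 * 3 ^ n * K + C ^ 2 with hDdef
  have D1 : 1 ≤ D := by
    have : 0 ≤ 2 * 3 ^ n * K := by positivity
    nlinarith [sq_nonneg C]
  have Ka : a ^ 2 * gav (fun x => u x ^ 2) (4 * r) ≤ K := by
    have := mul_le_mul_of_nonneg_left hD.1 (sq_nonneg a)
    unfold ht at this a2
    nlinarith
  have Kb : b ^ 2 * gav (fun x => v x ^ 2) (4 * r) ≤ K := by
    have := mul_le_mul_of_nonneg_left hD.2 (sq_nonneg b)
    unfold ht at this b2
    nlinarith
  have tu := (Function.HasTemperateGrowth.const (E := Eu n) (a / k ^ 4)).fun_mul h.tu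
  have tv := (Function.HasTemperateGrowth.const (E := Eu n) (b / k ^ 4)).fun_mul h.tv
  have key := gav_inner_pd_le (w := fun x => a / k ^ 4 * u x) (w' := fun x => b / k ^ 4 * v x)
    (L := D / k) (N := (1 + K) / k ^ 6) tu (fun x => by have := h.pu x; positivity)
    (fun x => by
      rw [Lap_const_mul h.tu.smooth]; exact mul_nonneg (by positivity) (h.lap_nonneg x)) tv
    (fun x => by have := h.pv x; positivity)
    (fun x => by
      rw [Lap_const_mul h.tv.smooth]; exact mul_nonneg (by positivity) (h.symm.lap_nonneg x))
    hr (by positivity) (fun z => ?_) (gav_bend_le h.tu k0 k1 Ka) (gav_bend_le h.tv k0 k1 Kb)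
  · have e : (fun x => ∑ i, pd i (fun x => a / k ^ 4 * u x) x * pd i (fun x => b / k ^ 4 * v x) x) =
        fun x => a * b / k ^ 8 * ∑ i, pd i u x * pd i v x := by
      ext x
      rw [Finset.mul_sum]
      refine Finset.sum_congr rfl fun i _ => ?_
      rw [pd_const_mul h.tu.smooth.diffble, pd_const_mul h.tv.smooth.diffble]
      field_simp
    rw [e, gav_const_mul, abs_mul, abs_of_pos (by positivity : 0 < a * b / k ^ 8)] at key
    set Z := |gav (fun x => ∑ i, pd i u x * pd i v x) r|
    have : r ^ 2 * Z = r ^ 2 * (a * b / k ^ 8 * Z) * (k ^ 8 * t) := by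
      have : r ^ 2 * (a * b / k ^ 8 * Z) * (k ^ 8 * t) = r ^ 2 * Z * (a * b * t) := by field_simp
      rw [this, st, mul_one]
    rw [this]
    calc _ ≤ D / k * 4 ^ n * ((1 + K) / k ^ 6) * (k ^ 8 * t) := by gcongr
      _ = _ := by field_simp
  · have hu2 := h.sq_le hr z
    have hv2 := h.symm.sq_le hr z
    have mu : ht u (3 * r) ≤ ht u (4 * r) := h.ht_mono (by positivity) (by linarith)
    have mv : ht v (3 * r) ≤ ht v (4 * r) := h.symm.ht_mono (by positivity) (by linarith)
    have hp := mul_pos (h.pu (r • z)) (h.pv (r • z))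
    have hoz := ho z
    have X1 : 1 ≤ Real.exp (‖z‖ ^ 2 / 16) := Real.one_le_exp (by positivity)
    have X2 : Real.exp (‖z‖ ^ 2 / 8) = Real.exp (‖z‖ ^ 2 / 16) ^ 2 := by
      rw [← Real.exp_nat_mul]; congr 1; push_cast; ring
    rw [X2]
    set X := Real.exp (‖z‖ ^ 2 / 16)
    have hu3 : a ^ 2 * u (r • z) ^ 2 ≤ 3 ^ n * K * X := by
      calc _ ≤ a ^ 2 * (3 ^ n * X * ht u (4 * r)) := by
            gcongr; exact hu2.trans (by gcongr)
        _ = 3 ^ n * X * (a ^ 2 * ht u (4 * r)) := by ring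
        _ ≤ 3 ^ n * X * K := by gcongr; exact Ka
        _ = _ := by ring
    have hv3 : b ^ 2 * v (r • z) ^ 2 ≤ 3 ^ n * K * X := by
      calc _ ≤ b ^ 2 * (3 ^ n * X * ht v (4 * r)) := by
            gcongr; exact hv2.trans (by gcongr)
        _ = 3 ^ n * X * (b ^ 2 * ht v (4 * r)) := by ring
        _ ≤ 3 ^ n * X * K := by gcongr; exact Kb
        _ = _ := by ring
    have huv : a * b * (u (r • z) * v (r • z)) ≤ C * k ^ 4 * X := by
      calc _ ≤ a * b * (C * k ^ 4 * X * t) := by gcongr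
        _ = C * k ^ 4 * X * (a * b * t) := by ring
        _ = _ := by rw [st, mul_one]
    have huv2 : (a * b * (u (r • z) * v (r • z))) ^ 2 ≤ (C * k ^ 4 * X) ^ 2 := by gcongr
    generalize u (r • z) = U at *
    generalize v (r • z) = V at *
    have k8 : k ^ 8 ≤ 1 := pow_le_one₀ k0.le k1
    have XX : X ≤ X ^ 2 := by nlinarith
    have e1 : (1 + (a / k ^ 4 * U) ^ 2) * (1 + (b / k ^ 4 * V) ^ 2) =
        (k ^ 8 + (a ^ 2 * U ^ 2 + b ^ 2 * V ^ 2) + (a * b * (U * V)) ^ 2 / k ^ 8) / k ^ 8 := by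
      field_simp; ring
    rw [e1, div_pow, div_mul_eq_mul_div]
    gcongr
    have e2 : (a * b * (U * V)) ^ 2 / k ^ 8 ≤ C ^ 2 * X ^ 2 := by
      rw [div_le_iff₀ (by positivity)]; refine huv2.trans_eq (by ring)
    have DD : D ≤ D ^ 8 := le_self_pow₀ D1 (by norm_num)
    calc _ ≤ 1 * X ^ 2 + (3 ^ n * K * X ^ 2 + 3 ^ n * K * X ^ 2) + C ^ 2 * X ^ 2 := by
          have hK' := mul_le_mul_of_nonneg_left XX (by positivity : 0 ≤ 3 ^ n * K)
          linarith
      _ = D * X ^ 2 := by rw [hDdef]; ring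
      _ ≤ _ := by gcongr

end cross

section spectral

variable {n : ℕ} {F G u v : Eu n → ℝ}

lemma reflected_difference_sq_le {a b a' b' : ℝ} (ha : 0 ≤ a) (hb : 0 ≤ b) (ha' : 0 ≤ a')
    (hb' : 0 ≤ b') :
    (a - b') ^ 2 ≤ 8 * ((a - b + (a' - b')) / 2) ^ 2 + 2 * (a * b) + 2 * (a' * b') := by
  have h1 := mul_nonneg ha hb
  have h2 := mul_nonneg ha' hb'
  have key : ∀ {a b a' b' : ℝ}, 0 ≤ a → 0 ≤ b → 0 ≤ a' → 0 ≤ b' → b' ≤ a →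
      (a - b') ^ 2 ≤ 8 * ((a - b + (a' - b')) / 2) ^ 2 + 2 * (a * b) := by
    intro a b a' b' ha hb ha' hb' h
    rcases le_total b a with hab | hab
    · rcases le_total (a - b') b with h3 | h3
      · nlinarith [sq_nonneg ((a - b + (a' - b')) / 2), mul_nonneg ha hb,
          mul_nonneg hb (sub_nonneg.2 hab), mul_nonneg (sub_nonneg.2 h) (sub_nonneg.2 h3)]
      · have : (a - b' - b) ^ 2 ≤ (a - b + (a' - b')) ^ 2 := by
          apply pow_le_pow_left₀ <;> linarith
        nlinarith [sq_nonneg (a - b' - 2 * b), mul_nonneg hb (sub_nonneg.2 hab)]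
    · have : (a - b') ^ 2 ≤ a ^ 2 := by apply pow_le_pow_left₀ <;> linarith
      nlinarith [sq_nonneg ((a - b + (a' - b')) / 2), mul_nonneg ha (sub_nonneg.2 hab)]
  rcases le_total b' a with h | h
  · linarith [key ha hb ha' hb' h]
  · have := key (a := b') (b := a') (a' := b) (b' := a) hb' ha' hb ha h
    nlinarith

lemma gav_neg_arg (F : Eu n → ℝ) (r : ℝ) : gav (fun x => F (-x)) r = gav F r := by
  unfold gav
  rw [← integral_gam_neg (fun z => F (r • z))]
  simp only [smul_neg]

lemma Sol.spectral (h : Sol u v) {r ε : ℝ} (hr : 0 < r)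
    (ho : gav (fun x => u x * v x) r ≤ ε * Real.sqrt (ht u r * ht v r))
    (hc : r ^ 2 * |gav (fun x => ∑ i, pd i u x * pd i v x) r| ≤
      ε * Real.sqrt (ht u r * ht v r)) :
    ∃ a b, 0 < a ∧ 0 < b ∧ (a - b) ^ 2 / 8 - 5 * ε * (a * b) ≤
      (lam u v r - 1) * a ^ 2 + (lam v u r - 1) * b ^ 2 := by
  have p0 := h.ht_pos r
  have q0 := h.symm.ht_pos r
  have m1 : 0 < gav u r := gav_pos h.tu h.pu r
  have m2 : 0 < gav v r := gav_pos h.tv h.pv r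
  have e1 : en u v r = lam u v r * ht u r := by unfold lam; field_simp
  have e2 : en v u r = lam v u r * ht v r := by unfold lam; field_simp
  have hS : 0 ≤ r ^ 2 * ov u v r := mul_nonneg (sq_nonneg r) (ov_nonneg u v r)
  have en1 : r ^ 2 * gav (gsq u) r ≤ lam u v r * ht u r := by
    rw [← e1]; unfold en; linarith
  have en2 : r ^ 2 * gav (gsq v) r ≤ lam v u r * ht v r := by
    rw [← e2]; unfold en; rw [ov_comm v u]; linarith
  set s := (gav u r)⁻¹ with hs
  set s' := (gav v r)⁻¹ with hs'
  have s0 : 0 < s := by positivity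
  have s0' : 0 < s' := by positivity
  have sp0 := Real.sqrt_pos.2 p0
  have sq0 := Real.sqrt_pos.2 q0
  have sp2 : Real.sqrt (ht u r) ^ 2 = ht u r := Real.sq_sqrt p0.le
  have sq2 : Real.sqrt (ht v r) ^ 2 = ht v r := Real.sq_sqrt q0.le
  rw [Real.sqrt_mul p0.le] at ho hc
  refine ⟨s * Real.sqrt (ht u r), s' * Real.sqrt (ht v r), by positivity, by positivity, ?_⟩
  have tcu := (Function.HasTemperateGrowth.const (E := Eu n) s).fun_mul h.tu
  have tcv := (Function.HasTemperateGrowth.const (E := Eu n) s').fun_mul h.tv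
  set F : Eu n → ℝ := fun x => s * u x - s' * v x with hF
  have tF : F.HasTemperateGrowth := tcu.fun_sub tcv
  have F0 : gav F r = 0 := by
    rw [hF, gav_sub tcu tcv, gav_const_mul, gav_const_mul, hs, hs']
    field_simp; ring
  have P := poincare_even tF F0
  have tuv := h.tu.fun_mul h.tv
  have quad : ∀ {f g k : Eu n → ℝ}, f.HasTemperateGrowth → g.HasTemperateGrowth →
      k.HasTemperateGrowth →
      gav (fun x => s ^ 2 * f x + s' ^ 2 * g x - 2 * s * s' * k x) r =
        s ^ 2 * gav f r + s' ^ 2 * gav g r - 2 * s * s' * gav k r := by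
    intro f g k hf hg hk
    have tc := fun c : ℝ => Function.HasTemperateGrowth.const (E := Eu n) c
    rw [gav_sub (((tc _).fun_mul hf).fun_add ((tc _).fun_mul hg)) ((tc _).fun_mul hk),
      gav_add ((tc _).fun_mul hf) ((tc _).fun_mul hg), gav_const_mul, gav_const_mul, gav_const_mul]
  have g1 : gav (fun x => F x ^ 2) r =
      s ^ 2 * ht u r + s' ^ 2 * ht v r - 2 * s * s' * gav (fun x => u x * v x) r := by
    unfold ht
    rw [← quad h.tu.sq h.tv.sq tuv]
    congr 1; ext x; rw [hF]; ring
  have g2 : gav (gsq F) r = s ^ 2 * gav (gsq u) r + s' ^ 2 * gav (gsq v) r -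
      2 * s * s' * gav (fun x => ∑ i, pd i u x * pd i v x) r := by
    rw [← quad h.tu.gsq h.tv.gsq (hasTemperateGrowth_inner_pd h.tu h.tv)]
    congr 1; ext x
    unfold gsq
    rw [Finset.mul_sum, Finset.mul_sum, Finset.mul_sum, ← Finset.sum_add_distrib,
      ← Finset.sum_sub_distrib]
    refine Finset.sum_congr rfl fun i _ => ?_
    rw [hF, pd_sub tcu.smooth.diffble tcv.smooth.diffble, pd_const_mul h.tu.smooth.diffble,
      pd_const_mul h.tv.smooth.diffble]
    ring
  have tv' := h.tv.neg_arg
  have tu' := h.tu.neg_arg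
  have g3 : gav (fun x => (s * u x - s' * v (-x)) ^ 2) r =
      s ^ 2 * ht u r + s' ^ 2 * ht v r - 2 * s * s' * gav (fun x => u x * v (-x)) r := by
    have : ht v r = gav (fun x => v (-x) ^ 2) r := (gav_neg_arg (fun x => v x ^ 2) r).symm
    rw [this, ht, ← quad h.tu.sq tv'.sq (h.tu.fun_mul tv')]
    congr 1; ext x; ring
  have g4 : gav (fun x => u x * v (-x)) r ≤ Real.sqrt (ht u r) * Real.sqrt (ht v r) := by
    have := gav_mul_sq_le h.tu tv' r
    rw [gav_neg_arg (fun x => v x ^ 2) r] at this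
    change _ ≤ ht u r * ht v r at this
    refine (abs_le_of_sq_le_sq' ?_ (by positivity)).2
    rw [mul_pow, sp2, sq2]; exact this
  have g5 : gav (fun x => (s * u x - s' * v (-x)) ^ 2) r ≤
      8 * gav (fun x => ((F x + F (-x)) / 2) ^ 2) r +
        4 * (s * s') * gav (fun x => u x * v x) r := by
    have tc := fun c : ℝ => Function.HasTemperateGrowth.const (E := Eu n) c
    have te : Function.HasTemperateGrowth (fun x => ((F x + F (-x)) / 2) ^ 2) := by
      have := ((tF.fun_add tF.neg_arg).fun_mul (tc (2⁻¹))).sq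
      simpa only [div_eq_mul_inv] using this
    have tn : Function.HasTemperateGrowth (fun x => u (-x) * v (-x)) := tu'.fun_mul tv'
    have tl : Function.HasTemperateGrowth (fun x => (s * u x - s' * v (-x)) ^ 2) :=
      (tcu.fun_sub ((tc s').fun_mul tv')).sq
    have ta := (tc 8).fun_mul te
    have tb := (tc (2 * (s * s'))).fun_mul tuv
    have tb' := (tc (2 * (s * s'))).fun_mul tn
    have := gav_mono tl ((ta.fun_add tb).fun_add tb') (fun x => ?_) r
    · refine this.trans_eq ?_
      rw [gav_add (ta.fun_add tb) tb', gav_add ta tb, gav_const_mul, gav_const_mul, gav_const_mul,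
        gav_neg_arg (fun x => u x * v x)]
      ring
    · have b1 := h.pu x
      have b2 := h.pv x
      have b3 := h.pu (-x)
      have b4 := h.pv (-x)
      have := reflected_difference_sq_le (a := s * u x) (b := s' * v x) (a' := s * u (-x))
        (b' := s' * v (-x)) (by positivity) (by positivity) (by positivity) (by positivity)
      refine this.trans_eq ?_
      rw [hF]; ring
  rw [g1, g2] at P
  rw [g3] at g5
  have hcc : -(ε * (Real.sqrt (ht u r) * Real.sqrt (ht v r))) ≤
      r ^ 2 * gav (fun x => ∑ i, pd i u x * pd i v x) r := by
    have := neg_abs_le (gav (fun x => ∑ i, pd i u x * pd i v x) r)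
    nlinarith [sq_nonneg r]
  have ss := mul_pos s0 s0'
  generalize gav (fun x => ∑ i, pd i u x * pd i v x) r = I at *
  generalize gav (fun x => u x * v x) r = J at *
  generalize gav (fun x => ((F x + F (-x)) / 2) ^ 2) r = E at *
  generalize gav (fun x => u x * v (-x)) r = L at *
  generalize gav (gsq u) r = A at *
  generalize gav (gsq v) r = B at *
  rw [mul_pow, mul_pow, sp2, sq2]
  have sub : (s * Real.sqrt (ht u r) - s' * Real.sqrt (ht v r)) ^ 2 =
      s ^ 2 * ht u r + s' ^ 2 * ht v r - 2 * (s * s') *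
        (Real.sqrt (ht u r) * Real.sqrt (ht v r)) := by
    rw [sub_sq, mul_pow, mul_pow, sp2, sq2]; ring
  rw [sub]
  set T := Real.sqrt (ht u r) * Real.sqrt (ht v r)
  have T0 : 0 < T := by positivity
  have k1 := mul_le_mul_of_nonneg_left en1 (sq_nonneg s)
  have k2 := mul_le_mul_of_nonneg_left en2 (sq_nonneg s')
  have k3 := mul_le_mul_of_nonneg_left ho ss.le
  have k4 := mul_le_mul_of_nonneg_left hcc ss.le
  have k5 := mul_le_mul_of_nonneg_left g4 ss.le
  have e5 : s * Real.sqrt (ht u r) * (s' * Real.sqrt (ht v r)) = s * s' * T := by ring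
  rw [e5]
  have eps : 0 ≤ ε * (s * s' * T) := by
    have : 0 ≤ ε * T := le_trans (by positivity) hc
    have := mul_nonneg ss.le this
    linarith
  linarith

end spectral

section algebra

set_option maxHeartbeats 1000000 in
/-- Lower bound for the logarithmic growth of the product of two heights: the half `1 / 2 ≤ θ`. -/
lemma growth_lower_bound_aux {x y θ s δ a b : ℝ} (hx : -1 ≤ x) (hy : -1 ≤ y) (h1 : 1 / 2 ≤ θ)
    (h2 : θ ≤ 1) (hs : 0 ≤ s) (hδ : 0 ≤ δ) (hδ' : δ ≤ 1 / 2) (ha : 0 < a) (hb : 0 < b)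
    (hq : (a - b) ^ 2 / 8 - δ * (a * b) ≤ x * a ^ 2 + y * b ^ 2)
    (hc : x * θ + y * (1 - θ) ≤ s) :
    -(4096 * (θ * (1 - θ) * (x - y) ^ 2 + s + δ)) ≤ x * (1 - θ) + y * θ := by
  have hp : 0 ≤ θ * (1 - θ) := mul_nonneg (by linarith) (by linarith)
  have hpp : 0 ≤ θ * (1 - θ) * (x - y) ^ 2 := mul_nonneg hp (sq_nonneg _)
  have low : -1 ≤ x * (1 - θ) + y * θ := by nlinarith
  rcases le_or_gt (1 / 8) y with y8 | y8
  · rcases le_or_gt 0 x with x0 | x0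
    · have : 0 ≤ x * (1 - θ) + y * θ := by
        have := mul_nonneg x0 (sub_nonneg.2 h2)
        nlinarith
      linarith
    · rcases le_or_gt (8 / 9) θ with t | t
      · have : 0 ≤ x * (1 - θ) + y * θ := by nlinarith
        linarith
      · have c1 : 1 / 18 ≤ θ * (1 - θ) := by nlinarith
        have c2 : 1 / 64 ≤ (x - y) ^ 2 := by nlinarith
        have : 1 / 18 * (1 / 64) ≤ θ * (1 - θ) * (x - y) ^ 2 := by gcongr
        linarith
  rcases le_or_gt (1 / 8) x with x8 | x8
  · rcases le_or_gt 0 y with y0 | y0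
    · have : 0 ≤ x * (1 - θ) + y * θ := by
        have := mul_nonneg (by linarith : 0 ≤ x) (sub_nonneg.2 h2)
        have := mul_nonneg y0 (by linarith : 0 ≤ θ)
        linarith
      linarith
    · rcases le_or_gt (1 / 32) s with t | t
      · linarith
      · have c0 : 1 / 32 ≤ 1 - θ := by nlinarith
        have c1 : 1 / 64 ≤ θ * (1 - θ) := by nlinarith
        have c2 : 1 / 64 ≤ (x - y) ^ 2 := by nlinarith
        have : 1 / 64 * (1 / 64) ≤ θ * (1 - θ) * (x - y) ^ 2 := by gcongr
        linarith
  have I : 8 * (x * y) - 2 * δ ≤ x + y := by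
    have k1 : (1 / 8 - x) * a ^ 2 + (1 / 8 - y) * b ^ 2 ≤ (1 / 4 + δ) * (a * b) := by linarith
    have k2 : (1 / 8 - x) * (1 / 8 - y) ≤ (1 / 8 + δ / 2) ^ 2 := by
      have A0 : 0 < 1 / 8 - x := by linarith
      have B0 : 0 < 1 / 8 - y := by linarith
      have k3 : 4 * ((1 / 8 - x) * (1 / 8 - y)) * (a * b) ^ 2 ≤ ((1 / 4 + δ) * (a * b)) ^ 2 := by
        have : ((1 / 8 - x) * a ^ 2 + (1 / 8 - y) * b ^ 2) ^ 2 ≤ ((1 / 4 + δ) * (a * b)) ^ 2 := by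
          gcongr
        nlinarith [sq_nonneg ((1 / 8 - x) * a ^ 2 - (1 / 8 - y) * b ^ 2)]
      rw [mul_pow (1 / 4 + δ)] at k3
      have := le_of_mul_le_mul_right k3 (by positivity)
      linarith
    nlinarith
  have G : x * (1 - θ) + y * θ = (x + y) - (x * θ + y * (1 - θ)) := by ring
  rcases le_or_gt 0 (x * y) with xy | xy
  · linarith
  rcases le_or_gt θ (15 / 16) with t | t
  · have c1 : 1 / 32 ≤ θ * (1 - θ) := by nlinarith
    have c2 : -(2 * (x - y) ^ 2) ≤ 8 * (x * y) := by nlinarith [sq_nonneg (x + y)]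
    have c3 : 1 / 32 * (x - y) ^ 2 ≤ θ * (1 - θ) * (x - y) ^ 2 := by gcongr
    linarith
  · rcases lt_or_ge x 0 with x0 | x0
    · have y0 : 0 < y := by
        by_contra hh
        linarith [mul_nonneg_of_nonpos_of_nonpos x0.le (not_lt.1 hh)]
      have c1 : y * (15 / 16) ≤ y * θ := by gcongr
      have c2 : x * (1 / 16) ≤ x * (1 - θ) := mul_le_mul_of_nonpos_left (by linarith) x0.le
      have d2 : -x ≤ 9 * y + 2 * δ := by linarith [mul_nonneg y0.le (by linarith : 0 ≤ 1 + x)]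
      linarith
    · have y0 : y < 0 := by
        by_contra hh
        linarith [mul_nonneg x0 (not_lt.1 hh)]
      have c1 : x * (15 / 16) ≤ x * θ := by gcongr
      have c2 : y * (1 / 16) ≤ y * (1 - θ) :=
        mul_le_mul_of_nonpos_left (by linarith) y0.le
      have d2 : -y ≤ 9 * x + 2 * δ := by linarith [mul_nonneg x0 (by linarith : 0 ≤ 1 + y)]
      have c3 : 0 ≤ x * (1 - θ) := mul_nonneg x0 (by linarith)
      have c4 : y * 1 ≤ y * θ := mul_le_mul_of_nonpos_left h2 y0.le
      linarith

lemma growth_lower_bound {x y θ s δ a b : ℝ} (hx : -1 ≤ x) (hy : -1 ≤ y) (h1 : 0 ≤ θ)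
    (h2 : θ ≤ 1) (hs : 0 ≤ s) (hδ : 0 ≤ δ) (hδ' : δ ≤ 1 / 2) (ha : 0 < a) (hb : 0 < b)
    (hq : (a - b) ^ 2 / 8 - δ * (a * b) ≤ x * a ^ 2 + y * b ^ 2)
    (hc : x * θ + y * (1 - θ) ≤ s) :
    -(4096 * (θ * (1 - θ) * (x - y) ^ 2 + s + δ)) ≤ x * (1 - θ) + y * θ := by
  rcases le_total (1 / 2) θ with t | t
  · exact growth_lower_bound_aux hx hy t h2 hs hδ hδ' ha hb hq hc
  · have := growth_lower_bound_aux (x := y) (y := x) (θ := 1 - θ) (s := s) (δ := δ) (a := b)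
      (b := a) hy hx (by linarith) (by linarith) hs hδ hδ' hb ha (by linarith) (by linarith)
    linarith

/-- A function bounded above that increases wherever it is nearly maximal is bounded below. -/
lemma bounded_below_of_deriv_pos {Y Y' : ℝ → ℝ} {T M : ℝ} (hT : 0 < T)
    (hd : ∀ r, T ≤ r → HasDerivAt Y (Y' r) r) (hM : ∀ r, T ≤ r → Y r ≤ M)
    (hpos : ∀ r, T ≤ r → Y (4 * r) ≤ Y r + 2 → 0 < Y' r) :
    ∃ t m, T ≤ t ∧ ∀ r, t ≤ r → m ≤ Y r := by
  have hb : BddAbove (Y '' Set.Ici T) := ⟨M, by rintro _ ⟨r, hr, rfl⟩; exact hM r hr⟩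
  have hne : (Y '' Set.Ici T).Nonempty := ⟨Y T, T, Set.self_mem_Ici, rfl⟩
  obtain ⟨_, ⟨t, ht, rfl⟩, hlt⟩ := exists_lt_of_lt_csSup hne (sub_one_lt (sSup (Y '' Set.Ici T)))
  have ht' : T ≤ t := ht
  refine ⟨t, Y t, ht', fun r hr => ?_⟩
  have key := image_le_of_deriv_right_lt_deriv_boundary (f := fun s => -Y s) (f' := fun s => -Y' s)
    (B := fun _ => -Y t) (B' := fun _ => 0) (a := t) (b := r)
    (fun s hs => (hd s (ht'.trans hs.1)).continuousAt.neg.continuousWithinAt)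
    (fun s hs => (hd s (ht'.trans hs.1)).neg.hasDerivWithinAt) le_rfl
    (fun s => hasDerivAt_const _ _) (fun s hs he => ?_) (Set.right_mem_Icc.2 hr)
  · simpa using key
  · have hs' : T ≤ s := ht'.trans hs.1
    have e : Y s = Y t := by simpa using he
    have := le_csSup hb ⟨4 * s, by change T ≤ 4 * s; linarith, rfl⟩
    have := hpos s hs' (by linarith)
    linarith

end algebra

section nondegenerate

variable {n : ℕ} {F G u v : Eu n → ℝ}

lemma Sol.gav_mul_le (h : Sol u v) {r c : ℝ} (hc : 0 ≤ c)
    (ho : ∀ z : Eu n, u (r • z) * v (r • z) ≤ c * Real.exp (‖z‖ ^ 2 / 16)) :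
    gav (fun x => u x * v x) r ≤ c * 2 ^ n := by
  have t1 := Function.HasTemperateGrowth.const (E := Eu n) (1 : ℝ)
  have e := integral_exp_mul (fun _ : Eu n => (1 : ℝ)) r
  rw [gav_const, mul_one] at e
  rw [← e, ← integral_const_mul]
  refine integral_mono ((h.tu.fun_mul h.tv).integrable_smul r)
    ((integrable_exp_mul t1 r).const_mul _) fun z => (ho z).trans ?_
  simp only [mul_one]
  gcongr
  nlinarith [sq_nonneg ‖z‖]

lemma Sol.exists_spectral (h : Sol u v) (K : ℝ) (hK : 1 ≤ K) :
    ∃ C, 0 < C ∧ ∃ R, 1 ≤ R ∧ ∀ r, R ≤ r → Dbl u v K r → ∃ a b, 0 < a ∧ 0 < b ∧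
      (a - b) ^ 2 / 8 - C * r ^ (-(1 / 128) : ℝ) * (a * b) ≤
        (lam u v r - 1) * a ^ 2 + (lam v u r - 1) * b ^ 2 := by
  obtain ⟨C, hC, R, hR, hb⟩ := h.exists_overlap_bound K hK
  set C' := (1 + 2 * 3 ^ n * K + C ^ 2) * 4 ^ n * (1 + K) + C * 2 ^ n with hC'
  have C0 : 0 < C' := by positivity
  refine ⟨5 * C', by positivity, R, hR, fun r hr hD => ?_⟩
  have r1 : 1 ≤ r := hR.trans hr
  have r0 : 0 < r := by linarith
  set k := r ^ (-(1 / 128) : ℝ) with hk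
  have k0 : 0 < k := by positivity
  have k1 : k ≤ 1 := Real.rpow_le_one_of_one_le_of_nonpos r1 (by norm_num)
  have k4 : r ^ (-(1 / 32) : ℝ) = k ^ 4 := by
    rw [hk, ← Real.rpow_natCast, ← Real.rpow_mul r0.le]; norm_num
  have ho := hb r hr hD
  rw [k4] at ho
  have s0 : 0 < Real.sqrt (ht u r * ht v r) :=
    Real.sqrt_pos.2 (mul_pos (h.ht_pos r) (h.symm.ht_pos r))
  have hc := h.cross_le r0 k0 k1 hK hD ho
  have hg := h.gav_mul_le (r := r) (c := C * k ^ 4 * Real.sqrt (ht u r * ht v r)) (by positivity)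
    (fun z => (ho z).trans_eq (by ring))
  set t := Real.sqrt (ht u r * ht v r)
  have hk4 : k ^ 4 ≤ k := pow_le_of_le_one k0.le k1 (by norm_num)
  have hA : C * k ^ 4 * t * 2 ^ n ≤ C' * k * t := by
    calc _ ≤ C * k * t * 2 ^ n := by gcongr
      _ = C * 2 ^ n * (k * t) := by ring
      _ ≤ C' * (k * t) := by
          gcongr; rw [hC']
          have : 0 ≤ (1 + 2 * 3 ^ n * K + C ^ 2) * 4 ^ n * (1 + K) := by positivity
          linarith
      _ = _ := by ring
  have hB : ((1 + 2 * 3 ^ n * K + C ^ 2) * 4 ^ n * (1 + K)) * k * t ≤ C' * k * t := by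
    calc _ = (1 + 2 * 3 ^ n * K + C ^ 2) * 4 ^ n * (1 + K) * (k * t) := by ring
      _ ≤ C' * (k * t) := by
          gcongr; rw [hC']
          have : 0 ≤ C * 2 ^ n := by positivity
          linarith
      _ = _ := by ring
  obtain ⟨a, b, ha, hb', hab⟩ := h.spectral (ε := C' * k) r0
    (hg.trans (le_of_eq_of_le (by ring) hA))
    (hc.trans (le_of_eq_of_le (by ring) hB))
  exact ⟨a, b, ha, hb', by simpa only [mul_assoc] using hab⟩

lemma Sol.prop_mul_lam (h : Sol u v) (r : ℝ) :
    prop u v r * lam u v r + (1 - prop u v r) * lam v u r = fr u v r + nov u v r := by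
  have a1 := h.ht_pos r
  have a2 := h.symm.ht_pos r
  have a3 := h.htt_pos r
  have e : 1 - prop u v r = ht v r / htt u v r := by
    unfold prop; field_simp; unfold htt; ring
  rw [e]
  unfold fr nov lam prop
  have := en_add_en u v r
  field_simp
  linarith

/-- Logarithm of the normalised product of heights. -/
def lgp (u v : Eu n → ℝ) (r : ℝ) : ℝ :=
  Real.log (ht u r) + Real.log (ht v r) - Real.log (htt u v r) - 2 * Real.log r

lemma Sol.hasDerivAt_lgp (h : Sol u v) {r : ℝ} (hr : 0 < r) :
    HasDerivAt (lgp u v)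
      (2 / r * ((lam u v r - 1) * (1 - prop u v r) + (lam v u r - 1) * prop u v r)) r := by
  have a1 := h.ht_pos r
  have a2 := h.symm.ht_pos r
  have a3 := h.htt_pos r
  have d := ((((h.hasDerivAt_ht hr).log a1.ne').add ((h.symm.hasDerivAt_ht hr).log a2.ne')).sub
    ((h.hasDerivAt_htt hr).log a3.ne')).sub ((Real.hasDerivAt_log hr.ne').const_mul 2)
  refine d.congr_deriv ?_
  have hp := h.prop_mul_lam r
  have e1 : 2 * en u v r / r / ht u r = 2 / r * lam u v r := by unfold lam; field_simp
  have e2 : 2 * en v u r / r / ht v r = 2 / r * lam v u r := by unfold lam; field_simp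
  have e3 : 2 * (ten u v r + r ^ 2 * ov u v r) / r / htt u v r =
      2 / r * (fr u v r + nov u v r) := by unfold fr nov; field_simp
  rw [e1, e2, e3, ← hp]
  ring

lemma Sol.nov_le_fr (h : Sol u v) (r : ℝ) : nov u v r ≤ fr u v r := by
  have := h.htt_pos r
  unfold nov fr
  gcongr
  exact sq_mul_ov_le_ten u v r

lemma Sol.htt_doubling (h : Sol u v) {C₀ : ℝ} (hg : ∀ x, u x + v x ≤ C₀ * (1 + ‖x‖)) {r : ℝ}
    (hr : 0 < r) : Real.log (htt u v (4 * r)) ≤ Real.log (htt u v r) + 4 * Real.log 4 := by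
  have hm : MonotoneOn (fun s => 4 * Real.log s - Real.log (htt u v s)) (Set.Ici r) := by
    refine monotoneOn_Ici_of_hasDerivAt (f' := fun s =>
      4 * s⁻¹ - 2 * (ten u v s + s ^ 2 * ov u v s) / s / htt u v s) ?_ ?_
    · intro s hs
      have s0 := hr.trans_le hs
      exact ((Real.hasDerivAt_log s0.ne').const_mul 4).sub
        ((h.hasDerivAt_htt s0).log (h.htt_pos s).ne')
    · intro s hs
      have s0 := hr.trans_le hs
      have p := h.htt_pos s
      have e3 : 2 * (ten u v s + s ^ 2 * ov u v s) / s / htt u v s =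
        2 * (fr u v s + nov u v s) * s⁻¹ := by unfold fr nov; field_simp
      rw [e3, ← sub_mul]
      have := h.fr_le_one hg s0
      have := h.nov_le_fr s
      have : 0 < s⁻¹ := inv_pos.2 s0
      exact mul_nonneg (by linarith) this.le
  have := hm (Set.mem_Ici.2 le_rfl) (Set.mem_Ici.2 (by linarith : r ≤ 4 * r)) (by linarith)
  simp only at this
  rw [Real.log_mul (x := 4) (by norm_num) hr.ne'] at this
  linarith

/-- The monotone quantity controlling the product of the heights. -/
def ypt (u v : Eu n → ℝ) (c r : ℝ) : ℝ :=
  lgp u v r + 4096 * fr u v r - c * r ^ (-(1 / 128) : ℝ)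

lemma Sol.dbl_of_ypt (h : Sol u v) {C₀ : ℝ} (hg : ∀ x, u x + v x ≤ C₀ * (1 + ‖x‖)) {c r : ℝ}
    (hc : 0 ≤ c) (hr : 0 < r) (hY : ypt u v c (4 * r) ≤ ypt u v c r + 2) :
    Dbl u v (Real.exp (2 + 6 * Real.log 4)) r := by
  have f1 := h.fr_mono hr (by linarith : r ≤ 4 * r)
  have f2 : (4 * r) ^ (-(1 / 128) : ℝ) ≤ r ^ (-(1 / 128) : ℝ) :=
    Real.rpow_le_rpow_of_nonpos hr (by linarith) (by norm_num)
  have f3 := mul_le_mul_of_nonneg_left f2 hc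
  have f4 := h.htt_doubling hg hr
  unfold ypt lgp at hY
  rw [Real.log_mul (x := 4) (by norm_num) hr.ne'] at hY
  have a1 := h.ht_pos r
  have a2 := h.symm.ht_pos r
  have a1' := h.ht_pos (4 * r)
  have a2' := h.symm.ht_pos (4 * r)
  have g1 := Real.log_le_log a1 (h.ht_mono hr (by linarith : r ≤ 4 * r))
  have g2 := Real.log_le_log a2 (h.symm.ht_mono hr (by linarith : r ≤ 4 * r))
  constructor
  · rw [← Real.log_le_log_iff a1' (by positivity), Real.log_mul (Real.exp_ne_zero _) a1.ne',
      Real.log_exp]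
    linarith
  · rw [← Real.log_le_log_iff a2' (by positivity), Real.log_mul (Real.exp_ne_zero _) a2.ne',
      Real.log_exp]
    linarith

lemma Sol.exists_ht_ge (h : Sol u v) {C₀ : ℝ} (hg : ∀ x, u x + v x ≤ C₀ * (1 + ‖x‖)) :
    ∃ c, 0 < c ∧ ∃ T, 1 ≤ T ∧ ∀ r, T ≤ r → c * r ^ 2 ≤ ht u r := by
  set K := Real.exp (2 + 6 * Real.log 4) with hKd
  have hK : 1 ≤ K :=
    Real.one_le_exp (by have := Real.log_nonneg (by norm_num : (1 : ℝ) ≤ 4); linarith)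
  obtain ⟨C, hC, R, hR, hsp⟩ := h.exists_spectral K hK
  obtain ⟨M, hM, hMr⟩ := h.htt_le hg
  set c := 128 * (8193 * C) with hc
  have c0 : 0 < c := by positivity
  have hlim : Filter.Tendsto (fun r : ℝ => r ^ (-(1 / 128) : ℝ)) Filter.atTop (nhds 0) :=
    tendsto_rpow_neg_atTop (by norm_num)
  have hev := hlim.eventually (gt_mem_nhds (by positivity : 0 < 1 / (2 * C)))
  obtain ⟨T₀, hT₀⟩ := Filter.eventually_atTop.1 hev
  set T := max R T₀ with hT
  have T1 : 1 ≤ T := hR.trans (le_max_left _ _)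
  have hle : ∀ r, 1 ≤ r → lgp u v r ≤ Real.log (ht u r) - 2 * Real.log r ∧
      lgp u v r ≤ Real.log (4 * M) := by
    intro r r1
    have r0 : 0 < r := by linarith
    have a1 := h.ht_pos r
    have a2 := h.symm.ht_pos r
    have k1 : Real.log (ht v r) ≤ Real.log (htt u v r) :=
      Real.log_le_log a2 (by unfold htt; linarith)
    have k2 : Real.log (ht u r) ≤ Real.log (4 * M * r ^ 2) := by
      refine Real.log_le_log a1 ?_
      have e := hMr r r0
      have : (1 + r) ^ 2 ≤ 4 * r ^ 2 := by nlinarith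
      have : M * (1 + r) ^ 2 ≤ M * (4 * r ^ 2) := by gcongr
      unfold htt at e; linarith
    rw [Real.log_mul (by positivity) (by positivity), Real.log_pow] at k2
    push_cast at k2
    unfold lgp
    constructor <;> linarith
  obtain ⟨t, m, ht', hm⟩ : ∃ t m, T ≤ t ∧ ∀ r, t ≤ r → m ≤ ypt u v c r := by
    refine bounded_below_of_deriv_pos (Y := ypt u v c)
      (Y' := fun r => 2 / r * ((lam u v r - 1) * (1 - prop u v r) + (lam v u r - 1) * prop u v r) +
        4096 * frDer u v r - c * (-(1 / 128) * r ^ (-(1 / 128) - 1 : ℝ)))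
      (T := T) (M := Real.log (4 * M) + 4096) (by linarith) ?_ ?_ ?_
    · intro r hr
      have r0 : 0 < r := by linarith
      exact ((h.hasDerivAt_lgp r0).add ((h.hasDerivAt_fr r0).const_mul _)).sub
        ((Real.hasDerivAt_rpow_const (Or.inl r0.ne')).const_mul c)
    · intro r hr
      have r0 : 0 < r := by linarith
      have := h.fr_le_one hg r0
      have := (hle r (by linarith)).2
      have : 0 ≤ c * r ^ (-(1 / 128) : ℝ) := by positivity
      unfold ypt; linarith
    · intro r hr hY
      have r0 : 0 < r := by linarith
      have hD := h.dbl_of_ypt hg c0.le r0 hY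
      obtain ⟨a, b, ha, hb, hab⟩ := hsp r ((le_max_left _ _).trans hr) hD
      have hT' := hT₀ r ((le_max_right _ _).trans hr)
      have e0 : r ^ (-(1 / 128) - 1 : ℝ) = r ^ (-(1 / 128) : ℝ) / r := by
        rw [Real.rpow_sub_one r0.ne']
      have q0 : 0 < r ^ (-(1 / 128) : ℝ) := by positivity
      simp only [e0]
      set q := r ^ (-(1 / 128) : ℝ)
      have hδ : C * q ≤ 1 / 2 := by
        rw [lt_div_iff₀ (by positivity)] at hT'; linarith
      have l1 := h.lam_nonneg r
      have l2 := h.symm.lam_nonneg r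
      obtain ⟨p1, p2⟩ := h.prop_mem r
      have fr1 := h.fr_le_one hg r0
      have hp := h.prop_mul_lam r
      have key := growth_lower_bound (x := lam u v r - 1) (y := lam v u r - 1) (θ := prop u v r)
        (s := nov u v r) (δ := C * q) (by linarith) (by linarith) p1.le p2.le (h.nov_nonneg r)
        (by positivity) hδ ha hb hab (by linarith)
      have hd := h.frDer_ge r0
      have e1 : (lam u v r - 1 - (lam v u r - 1)) ^ 2 = (lam u v r - lam v u r) ^ 2 := by ring
      rw [e1] at key
      have k1 := mul_le_mul_of_nonneg_left key (by positivity : 0 ≤ 2 / r)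
      have k2 : 0 < C * q / r := by positivity
      have e2 : c * (-(1 / 128) * (q / r)) = -(8193 * (C * q / r)) := by rw [hc]; ring
      have e3 : 2 / r * -(4096 * (prop u v r * (1 - prop u v r) * (lam u v r - lam v u r) ^ 2 +
          nov u v r + C * q)) = -(4096 * (2 / r * (prop u v r * (1 - prop u v r) *
          (lam u v r - lam v u r) ^ 2 + nov u v r))) - 8192 * (C * q / r) := by ring
      rw [e2]
      rw [e3] at k1
      linarith
  refine ⟨Real.exp (m - 4096), Real.exp_pos _, t, T1.trans ht', fun r hr => ?_⟩
  have r1 : 1 ≤ r := T1.trans (ht'.trans hr)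
  have r0 : 0 < r := by linarith
  have k1 := hm r hr
  have k2 := (hle r r1).1
  have k3 := h.fr_le_one hg r0
  unfold ypt at k1
  have : 0 ≤ c * r ^ (-(1 / 128) : ℝ) := by positivity
  rw [← Real.log_le_log_iff (by positivity) (h.ht_pos r),
    Real.log_mul (Real.exp_ne_zero _) (by positivity), Real.log_exp, Real.log_pow]
  push_cast
  linarith

end nondegenerate

section sphericalMean

open Set

variable {n : ℕ}

/-- Integration in polar coordinates. -/
lemma integral_polar (hn : 0 < n) {G : Eu n → ℝ} (hG : Integrable G) :
    ∫ x, G x = ∫ θ, (∫ ρ in Ioi (0 : ℝ), ρ ^ (n - 1) * G (ρ • (θ : Eu n)))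
      ∂(volume : Measure (Eu n)).toSphere := by
  have : Nonempty (Fin n) := ⟨⟨0, hn⟩⟩
  set Φ := homeomorphUnitSphereProd (Eu n)
  have hΦ := (volume : Measure (Eu n)).measurePreserving_homeomorphUnitSphereProd
  rw [finrank_euclideanSpace_fin] at hΦ
  have hemb := Φ.measurableEmbedding
  set H : sphere (0 : Eu n) 1 × Ioi (0 : ℝ) → ℝ := fun p => G ((p.2 : ℝ) • (p.1 : Eu n)) with hH
  have hcomp : ∀ x : ({0}ᶜ : Set (Eu n)), H (Φ x) = G x := by
    intro x
    have hx : ‖(x : Eu n)‖ ≠ 0 := norm_ne_zero_iff.2 x.2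
    simp [hH, Φ, smul_smul, hx]
  have hG' : Integrable (fun x : ({0}ᶜ : Set (Eu n)) => G x)
      ((volume : Measure (Eu n)).comap Subtype.val) :=
    (integrableOn_iff_comap_subtypeVal (measurableSet_singleton (0 : Eu n)).compl).1 hG.integrableOn
  have hHi : Integrable H ((volume : Measure (Eu n)).toSphere.prod (.volumeIoiPow (n - 1))) := by
    rw [← hΦ.integrable_comp_emb hemb]
    exact hG'.congr (.of_forall fun x => (hcomp x).symm)
  calc ∫ x, G x =
        ∫ x : ({0}ᶜ : Set (Eu n)), G x ∂((volume : Measure (Eu n)).comap Subtype.val) := by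
        rw [integral_subtype_comap (measurableSet_singleton _).compl fun x ↦ G x,
          restrict_compl_singleton]
    _ = ∫ p, H p ∂((volume : Measure (Eu n)).toSphere.prod (.volumeIoiPow (n - 1))) := by
        rw [← hΦ.integral_comp hemb]
        exact integral_congr_ae (.of_forall fun x => (hcomp x).symm)
    _ = _ := by
        rw [integral_prod _ hHi]
        refine integral_congr_ae (.of_forall fun θ => ?_)
        simp only [Measure.volumeIoiPow, ENNReal.ofReal, hH]
        rw [integral_withDensity_eq_integral_smul,
          integral_subtype_comap measurableSet_Ioi
            fun a ↦ Real.toNNReal (a ^ (n - 1)) • G (a • (θ : Eu n)),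
          setIntegral_congr_fun measurableSet_Ioi fun x hx ↦ ?_]
        · rw [NNReal.smul_def, Real.coe_toNNReal _ (pow_nonneg hx.out.le _), smul_eq_mul]
        · exact (measurable_subtype_coe.pow_const _).real_toNNReal

lemma hasDerivAt_max_zero_rpow {p : ℝ} (hp : 0 < p) (t : ℝ) :
    HasDerivAt (fun s : ℝ => max s 0 ^ (1 + p)) ((1 + p) * max t 0 ^ p) t := by
  have key : ∀ s, 0 ≤ s → HasDerivAt (fun s : ℝ => s ^ (1 + p)) ((1 + p) * s ^ p) s := fun s _ => by
    simpa using Real.hasDerivAt_rpow_const (x := s) (p := 1 + p) (Or.inr (by linarith))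
  have hz : (0 : ℝ) ^ (1 + p) = 0 := Real.zero_rpow (by linarith)
  have hz' : (0 : ℝ) ^ p = 0 := Real.zero_rpow (by linarith)
  rcases lt_trichotomy t 0 with h | rfl | h
  · rw [max_eq_right h.le, hz', mul_zero]
    refine (hasDerivAt_const t (0 : ℝ)).congr_of_eventuallyEq ?_
    filter_upwards [Iio_mem_nhds h] with s hs
    rw [max_eq_right (le_of_lt hs), hz]
  · rw [max_self, hz', mul_zero]
    have k1 := (key 0 le_rfl).hasDerivWithinAt (s := Ici 0)
    rw [hz', mul_zero] at k1
    have k2 := (hasDerivAt_const (0 : ℝ) (0 : ℝ)).hasDerivWithinAt (s := Iic 0)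
    have c2 : HasDerivWithinAt (fun s : ℝ => max s 0 ^ (1 + p)) 0 (Iic 0) 0 :=
      k2.congr (fun s hs => by rw [max_eq_right (mem_Iic.1 hs), hz]) (by simp [hz])
    have c1 : HasDerivWithinAt (fun s : ℝ => max s 0 ^ (1 + p)) 0 (Ici 0) 0 :=
      k1.congr (fun s hs => by rw [max_eq_left (mem_Ici.1 hs)]) (by simp)
    have := c2.union c1
    rwa [Iic_union_Ici, hasDerivWithinAt_univ] at this
  · rw [max_eq_left h.le]
    refine (key t h.le).congr_of_eventuallyEq ?_
    filter_upwards [Ioi_mem_nhds h] with s hs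
    rw [max_eq_left (le_of_lt hs)]

lemma integral_rpow_mul_euler_nonneg {F : Eu n → ℝ} (hF : ContDiff ℝ ∞ F) (hL : ∀ x, 0 ≤ Lap F x)
    {p : ℝ} (hp : 0 < p) : 0 ≤ ∫ x, max (1 - ‖x‖ ^ 2) 0 ^ p * euler F x := by
  set ψ : Eu n → ℝ := fun x => max (1 - ‖x‖ ^ 2) 0 ^ (1 + p) with hψ
  set w : Eu n → ℝ := fun x => max (1 - ‖x‖ ^ 2) 0 ^ p with hw
  have hwc : Continuous w := by
    refine Continuous.rpow_const (by fun_prop) (fun x => Or.inr hp.le)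
  have hd : ∀ x, HasFDerivAt ψ (-(2 * (1 + p) * w x) • innerSL ℝ x) x := by
    intro x
    have h1 : HasFDerivAt (fun x : Eu n => 1 - ‖x‖ ^ 2) (-(2 • innerSL ℝ x)) x := by
      simpa using ((hasStrictFDerivAt_norm_sq x).hasFDerivAt).const_sub 1
    refine ((hasDerivAt_max_zero_rpow hp (1 - ‖x‖ ^ 2)).comp_hasFDerivAt x h1).congr_fderiv ?_
    ext y
    simp [hw]; ring
  have hdiff : Differentiable ℝ ψ := fun x => (hd x).differentiableAt
  have hpd : ∀ i x, fderiv ℝ ψ x (bv i) = -(2 * (1 + p)) * (w x * x i) := by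
    intro i x
    rw [(hd x).fderiv]
    simp [bv, EuclideanSpace.inner_single_right]; ring
  have hsupp : ∀ q : ℝ, 0 < q → ∀ x : Eu n, x ∉ closedBall (0 : Eu n) 1 →
      max (1 - ‖x‖ ^ 2) 0 ^ q = 0 := by
    intro q hq x hx
    rw [mem_closedBall_zero_iff, not_le] at hx
    rw [max_eq_right (by nlinarith), Real.zero_rpow hq.ne']
  have hwi : ∀ G : Eu n → ℝ, Continuous G → Integrable (fun x => w x * G x) := fun G hG =>
    (hwc.mul hG).integrable_of_hasCompactSupport
      (HasCompactSupport.intro (isCompact_closedBall 0 1) fun x hx => by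
        simp only [hw, hsupp p hp x hx, zero_mul, Pi.mul_apply])
  have hψi : ∀ G : Eu n → ℝ, Continuous G → Integrable (fun x => ψ x * G x) := fun G hG =>
    (hdiff.continuous.mul hG).integrable_of_hasCompactSupport
      (HasCompactSupport.intro (isCompact_closedBall 0 1) fun x hx => by
        simp only [hψ, hsupp (1 + p) (by linarith) x hx, zero_mul, Pi.mul_apply])
  have hc : ∀ i : Fin n, Continuous (fun x : Eu n => x i) := fun i => by fun_prop
  have ibp : ∀ i, ∫ x, ψ x * pd i (pd i F) x = 2 * (1 + p) * ∫ x, w x * (x i * pd i F x) := by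
    intro i
    have e := integral_mul_fderiv_eq_neg_fderiv_mul_of_integrable (μ := volume) (f := ψ)
      (g := pd i F) (v := bv i) ?_ (hψi _ ((hF.pd i).pd i).continuous) (hψi _ (hF.pd i).continuous)
      (fun x _ => hdiff x) (fun x _ => (hF.pd i).diffble x)
    · refine e.trans ?_
      rw [← integral_neg, ← integral_const_mul]
      refine integral_congr_ae (.of_forall fun x => ?_)
      simp only [hpd]; ring
    · refine ((hwi _ ((hc i).mul (hF.pd i).continuous)).const_mul (-(2 * (1 + p)))).congr
        (.of_forall fun x => ?_)
      simp only [hpd, Pi.mul_apply]; ring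
  have e1 : ∫ x, ψ x * Lap F x = 2 * (1 + p) * ∫ x, w x * euler F x := by
    simp only [Lap, euler, Finset.mul_sum]
    rw [integral_finsetSum _ fun i _ => hψi _ ((hF.pd i).pd i).continuous,
      integral_finsetSum (f := fun i x => w x * (x i * pd i F x)) _
        fun i _ => hwi _ ((hc i).mul (hF.pd i).continuous), Finset.mul_sum]
    exact Finset.sum_congr rfl fun i _ => ibp i
  have e2 : 0 ≤ ∫ x, ψ x * Lap F x :=
    integral_nonneg fun x => mul_nonneg (by positivity) (hL x)
  rw [e1] at e2
  exact nonneg_of_mul_nonneg_right e2 (by positivity)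

lemma continuous_euler {F : Eu n → ℝ} (hF : ContDiff ℝ ∞ F) : Continuous (euler F) := by
  unfold euler
  exact continuous_finsetSum _ fun i _ => Continuous.mul (by fun_prop) (hF.pd i).continuous

lemma setIntegral_euler_nonneg {F : Eu n → ℝ} (hF : ContDiff ℝ ∞ F) (hL : ∀ x, 0 ≤ Lap F x) :
    0 ≤ ∫ x in ball 0 1, euler F x := by
  have hlim : Filter.Tendsto
      (fun k : ℕ => ∫ x, max (1 - ‖x‖ ^ 2) 0 ^ (1 / ((k : ℝ) + 1)) * euler F x)
      Filter.atTop (nhds (∫ x, (ball (0 : Eu n) 1).indicator (euler F) x)) := by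
    refine tendsto_integral_of_dominated_convergence
      (fun x => (closedBall (0 : Eu n) 1).indicator (fun x => |euler F x|) x) (fun k => ?_) ?_
      (fun k => .of_forall fun x => ?_) (.of_forall fun x => ?_)
    · have : (0 : ℝ) < 1 / ((k : ℝ) + 1) := by positivity
      refine (Continuous.mul (Continuous.rpow_const (by fun_prop) fun x => Or.inr this.le)
        (continuous_euler hF)).aestronglyMeasurable
    · rw [integrable_indicator_iff measurableSet_closedBall]
      exact (continuous_euler hF).abs.continuousOn.integrableOn_compact (isCompact_closedBall 0 1)
    · have hk : (0 : ℝ) < 1 / ((k : ℝ) + 1) := by positivity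
      by_cases hx : x ∈ closedBall (0 : Eu n) 1
      · rw [indicator_of_mem hx, Real.norm_eq_abs, abs_mul]
        refine mul_le_of_le_one_left (abs_nonneg _) ?_
        rw [abs_of_nonneg (by positivity)]
        refine Real.rpow_le_one (le_max_right _ _) (max_le ?_ zero_le_one) hk.le
        linarith [sq_nonneg ‖x‖]
      · rw [indicator_of_notMem hx]
        rw [mem_closedBall_zero_iff, not_le] at hx
        rw [max_eq_right (by nlinarith), Real.zero_rpow hk.ne']
        simp
    · by_cases hx : x ∈ ball (0 : Eu n) 1
      · rw [indicator_of_mem hx]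
        rw [mem_ball_zero_iff] at hx
        have h0 : 0 < 1 - ‖x‖ ^ 2 := by nlinarith [norm_nonneg x]
        rw [max_eq_left h0.le]
        have := (Real.continuousAt_const_rpow h0.ne' (b := 0)).tendsto.comp
          (tendsto_one_div_add_atTop_nhds_zero_nat (𝕜 := ℝ))
        rw [Real.rpow_zero] at this
        simpa using this.mul_const (euler F x)
      · rw [indicator_of_notMem hx]
        rw [mem_ball_zero_iff, not_lt] at hx
        rw [max_eq_right (by nlinarith)]
        refine tendsto_const_nhds.congr fun k => ?_
        rw [Real.zero_rpow (by positivity), zero_mul]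
  rw [← integral_indicator measurableSet_ball]
  exact ge_of_tendsto' hlim fun k => integral_rpow_mul_euler_nonneg hF hL (by positivity)

lemma setIntegral_ball_polar (hn : 0 < n) {G : Eu n → ℝ} (hG : Continuous G) :
    ∫ x in ball 0 1, G x = ∫ θ, (∫ ρ in (0 : ℝ)..1, ρ ^ (n - 1) * G (ρ • (θ : Eu n)))
      ∂(volume : Measure (Eu n)).toSphere := by
  rw [← integral_indicator measurableSet_ball, integral_polar hn]
  · refine integral_congr_ae (.of_forall fun θ => ?_)
    have hθ : ‖(θ : Eu n)‖ = 1 := by simp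
    simp only
    rw [intervalIntegral.integral_of_le zero_le_one, integral_Ioc_eq_integral_Ioo,
      ← integral_indicator measurableSet_Ioi, ← integral_indicator measurableSet_Ioo]
    congr 1
    ext ρ
    by_cases h0 : 0 < ρ
    · by_cases h1 : ρ < 1
      · have m1 : ρ • (θ : Eu n) ∈ ball (0 : Eu n) 1 := by
          simp [norm_smul, hθ, abs_of_pos h0, h1]
        rw [indicator_of_mem (mem_Ioi.2 h0), indicator_of_mem (mem_Ioo.2 ⟨h0, h1⟩),
          indicator_of_mem m1]
      · have m1 : ρ • (θ : Eu n) ∉ ball (0 : Eu n) 1 := by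
          simp [norm_smul, hθ, abs_of_pos h0]; linarith
        rw [indicator_of_mem (mem_Ioi.2 h0), indicator_of_notMem m1,
          indicator_of_notMem (fun h => h1 (mem_Ioo.1 h).2), mul_zero]
    · rw [indicator_of_notMem (fun h => h0 (mem_Ioi.1 h)),
        indicator_of_notMem (fun h => h0 (mem_Ioo.1 h).1)]
  · rw [integrable_indicator_iff measurableSet_ball]
    exact (hG.continuousOn.integrableOn_compact (isCompact_closedBall 0 1)).mono_set
      ball_subset_closedBall

/-- A subharmonic function has a larger mean over a sphere than over the ball it bounds. -/
lemma setIntegral_ball_le_integral_sphere (hn : 0 < n) {F : Eu n → ℝ} (hF : ContDiff ℝ ∞ F)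
    (hL : ∀ x, 0 ≤ Lap F x) :
    n * ∫ x in ball 0 1, F x ≤ ∫ θ, F θ ∂(volume : Measure (Eu n)).toSphere := by
  have hc := hF.continuous
  have hi : ∀ G : Eu n → ℝ, Continuous G → IntegrableOn G (ball 0 1) := fun G hG =>
    (hG.continuousOn.integrableOn_compact (isCompact_closedBall 0 1)).mono_set
      ball_subset_closedBall
  have key : ∫ x in ball 0 1, (n * F x + euler F x) =
      ∫ θ, F θ ∂(volume : Measure (Eu n)).toSphere := by
    rw [setIntegral_ball_polar hn (by have := continuous_euler hF; fun_prop)]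
    refine integral_congr_ae (.of_forall fun θ => ?_)
    simp only
    have hd : ∀ ρ ∈ uIcc (0 : ℝ) 1, HasDerivAt (fun ρ : ℝ => ρ ^ n * F (ρ • (θ : Eu n)))
        (ρ ^ (n - 1) * (n * F (ρ • (θ : Eu n)) + euler F (ρ • (θ : Eu n)))) ρ := by
      intro ρ _
      have h1 : HasDerivAt (fun ρ : ℝ => F (ρ • (θ : Eu n)))
          (∑ i, (θ : Eu n) i * pd i F (ρ • (θ : Eu n))) ρ := by
        have := hasDerivAt_line hF.diffble 0 (θ : Eu n) ρ
        simp only [zero_add] at this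
        rwa [fderiv_eq_sum_pd] at this
      refine ((hasDerivAt_pow n ρ).mul h1).congr_deriv ?_
      obtain ⟨m, rfl⟩ := Nat.exists_eq_succ_of_ne_zero hn.ne'
      simp only [euler, Nat.succ_eq_add_one, Nat.add_sub_cancel, PiLp.smul_apply, smul_eq_mul,
        mul_assoc, ← Finset.mul_sum]
      ring
    have he := continuous_euler hF
    rw [intervalIntegral.integral_eq_sub_of_hasDerivAt hd
      (Continuous.intervalIntegrable (by fun_prop) _ _)]
    simp [hn.ne']
  rw [← key, integral_add ((hi _ hc).const_mul _) (hi _ (continuous_euler hF)), integral_const_mul]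
  linarith [setIntegral_euler_nonneg hF hL]

end sphericalMean

section hausdorff

open scoped Pointwise

open Set

variable {n : ℕ}

lemma exists_lipschitzOnWith_cubeFace {m : ℕ} (R : ℝ) (i : Fin (m + 1)) {s : ℝ} (hs : s ≠ 0) :
    ∃ K, LipschitzOnWith K (fun y : Fin m → ℝ =>
      (R / ‖(WithLp.toLp 2 (i.insertNth s y : Fin (m + 1) → ℝ) : Eu (m + 1))‖) •
        (WithLp.toLp 2 (i.insertNth s y : Fin (m + 1) → ℝ) : Eu (m + 1))) (Icc (-1) 1) := by
  have h0 : ContDiff ℝ 1 (fun y : Fin m → ℝ =>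
      (WithLp.toLp 2 (i.insertNth s y : Fin (m + 1) → ℝ) : Eu (m + 1))) := by
    rw [contDiff_euclidean]
    intro j
    rcases Fin.eq_self_or_eq_succAbove i j with rfl | ⟨k, rfl⟩
    · simpa using contDiff_const
    · simpa using contDiff_apply ℝ ℝ k
  have hne : ∀ y : Fin m → ℝ,
      (WithLp.toLp 2 (i.insertNth s y : Fin (m + 1) → ℝ) : Eu (m + 1)) ≠ 0 := by
    intro y h
    have := congrArg (fun x : Eu (m + 1) => x i) h
    exact hs (by simpa using this)
  refine ContDiffOn.exists_lipschitzOnWith (n := 1) (ContDiff.contDiffOn ?_) one_ne_zero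
    (convex_Icc _ _) isCompact_Icc
  exact (contDiff_const.div (h0.norm ℝ hne) fun y => norm_ne_zero_iff.2 (hne y)).smul h0

lemma hausdorffMeasure_sphere_lt_top (hn : 1 ≤ n) {R : ℝ} (hR : 0 < R) :
    μH[(n : ℝ) - 1] (sphere (0 : Eu n) R) < ⊤ := by
  obtain ⟨m, rfl⟩ := Nat.exists_eq_add_of_le' hn
  have e : ((m + 1 : ℕ) : ℝ) - 1 = m := by push_cast; ring
  rw [e]
  set g : Fin (m + 1) → ℝ → (Fin m → ℝ) → Eu (m + 1) := fun i s y =>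
      (R / ‖(WithLp.toLp 2 (i.insertNth s y : Fin (m + 1) → ℝ) : Eu (m + 1))‖) •
        (WithLp.toLp 2 (i.insertNth s y : Fin (m + 1) → ℝ) : Eu (m + 1)) with hg
  have hfin : ∀ i s, s ≠ 0 → μH[(m : ℝ)] (g i s '' Icc (-1) 1) < ⊤ := by
    intro i s hs
    obtain ⟨K, hK⟩ := exists_lipschitzOnWith_cubeFace R i hs
    refine (hK.hausdorffMeasure_image_le (Nat.cast_nonneg m)).trans_lt ?_
    refine ENNReal.mul_lt_top (by simp) ?_
    have := hausdorffMeasure_pi_real (ι := Fin m)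
    rw [Fintype.card_fin] at this
    rw [this]
    exact isCompact_Icc.measure_lt_top
  have hcov : sphere (0 : Eu (m + 1)) R ⊆
      ⋃ i, (g i 1 '' Icc (-1) 1 ∪ g i (-1) '' Icc (-1) 1) := by
    intro x hx
    rw [mem_sphere_zero_iff_norm] at hx
    obtain ⟨i, -, hi⟩ := Finset.exists_max_image Finset.univ (fun j => |x j|) ⟨0, Finset.mem_univ _⟩
    have hxi : 0 < |x i| := by
      by_contra h
      have : x = 0 := by
        ext j
        have := (hi j (Finset.mem_univ _)).trans (not_lt.1 h)
        simpa using this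
      rw [this, norm_zero] at hx
      exact hR.ne hx
    set y : Fin m → ℝ := fun j => x (i.succAbove j) / |x i| with hy
    have hyI : y ∈ Icc (-1 : Fin m → ℝ) 1 := by
      have : ∀ j, |y j| ≤ 1 := fun j => by
        rw [hy, abs_div, abs_abs, div_le_one hxi]
        exact hi _ (Finset.mem_univ _)
      exact ⟨fun j => (abs_le.1 (this j)).1, fun j => (abs_le.1 (this j)).2⟩
    have hX : (WithLp.toLp 2 (i.insertNth (x i / |x i|) y : Fin (m + 1) → ℝ) : Eu (m + 1)) =
        |x i|⁻¹ • x := by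
      ext j
      rcases Fin.eq_self_or_eq_succAbove i j with rfl | ⟨k, rfl⟩
      · simp [div_eq_inv_mul]
      · simp [hy, div_eq_inv_mul]
    have hgx : g i (x i / |x i|) y = x := by
      simp only [hg, hX]
      rw [norm_smul, hx, smul_smul, Real.norm_eq_abs, abs_inv, abs_abs]
      have : R / (|x i|⁻¹ * R) * |x i|⁻¹ = 1 := by field_simp
      rw [this, one_smul]
    refine mem_iUnion.2 ⟨i, ?_⟩
    rcases lt_or_gt_of_ne (abs_pos.1 hxi) with h | h
    · right
      rw [abs_of_neg h, div_neg, div_self h.ne] at hgx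
      exact ⟨y, hyI, hgx⟩
    · left
      rw [abs_of_pos h, div_self h.ne'] at hgx
      exact ⟨y, hyI, hgx⟩
  refine (measure_mono hcov).trans_lt ((measure_iUnion_fintype_le _ _).trans_lt ?_)
  refine ENNReal.sum_lt_top.2 fun i _ => (measure_union_le _ _).trans_lt ?_
  exact ENNReal.add_lt_top.2 ⟨hfin i 1 one_ne_zero, hfin i (-1) (by norm_num)⟩

lemma toSphere_closedBall_le (hn : 1 ≤ n) (θ₀ : sphere (0 : Eu n) 1) {d : ℝ} (hd : 0 < d)
    (hd1 : d ≤ 1) : (volume : Measure (Eu n)).toSphere (closedBall θ₀ d) ≤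
      ENNReal.ofReal (n * 2 ^ (n + 1) * volume.real (ball (0 : Eu n) 1) * d ^ (n - 1)) := by
  have hsub : (Ioo (0 : ℝ) 1 • (Subtype.val '' closedBall θ₀ d) : Set (Eu n)) ⊆
      ⋃ j ∈ Finset.range (⌊1 / d⌋₊ + 1), closedBall ((j * d) • (θ₀ : Eu n)) (2 * d) := by
    rintro _ ⟨t, ht, _, ⟨θ, hθ, rfl⟩, rfl⟩
    have hθ' : ‖(θ : Eu n) - θ₀‖ ≤ d := by
      rw [← dist_eq_norm]; exact hθ
    have h0 : ‖(θ₀ : Eu n)‖ = 1 := by simp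
    have htd : 0 ≤ t / d := div_nonneg ht.1.le hd.le
    simp only [mem_iUnion]
    refine ⟨⌊t / d⌋₊, ?_, ?_⟩
    · rw [Finset.mem_range, Nat.lt_succ_iff]
      exact Nat.floor_le_floor (by gcongr; exact ht.2.le)
    · rw [mem_closedBall, dist_eq_norm]
      have e : t • (θ : Eu n) - ((⌊t / d⌋₊ : ℝ) * d) • (θ₀ : Eu n) =
          t • ((θ : Eu n) - θ₀) + (t - ⌊t / d⌋₊ * d) • (θ₀ : Eu n) := by module
      have a1 := Nat.floor_le htd
      have a2 := (Nat.lt_floor_add_one (t / d)).le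
      rw [le_div_iff₀ hd] at a1
      rw [div_le_iff₀ hd] at a2
      change ‖t • (θ : Eu n) - _‖ ≤ _
      rw [e]
      refine (norm_add_le _ _).trans ?_
      rw [norm_smul, norm_smul, h0, mul_one, Real.norm_eq_abs, Real.norm_eq_abs,
        abs_of_pos ht.1, abs_of_nonneg (by linarith)]
      have : t * ‖(θ : Eu n) - θ₀‖ ≤ 1 * d := by
        gcongr
        exact ht.2.le
      linarith
  rw [Measure.toSphere_apply' _ measurableSet_closedBall, finrank_euclideanSpace_fin]
  have hV : ∀ x : Eu n, volume (closedBall x (2 * d)) =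
      ENNReal.ofReal ((2 * d) ^ n * volume.real (ball (0 : Eu n) 1)) := by
    intro x
    rw [Measure.addHaar_closedBall _ _ (by positivity), finrank_euclideanSpace_fin,
      ENNReal.ofReal_mul (by positivity), ofReal_measureReal]
  calc _ ≤ (n : ENNReal) * ∑ j ∈ Finset.range (⌊1 / d⌋₊ + 1),
        volume (closedBall ((j * d) • (θ₀ : Eu n)) (2 * d)) := by
        gcongr
        exact (measure_mono hsub).trans (measure_biUnion_finset_le _ _)
    _ = ENNReal.ofReal
          (n * ((⌊1 / d⌋₊ + 1) * ((2 * d) ^ n * volume.real (ball (0 : Eu n) 1)))) := by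
        simp only [hV]
        rw [Finset.sum_const, Finset.card_range, nsmul_eq_mul,
          ENNReal.ofReal_mul (p := (n : ℝ)) (by positivity),
          ENNReal.ofReal_natCast, ENNReal.ofReal_mul (p := (⌊1 / d⌋₊ : ℝ) + 1) (by positivity),
          ENNReal.ofReal_add (by positivity) zero_le_one]
        simp
    _ ≤ _ := by
        refine ENNReal.ofReal_le_ofReal ?_
        have a1 := Nat.floor_le (by positivity : 0 ≤ 1 / d)
        rw [le_div_iff₀ hd] at a1
        obtain ⟨m, rfl⟩ := Nat.exists_eq_add_of_le' hn
        have : ((⌊1 / d⌋₊ : ℝ) + 1) * d ≤ 2 := by linarith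
        calc _ = (m + 1 : ℕ) * volume.real (ball (0 : Eu (m + 1)) 1) * 2 ^ (m + 1) * d ^ m *
              (((⌊1 / d⌋₊ : ℝ) + 1) * d) := by ring
          _ ≤ (m + 1 : ℕ) * volume.real (ball (0 : Eu (m + 1)) 1) * 2 ^ (m + 1) * d ^ m * 2 := by
              gcongr
          _ = _ := by simp; ring

/-- The cone measure on spheres is dominated by the Hausdorff measure. -/
lemma exists_toSphere_le_hausdorffMeasure (hn : 2 ≤ n) : ∃ c : ℝ, 0 < c ∧ ∀ R : ℝ, 0 < R →
    ENNReal.ofReal (c * R ^ (n - 1)) •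
      (volume : Measure (Eu n)).toSphere.map (fun θ : sphere (0 : Eu n) 1 => R • (θ : Eu n)) ≤
      μH[(n : ℝ) - 1] := by
  set C : ℝ := n * 2 ^ (n + 1) * volume.real (ball (0 : Eu n) 1) with hC
  have hV : 0 < volume.real (ball (0 : Eu n) 1) :=
    ENNReal.toReal_pos (measure_ball_pos volume (0 : Eu n) one_pos).ne' measure_ball_lt_top.ne
  have n0 : (0 : ℝ) < n := by exact_mod_cast (by omega : 0 < n)
  have C0 : 0 < C := by positivity
  refine ⟨1 / C, by positivity, fun R hR => ?_⟩
  refine Measure.le_hausdorffMeasure _ _ (ENNReal.ofReal R) (by simpa using hR) fun s hs => ?_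
  have hmeas : Measurable (fun θ : sphere (0 : Eu n) 1 => R • (θ : Eu n)) := by fun_prop
  set P := (fun θ : sphere (0 : Eu n) 1 => R • (θ : Eu n)) ⁻¹' closure s with hP
  have hfin : ediam s ≠ ⊤ := (hs.trans_lt ENNReal.ofReal_lt_top).ne
  set δ := (ediam s).toReal with hδ
  have hδ0 : 0 ≤ δ := ENNReal.toReal_nonneg
  have hδs : ediam s = ENNReal.ofReal δ := (ENNReal.ofReal_toReal hfin).symm
  have hδR : δ ≤ R := by
    rw [hδs] at hs
    exact (ENNReal.ofReal_le_ofReal_iff hR.le).1 hs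
  have hexp : (n : ℝ) - 1 = ((n - 1 : ℕ) : ℝ) := by
    rw [Nat.cast_sub (by omega)]; simp
  have hle : ∀ d, δ / R ≤ d → 0 < d → d ≤ 1 →
      (volume : Measure (Eu n)).toSphere P ≤ ENNReal.ofReal (C * d ^ (n - 1)) := by
    intro d hd d0 d1
    rcases P.eq_empty_or_nonempty with hPe | ⟨θ₀, hθ₀⟩
    · simp [hPe]
    refine (measure_mono fun θ hθ => ?_).trans (toSphere_closedBall_le (by omega) θ₀ d0 d1)
    have h1 := edist_le_ediam_of_mem (s := closure s) hθ hθ₀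
    rw [ediam_closure, hδs, edist_dist, ENNReal.ofReal_le_ofReal_iff hδ0, dist_smul₀,
      Real.norm_eq_abs, abs_of_pos hR] at h1
    rw [mem_closedBall, Subtype.dist_eq]
    refine le_trans ?_ hd
    rw [le_div_iff₀ hR]; linarith
  have hmain : ((volume : Measure (Eu n)).toSphere.map
      (fun θ : sphere (0 : Eu n) 1 => R • (θ : Eu n))) s ≤
      (volume : Measure (Eu n)).toSphere P := by
    refine (measure_mono subset_closure).trans_eq ?_
    rw [Measure.map_apply hmeas isClosed_closure.measurableSet]
  rw [Measure.smul_apply, smul_eq_mul, hexp, ENNReal.rpow_natCast, hδs]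
  rcases hδ0.eq_or_lt with h | h
  · have hz : (volume : Measure (Eu n)).toSphere P = 0 := by
      refine le_antisymm ?_ zero_le
      have hlim : Filter.Tendsto (fun d : ℝ => ENNReal.ofReal (C * d ^ (n - 1)))
          (nhdsWithin 0 (Ioi 0)) (nhds (ENNReal.ofReal (C * 0 ^ (n - 1)))) :=
        (Continuous.tendsto (ENNReal.continuous_ofReal.comp (by fun_prop)) 0).mono_left
          nhdsWithin_le_nhds
      rw [zero_pow (by omega), mul_zero, ENNReal.ofReal_zero] at hlim
      refine ge_of_tendsto hlim ?_
      filter_upwards [Ioc_mem_nhdsGT one_pos] with d hd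
      exact hle d (by rw [← h, zero_div]; exact hd.1.le) hd.1 hd.2
    rw [hz] at hmain
    simp [le_antisymm hmain zero_le]
  · calc _ ≤ ENNReal.ofReal (1 / C * R ^ (n - 1)) * ENNReal.ofReal (C * (δ / R) ^ (n - 1)) := by
          gcongr
          exact hmain.trans (hle _ le_rfl (by positivity) ((div_le_one hR).2 hδR))
      _ = _ := by
          rw [← ENNReal.ofReal_mul (by positivity), ← ENNReal.ofReal_pow hδ0]
          congr 1
          rw [div_pow]; field_simp

lemma integrableOn_sphere_hausdorffMeasure (hn : 1 ≤ n) {f : Eu n → ℝ} (hf : Continuous f) {R : ℝ}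
    (hR : 0 < R) : IntegrableOn f (sphere 0 R) μH[(n : ℝ) - 1] := by
  obtain ⟨B, hB⟩ := (isCompact_sphere (0 : Eu n) R).exists_bound_of_continuousOn hf.continuousOn
  exact Measure.integrableOn_of_bounded (hausdorffMeasure_sphere_lt_top hn hR).ne
    hf.aestronglyMeasurable ((ae_restrict_mem isClosed_sphere.measurableSet).mono hB)

lemma exists_le_integral_sphere (hn : 2 ≤ n) : ∃ c : ℝ, 0 < c ∧ ∀ f : Eu n → ℝ, Continuous f →
    (∀ x, 0 ≤ f x) → ∀ R, 0 < R →
      c * R ^ (n - 1) * ∫ θ, f (R • (θ : Eu n)) ∂(volume : Measure (Eu n)).toSphere ≤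
        ∫ y in sphere 0 R, f y ∂μH[(n : ℝ) - 1] := by
  obtain ⟨c, c0, hc⟩ := exists_toSphere_le_hausdorffMeasure hn
  refine ⟨c, c0, fun f hf h0 R hR => ?_⟩
  set φ : sphere (0 : Eu n) 1 → Eu n := fun θ => R • (θ : Eu n) with hφ
  have hmeas : Measurable φ := by fun_prop
  set ν := ENNReal.ofReal (c * R ^ (n - 1)) • (volume : Measure (Eu n)).toSphere.map φ with hν
  have hrest : ν.restrict (sphere 0 R) = ν := by
    refine Measure.restrict_eq_self_of_ae_mem ?_
    refine Measure.ae_smul_measure ?_ _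
    refine (ae_map_iff hmeas.aemeasurable isClosed_sphere.measurableSet).2 (.of_forall fun θ => ?_)
    simp [hφ, norm_smul, abs_of_pos hR]
  have hle : ν ≤ μH[(n : ℝ) - 1].restrict (sphere 0 R) := by
    rw [← hrest]
    exact Measure.restrict_mono le_rfl (hc R hR)
  have := integral_mono_measure hle (.of_forall h0)
    (integrableOn_sphere_hausdorffMeasure (by omega) hf hR)
  refine le_trans (le_of_eq ?_) this
  rw [hν, integral_smul_measure, integral_map hmeas.aemeasurable hf.aestronglyMeasurable,
    ENNReal.toReal_ofReal (by positivity), smul_eq_mul]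

end hausdorff

section sphericalGrowth

variable {n : ℕ} {u v : Eu n → ℝ} {C₀ : ℝ}

lemma Lap_comp_smul (hf : ContDiff ℝ ∞ u) (r : ℝ) (x : Eu n) :
    Lap (fun y => u (r • y)) x = r ^ 2 * Lap u (r • x) := by
  unfold Lap
  rw [Finset.mul_sum]
  refine Finset.sum_congr rfl fun i _ => ?_
  have h1 : pd i (fun x => u (r • x)) = fun x => r * pd i u (r • x) := by
    simpa using pd_translate_smul hf.diffble 0 r i
  have h2 : pd i (fun x => pd i u (r • x)) = fun x => r * pd i (pd i u) (r • x) := by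
    simpa using pd_translate_smul (hf.pd i).diffble 0 r i
  rw [h1, pd_const_mul (f := fun x => pd i u (r • x))
    ((hf.pd i).diffble.comp (differentiable_id.const_smul r)), h2]
  ring

lemma IsSolution.toSol (hsol : IsSolution u v)
    (hg : ∀ x, u x + v x ≤ C₀ * (1 + ‖x‖)) : Sol u v := by
  obtain ⟨su, sv, pu, pv, eu, ev⟩ := hsol
  have eu' : ∀ x, Lap u x = u x * v x ^ 2 := fun x => by rw [← eu, lap_eq_sum_pd su]; rfl
  have ev' : ∀ x, Lap v x = v x * u x ^ 2 := fun x => by rw [← ev, lap_eq_sum_pd sv]; rfl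
  have bu : PB u := ⟨1, C₀, fun x => by rw [abs_of_pos (pu x), pow_one]; linarith [hg x, pv x]⟩
  have bv : PB v := ⟨1, C₀, fun x => by rw [abs_of_pos (pv x), pow_one]; linarith [hg x, pu x]⟩
  have pg := PG_solution su sv bu bv eu' ev'
  exact ⟨hasTemperateGrowth_of_PG fun k => (pg k).1, hasTemperateGrowth_of_PG fun k => (pg k).2,
    pu, pv, eu', ev'⟩

/-- The Gaussian second moment is controlled by the mean over a large ball, up to a small error. -/
lemma ht_le_setIntegral_ball (hu : Continuous u) (pu : ∀ x, 0 < u x) (hC₀ : 0 < C₀)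
    (hg : ∀ x, u x ≤ C₀ * (1 + ‖x‖)) {A r : ℝ} (hA : 0 < A) (hr : 1 ≤ r) :
    ht u r ≤ C₀ * (1 + A * r) * ((gmass n)⁻¹ * A ^ n * ∫ y in ball 0 1, u ((A * r) • y)) +
      C₀ ^ 2 * r ^ 2 / A * ∫ z, (1 + ‖z‖) ^ 3 ∂(gam n) := by
  have r0 : 0 < r := by linarith
  have gm := gmass_pos n
  set B := ball (0 : Eu n) A
  have hcr : Continuous fun z : Eu n => u (r • z) := by fun_prop
  have hib : IntegrableOn (fun z : Eu n => u (r • z)) B :=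
    (hcr.continuousOn.integrableOn_compact (isCompact_closedBall 0 A)).mono_set
      ball_subset_closedBall
  have hPB : PB (fun z : Eu n => u (r • z)) := by
    refine ⟨1, C₀ * r, fun z => ?_⟩
    rw [abs_of_pos (pu _), pow_one]
    refine (hg _).trans ?_
    rw [norm_smul, Real.norm_eq_abs, abs_of_pos r0, mul_assoc]
    gcongr
    nlinarith [norm_nonneg z]
  have hi1 : Integrable (B.indicator fun z => u (r • z)) (gam n) :=
    (hPB.integrable hcr).indicator measurableSet_ball
  have hi3 := integrable_one_add_norm_pow n 3
  have hi2 : Integrable (fun z : Eu n => u (r • z) ^ 2) (gam n) := by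
    have := (hPB.mul hPB).integrable (by fun_prop)
    simpa only [sq] using this
  have hpt : ∀ z, u (r • z) ^ 2 ≤ C₀ * (1 + A * r) * B.indicator (fun z => u (r • z)) z +
      C₀ ^ 2 * r ^ 2 / A * (1 + ‖z‖) ^ 3 := by
    intro z
    have hz := norm_nonneg z
    have g1 := hg (r • z)
    have g0 := pu (r • z)
    rw [norm_smul, Real.norm_eq_abs, abs_of_pos r0] at g1
    by_cases hB : z ∈ B
    · rw [Set.indicator_of_mem hB, sq]
      rw [mem_ball_zero_iff] at hB
      have : u (r • z) ≤ C₀ * (1 + A * r) := g1.trans (by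
        have := mul_le_mul_of_nonneg_left hB.le r0.le
        exact mul_le_mul_of_nonneg_left (by linarith) hC₀.le)
      have : u (r • z) * u (r • z) ≤ C₀ * (1 + A * r) * u (r • z) := by gcongr
      have : 0 ≤ C₀ ^ 2 * r ^ 2 / A * (1 + ‖z‖) ^ 3 := by positivity
      linarith
    · rw [Set.indicator_of_notMem hB, mul_zero, zero_add]
      rw [mem_ball_zero_iff, not_lt] at hB
      have k1 : u (r • z) ≤ C₀ * (r * (1 + ‖z‖)) := g1.trans (by gcongr; nlinarith)
      calc u (r • z) ^ 2 ≤ (C₀ * (r * (1 + ‖z‖))) ^ 2 := by gcongr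
        _ = C₀ ^ 2 * r ^ 2 / A * (1 + ‖z‖) ^ 2 * A := by field_simp
        _ ≤ C₀ ^ 2 * r ^ 2 / A * (1 + ‖z‖) ^ 2 * (1 + ‖z‖) := by gcongr; linarith
        _ = _ := by ring
  have hball : ∫ z, B.indicator (fun z => u (r • z)) z ∂(gam n) ≤
      (gmass n)⁻¹ * A ^ n * ∫ y in ball 0 1, u ((A * r) • y) := by
    have hsc : ∫ z in B, u (r • z) = A ^ n * ∫ y in ball 0 1, u ((A * r) • y) := by
      have := Measure.setIntegral_comp_smul_of_pos (volume : Measure (Eu n)) (fun z => u (r • z))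
        (ball (0 : Eu n) 1) hA
      rw [finrank_euclideanSpace_fin, smul_unitBall_of_pos hA] at this
      simp only [smul_smul, mul_comm r A] at this
      rw [this, smul_eq_mul, ← mul_assoc, mul_inv_cancel₀ (by positivity), one_mul]
    rw [mul_assoc, ← hsc, integral_gam, ← integral_indicator measurableSet_ball,
      ← integral_const_mul]
    refine integral_mono (integrable_gam_iff.1 hi1)
      (((integrable_indicator_iff measurableSet_ball).2 hib).const_mul _) fun z => ?_
    refine mul_le_mul_of_nonneg_right ?_ (Set.indicator_nonneg (fun z _ => (pu _).le) z)
    unfold gdens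
    refine mul_le_of_le_one_right (by positivity) (Real.exp_le_one_iff.2 ?_)
    nlinarith [sq_nonneg ‖z‖]
  calc ht u r ≤ ∫ z, (C₀ * (1 + A * r) * B.indicator (fun z => u (r • z)) z +
        C₀ ^ 2 * r ^ 2 / A * (1 + ‖z‖) ^ 3) ∂(gam n) :=
        integral_mono hi2 ((hi1.const_mul _).add (hi3.const_mul _)) hpt
    _ = C₀ * (1 + A * r) * ∫ z, B.indicator (fun z => u (r • z)) z ∂(gam n) +
        C₀ ^ 2 * r ^ 2 / A * ∫ z, (1 + ‖z‖) ^ 3 ∂(gam n) := by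
        rw [integral_add (hi1.const_mul _) (hi3.const_mul _), integral_const_mul,
          integral_const_mul]
    _ ≤ _ := by gcongr

lemma exists_setIntegral_ball_ge (hu : Continuous u) (pu : ∀ x, 0 < u x) (hC₀ : 0 < C₀)
    (hg : ∀ x, u x ≤ C₀ * (1 + ‖x‖)) {c T : ℝ} (hc : 0 < c)
    (hT : ∀ r, T ≤ r → c * r ^ 2 ≤ ht u r) :
    ∃ c' > 0, ∃ R₀, ∀ R, R₀ ≤ R → c' * R ≤ ∫ y in ball 0 1, u (R • y) := by
  have gm := gmass_pos n
  set K := ∫ z, (1 + ‖z‖) ^ 3 ∂(gam n)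
  have K0 : 0 ≤ K := integral_nonneg fun z => by positivity
  set A := max 1 (2 * C₀ ^ 2 * K / c)
  have A1 : 1 ≤ A := le_max_left _ _
  have A0 : 0 < A := by linarith
  have hA : C₀ ^ 2 * K / A ≤ c / 2 := by
    have : 2 * C₀ ^ 2 * K / c ≤ A := le_max_right _ _
    rw [div_le_iff₀ hc] at this
    rw [div_le_iff₀ A0]; linarith
  refine ⟨c * gmass n / (4 * C₀ * A ^ (n + 2)), by positivity, A * max 1 T, fun R hR => ?_⟩
  obtain ⟨r, rfl⟩ : ∃ r, R = A * r := ⟨R / A, by field_simp⟩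
  have hr := le_of_mul_le_mul_left hR A0
  have r1 : 1 ≤ r := (le_max_left _ _).trans hr
  have r0 : 0 < r := by linarith
  have h1 := hT r ((le_max_right _ _).trans hr)
  have h2 := ht_le_setIntegral_ball hu pu hC₀ hg A0 r1
  set I := ∫ y in ball 0 1, u ((A * r) • y)
  have I0 : 0 ≤ I := integral_nonneg fun y => (pu _).le
  have h3 : C₀ ^ 2 * r ^ 2 / A * K ≤ c / 2 * r ^ 2 := by
    calc _ = C₀ ^ 2 * K / A * r ^ 2 := by ring
      _ ≤ _ := by gcongr
  have h4 : C₀ * (1 + A * r) * ((gmass n)⁻¹ * A ^ n * I) ≤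
      C₀ * (2 * (A * r)) * ((gmass n)⁻¹ * A ^ n * I) := by
    gcongr; nlinarith
  have h5 : c / 2 * r ^ 2 ≤ 2 * C₀ * A ^ (n + 1) * (gmass n)⁻¹ * I * r := by
    calc _ ≤ C₀ * (2 * (A * r)) * ((gmass n)⁻¹ * A ^ n * I) := by linarith
      _ = _ := by ring
  have h6 : c / 2 * r ≤ 2 * C₀ * A ^ (n + 1) * (gmass n)⁻¹ * I :=
    le_of_mul_le_mul_right (by linarith [h5]) r0
  calc _ = (c / 2 * r) * (gmass n / (2 * C₀ * A ^ (n + 1))) := by field_simp; ring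
    _ ≤ (2 * C₀ * A ^ (n + 1) * (gmass n)⁻¹ * I) * (gmass n / (2 * C₀ * A ^ (n + 1))) := by gcongr
    _ = _ := by field_simp

/-- Linear lower bound for the spherical means. -/
lemma Sol.exists_integral_toSphere_ge (h : Sol u v) (hn : 2 ≤ n) (hC₀ : 0 < C₀)
    (hg : ∀ x, u x + v x ≤ C₀ * (1 + ‖x‖)) :
    ∃ c > 0, ∀ R, 4 < R → c * R ≤ ∫ θ, u (R • (θ : Eu n)) ∂(volume : Measure (Eu n)).toSphere := by
  have hu : ContDiff ℝ ∞ u := h.tu.1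
  have n0 : (0 : ℝ) < n := by exact_mod_cast (by omega : 0 < n)
  have : Nontrivial (Eu n) := Module.nontrivial_of_finrank_pos (R := ℝ) (by simp; omega)
  obtain ⟨c, c0, T, -, hT⟩ := h.exists_ht_ge hg
  obtain ⟨c', hc', R₀, hR₀⟩ := exists_setIntegral_ball_ge hu.continuous h.pu hC₀
    (fun x => by linarith [hg x, h.pv x]) c0 hT
  obtain ⟨x₀, -, hx₀⟩ := (isCompact_closedBall (0 : Eu n) (max R₀ 4)).exists_isMinOn
    ⟨0, by simp⟩ hu.continuous.continuousOn
  set σ := (volume : Measure (Eu n)).toSphere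
  have σ0 : 0 < σ.real Set.univ := by
    rw [measureReal_def]
    exact ENNReal.toReal_pos (Measure.measure_univ_ne_zero.2 (Measure.toSphere_ne_zero _))
      (measure_ne_top _ _)
  have M0 : 0 < max R₀ 4 := by positivity
  have m0 := h.pu x₀
  refine ⟨min (n * c') (u x₀ * σ.real Set.univ / max R₀ 4), by positivity, fun R hR => ?_⟩
  have R0 : 0 < R := by linarith
  rcases le_total R₀ R with hRR | hRR
  · have hs : ContDiff ℝ ∞ (fun y => u (R • y)) := hu.comp (contDiff_id.const_smul R)
    have := setIntegral_ball_le_integral_sphere (by omega) hs fun x => by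
      rw [Lap_comp_smul hu]
      exact mul_nonneg (sq_nonneg R) (h.lap_nonneg _)
    refine le_trans ?_ this
    calc _ ≤ n * c' * R := by gcongr; exact min_le_left _ _
      _ = n * (c' * R) := by ring
      _ ≤ _ := by gcongr; exact hR₀ R hRR
  · calc _ ≤ u x₀ * σ.real Set.univ / max R₀ 4 * max R₀ 4 := by
          gcongr
          · exact min_le_right _ _
          · exact hRR.trans (le_max_left _ _)
      _ = ∫ _, u x₀ ∂σ := by rw [integral_const, smul_eq_mul]; field_simp
      _ ≤ _ := by
          have hcont : Continuous fun θ : sphere (0 : Eu n) 1 => u (R • (θ : Eu n)) := by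
            have := hu.continuous; fun_prop
          refine integral_mono (integrable_const _)
            (hcont.integrable_of_hasCompactSupport (HasCompactSupport.of_compactSpace _))
            fun θ => hx₀ ?_
          simp [norm_smul, abs_of_pos R0, hRR]

end sphericalGrowth

/-- Nondegeneracy: for an entire solution with linear growth there is C > 0 with
∫_{∂B_r(0)} (u + v) ≥ rⁿ / C for all r > 4. -/
theorem nondegeneracy {n : ℕ} (hn : 2 ≤ n)
    (u v : EuclideanSpace ℝ (Fin n) → ℝ) (hsol : IsSolution u v)
    (C₀ : ℝ) (hC₀ : 0 < C₀) (hgrowth : ∀ x, u x + v x ≤ C₀ * (1 + ‖x‖)) :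
    ∃ C : ℝ, 0 < C ∧ ∀ r : ℝ, 4 < r →
      r ^ n / C ≤ ∫ y in sphere (0 : EuclideanSpace ℝ (Fin n)) r,
        (u y + v y) ∂μH[(n : ℝ) - 1] := by
  have h := hsol.toSol hgrowth
  have hcu : Continuous u := hsol.1.continuous
  have hcv : Continuous v := hsol.2.1.continuous
  obtain ⟨c₁, hc₁, h₁⟩ := exists_le_integral_sphere hn
  obtain ⟨c₂, hc₂, h₂⟩ := h.exists_integral_toSphere_ge hn hC₀ hgrowth
  refine ⟨1 / (c₁ * c₂), by positivity, fun r hr => ?_⟩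
  have r0 : 0 < r := by linarith
  have hintg : ∀ f : Eu n → ℝ, Continuous f →
      Integrable (fun θ : sphere (0 : Eu n) 1 => f (r • (θ : Eu n)))
        (volume : Measure (Eu n)).toSphere := fun f hf =>
    Continuous.integrable_of_hasCompactSupport (by fun_prop) (HasCompactSupport.of_compactSpace _)
  refine le_trans ?_ (h₁ (fun x => u x + v x) (by fun_prop)
    (fun x => (add_pos (h.pu x) (h.pv x)).le) r r0)
  obtain ⟨m, rfl⟩ := Nat.exists_eq_add_of_le' (le_of_lt hn)
  calc r ^ (m + 1) / (1 / (c₁ * c₂)) = c₁ * r ^ m * (c₂ * r) := by field_simp; ring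
    _ ≤ c₁ * r ^ m * ∫ θ, u (r • (θ : Eu (m + 1))) ∂(volume : Measure (Eu (m + 1))).toSphere := by
        gcongr
        exact h₂ r hr
    _ ≤ _ := by
        rw [Nat.add_sub_cancel]
        refine mul_le_mul_of_nonneg_left (integral_mono (hintg u hcu)
          (hintg (fun x => u x + v x) (by fun_prop)) fun θ => ?_) (by positivity)
        exact le_add_of_nonneg_right (h.pv _).le
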